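/- arXiv:1603.04539 — 3 statements merged into one kernel-verified Lean document; each statement's English description precedes it below -/
import Mathlib

section
/- Let f : 𝕋 → ℝ be a continuous real-valued function on the circle 𝕋 = ℝ/2πℤ. Then there exists a homeomorphism h of 𝕋 onto itself such that the superposition f∘h belongs to the Sobolev space W₂^{1/2}(𝕋), i.e., Σ_{k∈ℤ} |(f∘h)^(k)|²·|k| < ∞. -/
open scoped Real

section Helpers
open scoped Real ENNReal
open MeasureTheory AddCircle

namespace SH

lemma parseval [Fact ((0:ℝ) < 2 * π)] (g : C(AddCircle (2 * π), ℂ)) :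
    ∫⁻ x, ‖g x‖ₑ ^ 2 ∂haarAddCircle = ∑' k : ℤ, ‖fourierCoeff g k‖ₑ ^ 2 := by
  have h := hasSum_sq_fourierCoeff (ContinuousMap.toLp (E := ℂ) 2 haarAddCircle ℂ g)
  simp_rw [fourierCoeff_toLp] at h
  have h2 : ∫ t : AddCircle (2 * π), ‖(ContinuousMap.toLp (E := ℂ) 2 haarAddCircle ℂ g) t‖ ^ 2 ∂haarAddCircle
      = ∫ t : AddCircle (2 * π), ‖g t‖ ^ 2 ∂haarAddCircle := by
    apply integral_congr_ae
    filter_upwards [ContinuousMap.coeFn_toLp (p := 2) (𝕜 := ℂ) haarAddCircle g] with x hx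
    rw [hx]
  rw [h2] at h
  have h3 : ∑' k : ℤ, ‖fourierCoeff g k‖ₑ ^ 2 = ENNReal.ofReal (∑' k : ℤ, ‖fourierCoeff g k‖ ^ 2) := by
    rw [ENNReal.ofReal_tsum_of_nonneg (fun _ => by positivity) h.summable]
    congr 1; ext k
    rw [ENNReal.ofReal_pow (norm_nonneg _), ofReal_norm]
  rw [h3, h.tsum_eq, ofReal_integral_eq_lintegral_ofReal]
  · congr 1; ext k
    rw [ENNReal.ofReal_pow (norm_nonneg _), ofReal_norm]
  · exact (Continuous.integrable_of_hasCompactSupport (by fun_prop) (HasCompactSupport.of_compactSpace _))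
  · exact Filter.Eventually.of_forall fun x => by positivity

noncomputable def kap (t : AddCircle (2 * π)) : ℝ≥0∞ := (‖(fourier 1 t : ℂ) - 1‖ₑ ^ 2)⁻¹

lemma kap_meas : Measurable kap := by
  unfold kap
  refine Measurable.inv (Measurable.pow_const (Continuous.measurable ?_) 2)
  fun_prop

lemma norm_fourier (k : ℤ) (t : AddCircle (2 * π)) : ‖(fourier k t : ℂ)‖ = 1 := by
  rw [fourier_apply]; exact Circle.norm_coe _

lemma four_pow (n : ℕ) (t : AddCircle (2 * π)) : (fourier (n:ℤ) t : ℂ) = (fourier 1 t) ^ n := by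
  induction n with
  | zero => simp
  | succ n ih => push_cast; rw [fourier_add, ih, pow_succ]

lemma four_ne_one [Fact ((0:ℝ) < 2 * π)] (t : AddCircle (2 * π)) (ht : t ≠ 0) : (fourier 1 t : ℂ) ≠ 1 := by
  intro h
  apply ht
  apply injective_toCircle (T := 2 * π) (by positivity)
  rw [fourier_one] at h
  ext
  rw [h]; simp

lemma int_kap_nat [Fact ((0:ℝ) < 2 * π)] (n : ℕ) :
    ∫⁻ t, ‖(fourier (n:ℤ) t : ℂ) - 1‖ₑ ^ 2 * kap t ∂haarAddCircle = n := by
  let g : C(AddCircle (2 * π), ℂ) := ∑ j ∈ Finset.range n, fourier (j:ℤ)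
  have hae : ∀ᵐ t ∂(haarAddCircle (T := 2 * π)), ‖(fourier (n:ℤ) t : ℂ) - 1‖ₑ ^ 2 * kap t = ‖g t‖ₑ ^ 2 := by
    have h0 : ∀ᵐ t ∂(haarAddCircle (T := 2 * π)), t ≠ 0 := by
      have hv : ∀ᵐ t : AddCircle (2 * π), t ≠ 0 := by
        rw [ae_iff]
        simp only [ne_eq, not_not, Set.ofPred_eq_eq_singleton]
        have := volume_closedBall (T := 2 * π) (x := 0) 0
        simpa using this
      rw [volume_eq_smul_haarAddCircle] at hv
      have hne : ENNReal.ofReal (2 * π) ≠ 0 := by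
        simp [Real.pi_pos]
      rw [ae_iff] at hv ⊢
      simpa [hne, Real.pi_pos.not_ge] using hv
    filter_upwards [h0] with t ht
    have h1 := four_ne_one t ht
    have hg : g t = ∑ j ∈ Finset.range n, (fourier 1 t : ℂ) ^ j := by
      simp only [g, ContinuousMap.sum_apply, four_pow]
    have h2 : (fourier (n:ℤ) t : ℂ) - 1 = g t * (fourier 1 t - 1) := by
      rw [hg, geom_sum_mul, four_pow]
    have h3 : ‖(fourier 1 t : ℂ) - 1‖ₑ ≠ 0 := by
      simpa [sub_eq_zero] using h1
    rw [h2, kap, enorm_mul, mul_pow, mul_assoc, ENNReal.mul_inv_cancel, mul_one]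
    · exact pow_ne_zero _ h3
    · exact ENNReal.pow_ne_top enorm_ne_top
  rw [lintegral_congr_ae hae, parseval]
  have hc : ∀ k : ℤ, fourierCoeff g k = if k ∈ (Finset.range n).image (fun j : ℕ => (j:ℤ)) then 1 else 0 := by
    intro k
    have : (g : AddCircle (2 * π) → ℂ) = ∑ j ∈ Finset.range n, (fourier (j:ℤ) : AddCircle (2 * π) → ℂ) := by
      ext x; simp [g]
    rw [this, fourierCoeff.sum]
    · simp only [fourierCoeff_fourier, Finset.sum_apply]
      rw [Finset.sum_congr rfl (fun j _ => Pi.single_apply _ _ _)]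
      split_ifs with h
      · simp only [Finset.mem_image, Finset.mem_range] at h
        obtain ⟨j, hj, rfl⟩ := h
        simp [hj]
      · apply Finset.sum_eq_zero
        intro j hj
        rw [if_neg]
        rintro rfl
        exact h (Finset.mem_image_of_mem _ hj)
    · intro j _
      exact (Continuous.integrable_of_hasCompactSupport (by fun_prop) (HasCompactSupport.of_compactSpace _))
  rw [tsum_eq_sum (s := (Finset.range n).image (fun j : ℕ => (j:ℤ)))]
  · rw [Finset.sum_congr rfl (g := fun _ => 1)]
    · simp [Finset.card_image_of_injective _ Nat.cast_injective]
    · intro k hk; rw [hc, if_pos hk]; simp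
  · intro k hk; rw [hc, if_neg hk]; simp

lemma int_kap [Fact ((0:ℝ) < 2 * π)] (k : ℤ) :
    ∫⁻ t, ‖1 - (fourier (-k) t : ℂ)‖ₑ ^ 2 * kap t ∂haarAddCircle = ‖(k:ℝ)‖ₑ := by
  have h1 : ∀ t : AddCircle (2 * π), ‖1 - (fourier (-k) t : ℂ)‖ₑ = ‖(fourier (k.natAbs : ℤ) t : ℂ) - 1‖ₑ := by
    intro t
    have h2 : ‖1 - (fourier (-k) t : ℂ)‖ = ‖(fourier k t : ℂ) - 1‖ := by
      have : (fourier k t : ℂ) - 1 = fourier k t * (1 - fourier (-k) t) := by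
        rw [mul_sub, ← fourier_add]; simp
      rw [this, norm_mul, norm_fourier, one_mul]
    have h3 : ‖1 - (fourier (-k) t : ℂ)‖ = ‖(fourier (-k) t : ℂ) - 1‖ := norm_sub_rev _ _
    rw [← ofReal_norm, ← ofReal_norm]
    congr 1
    rcases Int.natAbs_eq k with h | h
    · rw [← h]; exact h2
    · have h4 : -k = (k.natAbs : ℤ) := by omega
      rw [h3, h4]
  simp_rw [h1]
  rw [int_kap_nat]
  rw [← ofReal_norm, Real.norm_eq_abs, ← Int.cast_abs, Int.abs_eq_natAbs, Int.cast_natCast,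
    ENNReal.ofReal_natCast]

lemma coeff_diff [Fact ((0:ℝ) < 2 * π)] (G : C(AddCircle (2 * π), ℂ)) (t : AddCircle (2 * π)) (k : ℤ) :
    fourierCoeff (fun x => G x - G (x - t)) k = (1 - fourier (-k) t) * fourierCoeff G k := by
  have hi : ∀ H : AddCircle (2 * π) → ℂ, Continuous H → Integrable H haarAddCircle := fun H hH =>
    (Continuous.integrable_of_hasCompactSupport hH (HasCompactSupport.of_compactSpace _))
  unfold fourierCoeff
  simp only [smul_eq_mul, mul_sub]
  rw [integral_sub (hi _ (by fun_prop)) (hi _ (by fun_prop)), sub_mul, one_mul]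
  congr 1
  rw [← integral_add_right_eq_self _ t, ← integral_const_mul]
  congr 1; ext x
  rw [add_sub_cancel_right, fourier_apply, smul_add, toCircle_add, Circle.coe_mul, ← fourier_apply, ← fourier_apply]
  ring

lemma douglas_circle [Fact ((0:ℝ) < 2 * π)] (G : C(AddCircle (2 * π), ℂ)) :
    ∫⁻ x, ∫⁻ y, ‖G x - G y‖ₑ ^ 2 * kap (x - y) ∂haarAddCircle ∂haarAddCircle
      = ∑' k : ℤ, ‖fourierCoeff G k‖ₑ ^ 2 * ‖(k:ℝ)‖ₑ := by
  have h1 : ∀ x, ∫⁻ y, ‖G x - G y‖ₑ ^ 2 * kap (x - y) ∂haarAddCircle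
      = ∫⁻ t, ‖G x - G (x - t)‖ₑ ^ 2 * kap t ∂haarAddCircle := by
    intro x
    rw [← lintegral_sub_left_eq_self _ x]
    simp
  simp_rw [h1]
  rw [lintegral_lintegral_swap]
  swap
  · apply Measurable.aemeasurable
    apply Measurable.mul
    · exact Continuous.measurable (f := fun z : AddCircle (2 * π) × AddCircle (2 * π) =>
        ‖G z.1 - G (z.1 - z.2)‖ₑ ^ 2) (by fun_prop)
    · exact kap_meas.comp measurable_snd
  have h2 : ∀ t, ∫⁻ x, ‖G x - G (x - t)‖ₑ ^ 2 * kap t ∂haarAddCircle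
      = ∑' k : ℤ, ‖fourierCoeff G k‖ₑ ^ 2 * (‖1 - (fourier (-k) t : ℂ)‖ₑ ^ 2 * kap t) := by
    intro t
    rw [lintegral_mul_const _ (Continuous.measurable (by fun_prop))]
    have := parseval ⟨fun x => G x - G (x - t), by fun_prop⟩
    simp only [ContinuousMap.coe_mk, coeff_diff] at this
    rw [this, ← ENNReal.tsum_mul_right]
    congr 1; ext k
    rw [enorm_mul, mul_pow]; ring
  simp_rw [h2]
  rw [lintegral_tsum]
  swap
  · intro k
    apply Measurable.aemeasurable
    apply Measurable.const_mul
    exact (Continuous.measurable (by fun_prop)).mul kap_meas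
  congr 1; ext k
  rw [lintegral_const_mul, int_kap]
  exact (Continuous.measurable (by fun_prop)).mul kap_meas

/-- squared kernel on the line -/
noncomputable def Kr (x y : ℝ) : ℝ≥0∞ := kap ((x : AddCircle (2 * π)) - (y : AddCircle (2 * π)))

noncomputable def mu : Measure ℝ := volume.restrict (Set.Ioc 0 (2 * π))

noncomputable def En {F : Type*} [NormedAddCommGroup F] (g : ℝ → F) : ℝ≥0∞ :=
  ∫⁻ z : ℝ × ℝ, ‖g z.1 - g z.2‖ₑ ^ 2 * Kr z.1 z.2 ∂(mu.prod mu)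

lemma Kr_meas : Measurable (fun z : ℝ × ℝ => Kr z.1 z.2) := by
  unfold Kr
  apply kap_meas.comp
  exact Continuous.measurable (by fun_prop)

instance : IsFiniteMeasure mu := by unfold mu; infer_instance

lemma douglas [Fact ((0:ℝ) < 2 * π)] (G : C(AddCircle (2 * π), ℂ)) :
    En (fun x : ℝ => G (x : AddCircle (2 * π))) =
     ENNReal.ofReal (2 * π) ^ 2 * ∑' k : ℤ, ‖fourierCoeff G k‖ₑ ^ 2 * ‖(k:ℝ)‖ₑ := by
  unfold En
  rw [lintegral_prod]
  swap
  · apply Measurable.aemeasurable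
    exact (Continuous.measurable (by fun_prop)).mul Kr_meas
  have key : ∀ f : AddCircle (2 * π) → ℝ≥0∞, ∫⁻ x, f x ∂mu = ENNReal.ofReal (2 * π) * ∫⁻ x, f x ∂haarAddCircle := by
    intro f
    have := AddCircle.lintegral_preimage (2 * π) 0 f
    rw [zero_add, volume_eq_smul_haarAddCircle, lintegral_smul_measure] at this
    exact this
  unfold Kr
  have h1 : ∀ x : ℝ, ∫⁻ y : ℝ, ‖G x - G y‖ₑ ^ 2 * kap ((x : AddCircle (2 * π)) - y) ∂mu
    = ENNReal.ofReal (2 * π) * ∫⁻ y, ‖G x - G y‖ₑ ^ 2 * kap (x - y) ∂haarAddCircle :=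
    fun x => key (fun y => ‖G x - G y‖ₑ ^ 2 * kap (x - y))
  simp only [h1]
  rw [key (fun x => ENNReal.ofReal (2 * π) * ∫⁻ y, ‖G x - G y‖ₑ ^ 2 * kap (x - y) ∂haarAddCircle),
    lintegral_const_mul' _ _ ENNReal.ofReal_ne_top, douglas_circle]
  ring

end SH


namespace SH

lemma dd_eq (x y : ℝ) : ‖(fourier 1 ((x : AddCircle (2 * π)) - (y : AddCircle (2 * π))) : ℂ) - 1‖
    = 2 * |Real.sin ((x - y) / 2)| := by
  rw [← AddCircle.coe_sub, fourier_coe_apply]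
  have h := Complex.norm_exp_I_mul_ofReal_sub_one (x - y)
  have h2 : (2 * π * Complex.I * ((1:ℤ):ℂ) * ((x - y : ℝ) : ℂ) / ((2 * π : ℝ) : ℂ)) = Complex.I * ((x - y : ℝ) : ℂ) := by
    push_cast
    have : (π : ℂ) ≠ 0 := by exact_mod_cast Real.pi_ne_zero
    field_simp
  rw [h2, h]
  simp

lemma ae_mem : ∀ᵐ z ∂(mu.prod mu), z.1 ∈ Set.Ioc 0 (2 * π) ∧ z.2 ∈ Set.Ioc 0 (2 * π) := by
  have h : ∀ᵐ x ∂mu, x ∈ Set.Ioc 0 (2 * π) := by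
    unfold mu; exact ae_restrict_mem measurableSet_Ioc
  exact (Measure.quasiMeasurePreserving_fst.ae h).and (Measure.quasiMeasurePreserving_snd.ae h)

variable {F F' : Type*} [NormedAddCommGroup F] [NormedAddCommGroup F']

lemma En_mono {g : ℝ → F} {g' : ℝ → F'} (h : ∀ x ∈ Set.Ioc 0 (2 * π), ∀ y ∈ Set.Ioc 0 (2 * π), ‖g x - g y‖ ≤ ‖g' x - g' y‖) :
    En g ≤ En g' := by
  apply lintegral_mono_ae
  filter_upwards [ae_mem] with z hz
  gcongr
  exact enorm_le_iff_norm_le.2 (h _ hz.1 _ hz.2)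

lemma En_smul (c : ℝ) (g : ℝ → ℝ) : En (fun x => c * g x) = ENNReal.ofReal (c ^ 2) * En g := by
  unfold En
  rw [← lintegral_const_mul' _ _ ENNReal.ofReal_ne_top]
  congr 1; ext z
  rw [← mul_sub, enorm_mul, mul_pow, ← mul_assoc]
  congr 2
  rw [← ofReal_norm, ← ENNReal.ofReal_pow (norm_nonneg _)]
  simp

lemma En_neg (g : ℝ → ℝ) : En (fun x => - g x) = En g := by
  have := En_smul (-1) g
  simpa using this

lemma En_add {f g : ℝ → ℝ} (hf : Continuous f) (t : ℝ) (ht : 0 < t) :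
    En (fun x => f x + g x) ≤ ENNReal.ofReal (1 + t) * En f + ENNReal.ofReal (1 + 1 / t) * En g := by
  unfold En
  rw [← lintegral_const_mul' _ _ ENNReal.ofReal_ne_top, ← lintegral_const_mul' _ _ ENNReal.ofReal_ne_top,
    ← lintegral_add_left]
  swap
  · apply Measurable.const_mul
    exact (Continuous.measurable (by fun_prop)).mul Kr_meas
  apply lintegral_mono
  intro z
  simp only
  rw [← mul_assoc, ← mul_assoc, ← add_mul]
  gcongr
  rw [← ofReal_norm, ← ofReal_norm, ← ofReal_norm, ← ENNReal.ofReal_pow (norm_nonneg _), ← ENNReal.ofReal_pow (norm_nonneg _),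
    ← ENNReal.ofReal_pow (norm_nonneg _), ← ENNReal.ofReal_mul (by positivity), ← ENNReal.ofReal_mul (by positivity),
    ← ENNReal.ofReal_add (by positivity) (by positivity)]
  apply ENNReal.ofReal_le_ofReal
  simp only [Real.norm_eq_abs, sq_abs]
  set a := f z.1 - f z.2
  set b := g z.1 - g z.2
  have : f z.1 + g z.1 - (f z.2 + g z.2) = a + b := by simp only [a, b]; ring
  rw [this]
  have h1 : (1 + t) * a ^ 2 + (1 + 1 / t) * b ^ 2 - (a + b) ^ 2 = (t * a - b) ^ 2 / t := by
    field_simp; ring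
  have h2 : 0 ≤ (t * a - b) ^ 2 / t := by positivity
  linarith

lemma En_step (n : ℕ) : ∃ ε : ℝ, 0 < ε ∧ ∀ f g : ℝ → ℝ, Continuous f → En f ≤ ENNReal.ofReal (2 - (1/2) ^ n) →
    En g ≤ ENNReal.ofReal ε → En (fun x => f x + g x) ≤ ENNReal.ofReal (2 - (1/2) ^ (n + 1)) := by
  set a : ℝ := (1/2) ^ n with ha
  have ha0 : 0 < a := by positivity
  have ha1 : a ≤ 1 := pow_le_one₀ (by norm_num) (by norm_num)
  refine ⟨(a / 4) / (1 + 1 / (a / 8)), by positivity, fun f g hf h1 h2 => ?_⟩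
  refine (En_add hf (a / 8) (by positivity)).trans ?_
  calc _ ≤ ENNReal.ofReal (1 + a / 8) * ENNReal.ofReal (2 - a) + ENNReal.ofReal (1 + 1 / (a / 8)) *
        ENNReal.ofReal ((a / 4) / (1 + 1 / (a / 8))) := by gcongr
    _ = ENNReal.ofReal ((1 + a / 8) * (2 - a) + a / 4) := by
        rw [← ENNReal.ofReal_mul (by positivity), ← ENNReal.ofReal_mul (by positivity), ← ENNReal.ofReal_add]
        · congr 2; field_simp
        · apply mul_nonneg <;> linarith
        · positivity
    _ ≤ _ := by
        apply ENNReal.ofReal_le_ofReal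
        rw [pow_succ, ← ha]
        nlinarith

lemma En_fatou {S : ℕ → ℝ → ℝ} {g : ℝ → ℝ} (hS : ∀ n, Continuous (S n)) (hlim : ∀ x, Filter.Tendsto (fun n => S n x) Filter.atTop (nhds (g x)))
    (C : ℝ≥0∞) (hC : ∀ n, En (S n) ≤ C) : En g ≤ C := by
  have h : En g ≤ ∫⁻ z : ℝ × ℝ, Filter.liminf (fun n => ‖S n z.1 - S n z.2‖ₑ ^ 2 * Kr z.1 z.2) Filter.atTop ∂(mu.prod mu) := by
    apply lintegral_mono
    intro z
    simp only
    by_cases hz : g z.1 - g z.2 = 0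
    · simp [hz]
    have ht : Filter.Tendsto (fun n => ‖S n z.1 - S n z.2‖ₑ ^ 2 * Kr z.1 z.2) Filter.atTop (nhds (‖g z.1 - g z.2‖ₑ ^ 2 * Kr z.1 z.2)) := by
      apply ENNReal.Tendsto.mul_const
      · exact ENNReal.Tendsto.pow ((hlim z.1).sub (hlim z.2)).enorm
      · left; simpa using hz
    rw [ht.liminf_eq]
  refine h.trans ((lintegral_liminf_le ?_).trans ?_)
  · intro n
    have := hS n
    exact (Continuous.measurable (by fun_prop)).mul Kr_meas
  · refine Filter.liminf_le_of_le (by isBoundedDefault) ?_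
    intro b hb
    obtain ⟨n, hn⟩ := hb.exists
    exact hn.trans (hC n)

lemma lip_dd {w : ℝ → ℝ} {L : ℝ} (hw : ∀ x y, |w x - w y| ≤ L * |x - y|) (h0 : w 0 = 0) (h1 : w (2 * π) = 0)
    (x y : ℝ) (hx : x ∈ Set.Ioc 0 (2 * π)) (hy : y ∈ Set.Ioc 0 (2 * π)) : |w x - w y| ≤ (2 * L) * (2 * |Real.sin ((x - y) / 2)|) := by
  have hL : 0 ≤ L := by
    have := (abs_nonneg _).trans (hw 0 1); simpa using this
  wlog hxy : y ≤ x generalizing x y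
  · have := this y x hy hx (by linarith)
    rw [abs_sub_comm]
    refine this.trans_eq ?_
    rw [show (y - x) / 2 = - ((x - y) / 2) by ring, Real.sin_neg, abs_neg]
  have hπ := Real.pi_pos
  have hpi4 := Real.pi_le_four
  obtain ⟨hx0, hx1⟩ := hx
  obtain ⟨hy0, hy1⟩ := hy
  by_cases hc : x - y ≤ π
  · have h := Real.mul_le_sin (x := (x - y) / 2) (by linarith) (by linarith)
    have h2 : (x - y) / 4 ≤ |Real.sin ((x - y) / 2)| := by
      refine le_trans ?_ (h.trans (le_abs_self _))
      rw [show 2 / π * ((x - y) / 2) = (x - y) / π by ring]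
      apply div_le_div_of_nonneg_left <;> linarith
    have h3 := hw x y
    rw [abs_of_nonneg (by linarith : 0 ≤ x - y)] at h3
    nlinarith
  · push Not at hc
    have h := Real.mul_le_sin (x := π - (x - y) / 2) (by linarith) (by linarith)
    rw [Real.sin_pi_sub] at h
    have h2 : (2 * π - (x - y)) / 4 ≤ |Real.sin ((x - y) / 2)| := by
      refine le_trans ?_ (h.trans (le_abs_self _))
      rw [show 2 / π * (π - (x - y) / 2) = (2 * π - (x - y)) / π by field_simp]
      apply div_le_div_of_nonneg_left <;> linarith
    have h3 := hw x (2 * π)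
    have h4 := hw 0 y
    rw [h0, zero_sub, abs_neg, zero_sub, abs_neg, abs_of_pos hy0] at h4
    rw [h1, sub_zero, abs_sub_comm x, abs_of_nonneg (by linarith : 0 ≤ 2 * π - x)] at h3
    have h5 := abs_sub (w x) (w y)
    nlinarith

lemma lip_small (L δ : ℝ) (hL : 0 ≤ L) (hδ : 0 < δ) : ∃ η > 0, ∀ w : ℝ → ℝ, (∀ x y, |w x - w y| ≤ L * |x - y|) →
    w 0 = 0 → w (2 * π) = 0 → (∀ x, |w x| ≤ η) → En w ≤ ENNReal.ofReal δ := by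
  let d : ℝ × ℝ → ℝ := fun z => 2 * |Real.sin ((z.1 - z.2) / 2)|
  have hd0 : ∀ z, 0 ≤ d z := fun z => by positivity
  have hdc : Continuous d := by fun_prop
  have hKr : ∀ z : ℝ × ℝ, Kr z.1 z.2 = (ENNReal.ofReal (d z ^ 2))⁻¹ := by
    intro z
    unfold Kr kap
    rw [← ofReal_norm, dd_eq, ENNReal.ofReal_pow (hd0 z)]
  let Φ : ℕ → ℝ × ℝ → ℝ≥0∞ := fun n z => ENNReal.ofReal ((min (2 * (1 / ((n:ℝ) + 1))) (2 * L * d z)) ^ 2) * Kr z.1 z.2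
  have hlim : Filter.Tendsto (fun n => ∫⁻ z, Φ n z ∂(mu.prod mu)) Filter.atTop (nhds (∫⁻ z, 0 ∂(mu.prod mu))) := by
    apply tendsto_lintegral_of_dominated_convergence (fun _ => ENNReal.ofReal ((2 * L) ^ 2))
    · intro n
      exact (ENNReal.continuous_ofReal.comp (by fun_prop)).measurable.mul Kr_meas
    · intro n
      refine Filter.Eventually.of_forall fun z => ?_
      simp only [Φ]
      by_cases hz : d z = 0
      · have : min (2 * (1 / ((n:ℝ) + 1))) (2 * L * d z) = 0 := by
          rw [hz, mul_zero]; apply min_eq_right; positivity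
        rw [this]; simp
      · have hpos : 0 < d z := lt_of_le_of_ne (hd0 z) (Ne.symm hz)
        rw [hKr, ← div_eq_mul_inv]
        apply ENNReal.div_le_of_le_mul
        rw [← ENNReal.ofReal_mul (by positivity), ← mul_pow]
        apply ENNReal.ofReal_le_ofReal
        apply pow_le_pow_left₀
        · apply le_min <;> positivity
        · exact min_le_right _ _
    · simp only [lintegral_const]
      exact ENNReal.mul_ne_top ENNReal.ofReal_ne_top (measure_ne_top _ _)
    · refine Filter.Eventually.of_forall fun z => ?_
      by_cases hz : d z = 0
      · have : ∀ n, Φ n z = 0 := by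
          intro n
          have : min (2 * (1 / ((n:ℝ) + 1))) (2 * L * d z) = 0 := by
            rw [hz, mul_zero]; apply min_eq_right; positivity
          simp only [Φ]; rw [this]; simp
        simp [this]
      · have hpos : 0 < d z := lt_of_le_of_ne (hd0 z) (Ne.symm hz)
        have h1 : Filter.Tendsto (fun n : ℕ => (min (2 * (1 / ((n:ℝ) + 1))) (2 * L * d z)) ^ 2) Filter.atTop (nhds 0) := by
          have := ((tendsto_one_div_add_atTop_nhds_zero_nat (𝕜 := ℝ)).const_mul 2).min (tendsto_const_nhds (x := 2 * L * d z))
          have := this.pow 2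
          rw [mul_zero, min_eq_left (by positivity)] at this
          simpa using this
        have h2 := ENNReal.Tendsto.mul_const (b := Kr z.1 z.2) (ENNReal.tendsto_ofReal h1) (Or.inr ?_)
        · simpa only [ENNReal.ofReal_zero, zero_mul] using h2
        · rw [hKr]; simp [hz]
  simp only [lintegral_zero] at hlim
  have hev := hlim.eventually (Iic_mem_nhds (show (0:ℝ≥0∞) < ENNReal.ofReal δ by simpa using hδ))
  obtain ⟨n, hn⟩ := hev.exists
  refine ⟨1 / ((n:ℝ) + 1), by positivity, fun w hw h0 h1 hb => ?_⟩
  refine le_trans ?_ hn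
  apply lintegral_mono_ae
  filter_upwards [ae_mem] with z hz
  simp only [Φ]
  gcongr
  rw [← ofReal_norm, ← ENNReal.ofReal_pow (norm_nonneg _)]
  apply ENNReal.ofReal_le_ofReal
  apply pow_le_pow_left₀ (norm_nonneg _)
  rw [Real.norm_eq_abs]
  apply le_min
  · have := abs_sub (w z.1) (w z.2)
    have := hb z.1
    have := hb z.2
    linarith
  · exact lip_dd hw h0 h1 _ _ hz.1 hz.2

end SH


namespace SH

lemma hasSum_cg {ι E : Type*} [AddCommMonoid E] [TopologicalSpace E] {f g : ι → E} {a : E} (h : ∀ i, f i = g i) :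
    HasSum f a ↔ HasSum g a := by rw [funext h]

/-- log potential -/
noncomputable def Bl (r s : ℝ) : ℝ := -(1/2) * Real.log (1 - 2 * r * Real.cos s + r ^ 2)

lemma Bl_arg (r s : ℝ) (hr0 : 0 ≤ r) : (1 - r) ^ 2 ≤ 1 - 2 * r * Real.cos s + r ^ 2 := by
  nlinarith [Real.cos_le_one s, mul_le_mul_of_nonneg_left (Real.cos_le_one s) hr0]

lemma Bl_eq (r s : ℝ) : Bl r s = - Real.log ‖1 - (r:ℂ) * Complex.exp (Complex.I * s)‖ := by
  have h : ‖1 - (r:ℂ) * Complex.exp (Complex.I * s)‖ ^ 2 = 1 - 2 * r * Real.cos s + r ^ 2 := by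
    rw [← Complex.normSq_eq_norm_sq, mul_comm Complex.I, Complex.exp_mul_I, Complex.normSq_apply]
    simp [← Complex.ofReal_cos, ← Complex.ofReal_sin]
    nlinarith [Real.sin_sq_add_cos_sq s]
  rw [Bl, ← h, Real.log_pow]; push_cast; ring

lemma Bl_anti {r s t : ℝ} (hr0 : 0 ≤ r) (hr1 : r < 1) (h : Real.cos t ≤ Real.cos s) : Bl r t ≤ Bl r s := by
  have h1 := Bl_arg r s hr0
  have h2 : 0 < (1 - r) ^ 2 := by have : 0 < 1 - r := by linarith
                                  positivity
  have := Real.log_le_log (lt_of_lt_of_le h2 h1) (show 1 - 2 * r * Real.cos s + r ^ 2 ≤ 1 - 2 * r * Real.cos t + r ^ 2 by nlinarith)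
  unfold Bl; linarith

lemma log_lip {a b m : ℝ} (hm : 0 < m) (ha : m ≤ a) (hb : m ≤ b) : |Real.log a - Real.log b| ≤ |a - b| / m := by
  wlog hab : b ≤ a generalizing a b
  · rw [abs_sub_comm, abs_sub_comm a]; exact this hb ha (by linarith)
  have hb0 : 0 < b := by linarith
  have ha0 : 0 < a := by linarith
  rw [abs_of_nonneg (by linarith [Real.log_le_log hb0 hab]), abs_of_nonneg (by linarith), ← Real.log_div ha0.ne' hb0.ne']
  have h1 := Real.log_le_sub_one_of_pos (div_pos ha0 hb0)
  have h2 : a / b - 1 = (a - b) / b := by field_simp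
  rw [h2] at h1
  refine h1.trans (div_le_div_of_nonneg_left (by linarith) hm hb)

lemma Bl_lip {r : ℝ} (hr0 : 0 ≤ r) (hr1 : r < 1) (s t : ℝ) : |Bl r s - Bl r t| ≤ (1 / (1 - r) ^ 2) * |s - t| := by
  have h2 : 0 < (1 - r) ^ 2 := by have : 0 < 1 - r := by linarith
                                  positivity
  have h := log_lip h2 (Bl_arg r s hr0) (Bl_arg r t hr0)
  have hc : |Real.cos s - Real.cos t| ≤ |s - t| := Real.abs_cos_sub_cos_le s t
  have e1 : Bl r s - Bl r t = -(1/2) * (Real.log (1 - 2 * r * Real.cos s + r ^ 2) - Real.log (1 - 2 * r * Real.cos t + r ^ 2)) := by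
    unfold Bl; ring
  have e2 : (1 - 2 * r * Real.cos s + r ^ 2) - (1 - 2 * r * Real.cos t + r ^ 2) = -(2 * r) * (Real.cos s - Real.cos t) := by ring
  rw [e2, abs_mul, abs_neg, abs_of_nonneg (by linarith : 0 ≤ 2 * r)] at h
  rw [e1, abs_mul, abs_neg, abs_of_pos (by norm_num : (0:ℝ) < 1/2)]
  calc _ ≤ 1 / 2 * (2 * r * |Real.cos s - Real.cos t| / (1 - r) ^ 2) := by gcongr
    _ = r * |Real.cos s - Real.cos t| / (1 - r) ^ 2 := by ring
    _ ≤ 1 * |s - t| / (1 - r) ^ 2 := by gcongr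
    _ = _ := by ring

lemma hasSum_Bl [Fact ((0:ℝ) < 2 * π)] {r : ℝ} (hr0 : 0 ≤ r) (hr1 : r < 1) (s : ℝ) :
    HasSum (fun k : ℤ => ((r ^ k.natAbs / (2 * k.natAbs) : ℝ) : ℂ) * fourier k (s : AddCircle (2 * π))) (Bl r s : ℂ) := by
  set z : ℂ := (r:ℂ) * fourier 1 (s : AddCircle (2 * π)) with hz
  have hzn : ‖z‖ < 1 := by
    rw [hz, norm_mul, norm_fourier, mul_one, Complex.norm_real, Real.norm_eq_abs, abs_of_nonneg hr0]; exact hr1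
  have h1 := (Complex.hasSum_taylorSeries_neg_log hzn).div_const 2
  have h2 := (Complex.hasSum_conj'.2 (Complex.hasSum_taylorSeries_neg_log hzn)).div_const 2
  have h3 : fourier 1 (s : AddCircle (2 * π)) = Complex.exp (Complex.I * s) := by
    rw [fourier_coe_apply]
    congr 1
    push_cast
    have : (π : ℂ) ≠ 0 := by exact_mod_cast Real.pi_ne_zero
    field_simp
  have h4 : (Bl r s : ℂ) = -Complex.log (1 - z) / 2 + (starRingEnd ℂ) (-Complex.log (1 - z)) / 2 - 0 := by
    rw [sub_zero, ← add_div, Complex.add_conj, Bl_eq]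
    simp [hz, h3, Complex.log_re]
    ring
  rw [h4]
  have h5 := HasSum.of_nat_of_neg (f := fun k : ℤ => ((r ^ k.natAbs / (2 * k.natAbs) : ℝ) : ℂ) * fourier k (s : AddCircle (2 * π)))
    (g := -Complex.log (1 - z) / 2) (g' := (starRingEnd ℂ) (-Complex.log (1 - z)) / 2) ?_ ?_
  · simpa using h5
  · refine (hasSum_cg fun n => ?_).2 h1
    rw [four_pow, hz, mul_pow]
    simp
    ring
  · refine (hasSum_cg fun n => ?_).2 h2
    rw [fourier_neg, four_pow, hz]
    simp
    ring

lemma En_Bl [Fact ((0:ℝ) < 2 * π)] {r : ℝ} (hr0 : 0 ≤ r) (hr1 : r < 1) (p : ℝ) :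
    En (fun x => Bl r (x - p)) ≤ ENNReal.ofReal (2 * π ^ 2 * (- Real.log (1 - r))) := by
  let c : ℤ → ℂ := fun k => ((r ^ k.natAbs / (2 * k.natAbs) : ℝ) : ℂ) * fourier k ((-p : ℝ) : AddCircle (2 * π))
  have hcn : ∀ k, ‖c k‖ = r ^ k.natAbs / (2 * k.natAbs) := by
    intro k
    simp only [c]
    rw [norm_mul, norm_fourier, mul_one, Complex.norm_real, Real.norm_eq_abs, abs_of_nonneg (by positivity)]
  have hsumN : Summable (fun n : ℕ => r ^ n / (2 * n)) := by
    refine Summable.of_nonneg_of_le (fun n => by positivity) (fun n => ?_) (summable_geometric_of_lt_one hr0 hr1)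
    rcases Nat.eq_zero_or_pos n with rfl | hn
    · simp
    · apply div_le_self (by positivity)
      have : (1:ℝ) ≤ n := by exact_mod_cast hn
      linarith
  have hsum : Summable (fun k => ‖c k‖) := by
    simp_rw [hcn]
    apply Summable.of_nat_of_neg <;> simpa using hsumN
  have hsumC : Summable (fun k => c k • (fourier k : C(AddCircle (2 * π), ℂ))) := by
    apply Summable.of_norm
    simpa only [norm_smul, fourier_norm, mul_one] using hsum
  obtain ⟨G, hG⟩ := hsumC
  have hGx : ∀ x : ℝ, G (x : AddCircle (2 * π)) = Bl r (x - p) := by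
    intro x
    have h1 := (ContinuousMap.evalCLM ℂ (x : AddCircle (2 * π))).hasSum hG
    have h2 := hasSum_Bl hr0 hr1 (x - p)
    refine HasSum.unique h1 ?_
    convert h2 using 2 with k
    simp only [c, ContinuousMap.evalCLM_apply, ContinuousMap.smul_apply, smul_eq_mul]
    rw [mul_assoc]
    congr 1
    rw [sub_eq_add_neg, AddCircle.coe_add, fourier_apply, fourier_apply, fourier_apply, smul_add, toCircle_add, Circle.coe_mul]
    ring
  have hGc : ∀ k, fourierCoeff G k = c k := by
    intro k
    have h1 := (ContinuousMap.toLp (E := ℂ) 2 haarAddCircle ℂ).hasSum hG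
    have h2 := (fourierBasis (T := 2 * π)).repr.toContinuousLinearEquiv.toContinuousLinearMap.hasSum h1
    have h3 := (lp.evalCLM ℂ (fun _ : ℤ => ℂ) 2 k).hasSum h2
    have h4 : ∀ H : C(AddCircle (2 * π), ℂ), (lp.evalCLM ℂ (fun _ : ℤ => ℂ) 2 k) ((fourierBasis (T := 2 * π)).repr.toContinuousLinearEquiv.toContinuousLinearMap (ContinuousMap.toLp (E := ℂ) 2 haarAddCircle ℂ H)) = fourierCoeff H k := by
      intro H
      rw [← fourierCoeff_toLp, ← fourierBasis_repr]
      rfl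
    rw [h4] at h3
    refine HasSum.unique h3 ?_
    have h5 : ∀ j, ((lp.evalCLM ℂ (fun _ : ℤ => ℂ) 2 k) ((fourierBasis (T := 2 * π)).repr.toContinuousLinearEquiv.toContinuousLinearMap (ContinuousMap.toLp (E := ℂ) 2 haarAddCircle ℂ (c j • fourier j)))) = if j = k then c k else 0 := by
      intro j
      rw [h4, ContinuousMap.coe_smul]
      have := fourierCoeff.const_smul (fourier j : AddCircle (2 * π) → ℂ) (c j) k
      rw [this, fourierCoeff_fourier, Pi.single_apply]
      split_ifs with h1 h2 h2
      · rw [h2]; simp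
      · exact absurd h1.symm h2
      · exact absurd h2.symm h1
      · simp
    exact (hasSum_cg h5).2 (hasSum_ite_eq k (c k))
  have hEn : En (fun x => Bl r (x - p)) = En (fun x : ℝ => G (x : AddCircle (2 * π))) := by
    apply le_antisymm <;> apply En_mono <;> intro x _ y _ <;> rw [hGx, hGx, ← Complex.ofReal_sub, Complex.norm_real]
  rw [hEn, douglas]
  have hs1 : HasSum (fun n : ℕ => r ^ (2 * n) / (4 * n)) (-Real.log (1 - r ^ 2) / 4) := by
    have := (Real.hasSum_pow_div_log_of_abs_lt_one (x := r ^ 2) (by rw [abs_of_nonneg (by positivity)]; nlinarith)).div_const 4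
    rw [← hasSum_nat_add_iff' 1]
    simp only [Finset.range_one, Finset.sum_singleton, Nat.cast_zero, mul_zero, div_zero, sub_zero]
    refine (hasSum_cg fun n => ?_).2 this
    push_cast
    rw [← pow_mul]
    field_simp
  have hs2 : HasSum (fun k : ℤ => ‖c k‖ ^ 2 * ‖(k:ℝ)‖) (-Real.log (1 - r ^ 2) / 4 + -Real.log (1 - r ^ 2) / 4 - 0) := by
    have hterm : ∀ k : ℤ, ‖c k‖ ^ 2 * ‖(k:ℝ)‖ = r ^ (2 * k.natAbs) / (4 * k.natAbs) := by
      intro k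
      rw [hcn]
      have : ‖(k:ℝ)‖ = k.natAbs := by
        rw [Real.norm_eq_abs, ← Int.cast_abs, Int.abs_eq_natAbs, Int.cast_natCast]
      rw [this]
      rcases Nat.eq_zero_or_pos k.natAbs with h | h
      · rw [h]; simp
      · have : (k.natAbs : ℝ) ≠ 0 := by exact_mod_cast h.ne'
        rw [pow_mul, pow_right_comm]
        field_simp; norm_num
    simp_rw [hterm]
    have := HasSum.of_nat_of_neg (f := fun k : ℤ => r ^ (2 * k.natAbs) / (4 * (k.natAbs:ℝ))) (by simpa using hs1) (by simpa using hs1)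
    simpa using this
  have hs3 : ∑' k : ℤ, ‖fourierCoeff G k‖ₑ ^ 2 * ‖(k:ℝ)‖ₑ = ENNReal.ofReal (∑' k : ℤ, ‖c k‖ ^ 2 * ‖(k:ℝ)‖) := by
    rw [ENNReal.ofReal_tsum_of_nonneg (fun _ => by positivity) hs2.summable]
    congr 1; ext k
    rw [ENNReal.ofReal_mul (by positivity), ENNReal.ofReal_pow (norm_nonneg _), ofReal_norm, ofReal_norm, hGc]
  rw [hs3, hs2.tsum_eq, ← ENNReal.ofReal_pow (by positivity), ← ENNReal.ofReal_mul (by positivity)]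
  apply ENNReal.ofReal_le_ofReal
  have h1 : Real.log (1 - r) ≤ Real.log (1 - r ^ 2) := Real.log_le_log (by linarith) (by nlinarith)
  have : 0 ≤ π ^ 2 := by positivity
  nlinarith

lemma spike [Fact ((0:ℝ) < 2 * π)] {p ρ : ℝ} (hρ : 0 < ρ) (h0 : ρ ≤ p) (h1 : p + ρ ≤ 2 * π) (ε : ℝ) (hε : 0 < ε) (hρ' : ρ < π) :
    ∃ (ψ : ℝ → ℝ) (L : ℝ), 0 ≤ L ∧ (∀ x y, |ψ x - ψ y| ≤ L * |x - y|) ∧ ψ p = 1 ∧ (∀ x, 0 ≤ ψ x) ∧ (∀ x, ψ x ≤ 1) ∧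
      (∀ x, ρ ≤ |x - p| → ψ x = 0) ∧ (∀ x y, x ≤ y → y ≤ p → ψ x ≤ ψ y) ∧ (∀ x y, p ≤ x → x ≤ y → ψ y ≤ ψ x) ∧
      En ψ ≤ ENNReal.ofReal ε := by
  have hsin : 0 < Real.sin ρ := Real.sin_pos_of_pos_of_lt_pi hρ hρ'
  set C : ℝ := - Real.log (Real.sin ρ) with hC
  have hC0 : 0 ≤ C := by
    have := Real.log_nonpos hsin.le (Real.sin_le_one ρ); linarith
  set Λ : ℝ := 2 * C + 1 + 8 * π ^ 2 / ε with hΛ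
  have hq : 0 < 8 * π ^ 2 / ε := by positivity
  have hΛ0 : 0 < Λ := by positivity
  set r : ℝ := 1 - Real.exp (-Λ) with hr
  have hr1 : r < 1 := by have := Real.exp_pos (-Λ); linarith
  have hr0 : 0 ≤ r := by have : Real.exp (-Λ) ≤ 1 := Real.exp_le_one_iff.2 (by linarith)
                         linarith
  have hlog : - Real.log (1 - r) = Λ := by
    rw [hr, sub_sub_cancel, Real.log_exp, neg_neg]
  have hB0 : Bl r 0 = Λ := by
    rw [Bl, Real.cos_zero, show 1 - 2 * r * 1 + r ^ 2 = (1 - r) ^ 2 by ring, Real.log_pow, ← hlog]; push_cast; ring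
  have hBρ : Bl r ρ ≤ C := by
    have := Real.log_le_log (show 0 < Real.sin ρ ^ 2 by positivity) (show Real.sin ρ ^ 2 ≤ 1 - 2 * r * Real.cos ρ + r ^ 2 by
      nlinarith [Real.sin_sq_add_cos_sq ρ, sq_nonneg (r - Real.cos ρ)])
    rw [Real.log_pow] at this
    push_cast at this
    rw [Bl]; linarith
  set D : ℝ := Bl r 0 - Bl r ρ with hD
  have hDΛ : Λ / 2 ≤ D := by rw [hD, hB0]; linarith
  have hD0 : 0 < D := by linarith
  have hBmono : ∀ s t, 0 ≤ s → s ≤ t → t ≤ π → Bl r t ≤ Bl r s := fun s t hs hst ht =>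
    Bl_anti hr0 hr1 (Real.cos_le_cos_of_nonneg_of_le_pi hs ht hst)
  refine ⟨fun x => (Bl r (min |x - p| ρ) - Bl r ρ) / D, 1 / (1 - r) ^ 2 / D, by positivity, ?_, ?_, ?_, ?_, ?_, ?_, ?_, ?_⟩
  · intro x y
    rw [← sub_div, sub_sub_sub_cancel_right, abs_div, abs_of_pos hD0, div_mul_eq_mul_div]
    gcongr
    refine (Bl_lip hr0 hr1 _ _).trans ?_
    apply mul_le_mul_of_nonneg_left _ (by positivity)
    refine (abs_min_sub_min_le_max _ _ _ _).trans ?_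
    simp only [sub_self, abs_zero]
    apply max_le _ (abs_nonneg _)
    refine (abs_abs_sub_abs_le_abs_sub _ _).trans ?_
    rw [sub_sub_sub_cancel_right]
  · simp only [sub_self, abs_zero, min_eq_left hρ.le, ← hD]; exact div_self hD0.ne'
  · intro x
    apply div_nonneg _ hD0.le
    have := hBmono (min |x - p| ρ) ρ (by positivity) (min_le_right _ _) hρ'.le
    linarith
  · intro x
    rw [div_le_one hD0, hD]
    have := hBmono 0 (min |x - p| ρ) le_rfl (by positivity) ((min_le_right _ _).trans hρ'.le)
    linarith
  · intro x hx
    simp only [min_eq_right hx]; simp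
  · intro x y hxy hy
    apply div_le_div_of_nonneg_right _ hD0.le
    have := hBmono (min |y - p| ρ) (min |x - p| ρ) (by positivity) (by
      apply min_le_min_right
      rw [abs_of_nonpos (by linarith), abs_of_nonpos (by linarith)]; linarith) ((min_le_right _ _).trans hρ'.le)
    linarith
  · intro x y hx hxy
    apply div_le_div_of_nonneg_right _ hD0.le
    have := hBmono (min |x - p| ρ) (min |y - p| ρ) (by positivity) (by
      apply min_le_min_right
      rw [abs_of_nonneg (by linarith), abs_of_nonneg (by linarith)]; linarith) ((min_le_right _ _).trans hρ'.le)
    linarith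
  · have hEq : ∀ x ∈ Set.Ioc 0 (2 * π), Bl r (min |x - p| ρ) = max (Bl r (x - p)) (Bl r ρ) := by
      intro x hx
      have heven : Bl r (x - p) = Bl r |x - p| := by unfold Bl; rw [Real.cos_abs]
      rw [heven]
      rcases le_total |x - p| ρ with h | h
      · rw [min_eq_left h, max_eq_left (hBmono _ _ (abs_nonneg _) h hρ'.le)]
      · rw [min_eq_right h, max_eq_right]
        apply Bl_anti hr0 hr1
        have hup : |x - p| ≤ 2 * π - ρ := abs_le.2 ⟨by linarith [hx.1], by linarith [hx.2]⟩
        rcases le_total |x - p| π with h' | h'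
        · exact Real.cos_le_cos_of_nonneg_of_le_pi hρ.le h' h
        · rw [← Real.cos_two_pi_sub |x - p|]
          exact Real.cos_le_cos_of_nonneg_of_le_pi hρ.le (by linarith) (by linarith)
    have hle : En (fun x => (Bl r (min |x - p| ρ) - Bl r ρ) / D) ≤ En (fun x => (1 / D) * Bl r (x - p)) := by
      apply En_mono
      intro x hx y hy
      rw [hEq x hx, hEq y hy, ← sub_div, sub_sub_sub_cancel_right, ← mul_sub, norm_div, norm_mul, norm_div, norm_one, one_div_mul_eq_div]
      gcongr
      simp only [Real.norm_eq_abs]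
      refine (abs_max_sub_max_le_max _ _ _ _).trans ?_
      simp
    refine hle.trans ?_
    rw [En_smul]
    calc _ ≤ ENNReal.ofReal ((1 / D) ^ 2) * ENNReal.ofReal (2 * π ^ 2 * Λ) := by
            gcongr
            have := En_Bl hr0 hr1 p
            rwa [hlog] at this
      _ ≤ _ := by
            rw [← ENNReal.ofReal_mul (by positivity)]
            apply ENNReal.ofReal_le_ofReal
            have e1 : 8 * π ^ 2 ≤ Λ * ε := by
              have : 8 * π ^ 2 / ε ≤ Λ := by linarith
              rwa [div_le_iff₀ hε] at this
            rw [div_pow, one_pow, one_div_mul_eq_div, div_le_iff₀ (by positivity)]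
            have e2 : Λ ^ 2 / 4 ≤ D ^ 2 := by nlinarith
            calc 2 * π ^ 2 * Λ ≤ (Λ * ε) / 4 * Λ := by gcongr; linarith
              _ = ε * (Λ ^ 2 / 4) := by ring
              _ ≤ _ := by gcongr

end SH


namespace SH

lemma env_left {r : ℝ → ℝ} (hr : Continuous r) {a p : ℝ} (hap : a < p) (h0 : ∀ x ≤ a, r x = 0) (hv : 0 < r p) :
    ∃ A : ℝ → ℝ, Continuous A ∧ Monotone A ∧ (∀ x ≤ a, A x = 0) ∧ (∀ x, p ≤ x → A x = r p) ∧
      (∀ x y, x ≤ y → y ≤ p → A x < A y → ∃ z, x ≤ z ∧ z ≤ y ∧ r z = A y ∧ A z = A y) := by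
  let F : ℝ → ℝ := fun x => sSup ((fun s => r (min s x)) '' Set.Icc a p)
  have hne : (Set.Icc a p).Nonempty := ⟨a, le_rfl, hap.le⟩
  have hcF : Continuous F := by
    refine IsCompact.continuous_sSup (f := fun x s => r (min s x)) isCompact_Icc ?_
    exact hr.comp (continuous_snd.min continuous_fst)
  have hcs : ∀ x, IsCompact ((fun s => r (min s x)) '' Set.Icc a p) := fun x =>
    isCompact_Icc.image (hr.comp (continuous_id.min continuous_const))
  have hle0 : ∀ x s, a ≤ s → s ≤ p → r (min s x) ≤ F x := fun x s h1 h2 =>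
    le_csSup (hcs x).bddAbove ⟨s, ⟨h1, h2⟩, rfl⟩
  have hex : ∀ x, ∃ s, a ≤ s ∧ s ≤ p ∧ F x = r (min s x) := by
    intro x
    obtain ⟨s, hs, h⟩ := (hcs x).sSup_mem (hne.image _)
    exact ⟨s, hs.1, hs.2, h.symm⟩
  have hle : ∀ t x, t ≤ x → t ≤ p → r t ≤ F x := by
    intro t x h1 h2
    rcases le_total a t with h | h
    · have := hle0 x t h h2
      rwa [min_eq_left h1] at this
    · rw [h0 t h]
      have := hle0 x a le_rfl hap.le
      rwa [h0 _ (min_le_left _ _)] at this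
  have hmono : Monotone F := by
    intro x y hxy
    obtain ⟨s, h1, h2, h3⟩ := hex x
    rw [h3]
    exact hle _ _ ((min_le_right _ _).trans hxy) ((min_le_left _ _).trans h2)
  refine ⟨fun x => min (r p) (F x), continuous_const.min hcF, fun x y h => min_le_min le_rfl (hmono h), ?_, ?_, ?_⟩
  · intro x hx
    obtain ⟨s, h1, h2, h3⟩ := hex x
    simp only
    rw [h3, h0 _ ((min_le_right _ _).trans hx), min_eq_right hv.le]
  · intro x hx
    exact min_eq_left (hle _ _ hx le_rfl)
  · intro x y hxy hyp hlt
    simp only at hlt ⊢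
    obtain ⟨s, h1, h2, h3⟩ := hex y
    have ht1 : min s y ≤ y := min_le_right _ _
    have ht2 : min s y ≤ p := (min_le_left _ _).trans h2
    generalize min s y = t at *
    have hxt : x < t := by
      by_contra! hc
      have := hle t x hc ht2
      rw [← h3] at this
      exact absurd hlt (not_lt.2 (min_le_min le_rfl this))
    have hx1 := hle x x le_rfl (hxt.le.trans ht2)
    have hx2 : r x ≤ min (r p) (F y) := by
      refine hx1.trans ?_
      rcases le_total (r p) (F x) with h | h
      · rw [min_eq_left h] at hlt
        exact absurd hlt (not_lt.2 (min_le_left _ _))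
      · rw [min_eq_right h] at hlt
        exact hlt.le
    have hx3 : min (r p) (F y) ≤ r t := h3 ▸ min_le_right _ _
    obtain ⟨z, hz, hz2⟩ := intermediate_value_Icc hxt.le hr.continuousOn ⟨hx2, hx3⟩
    refine ⟨z, hz.1, hz.2.trans ht1, hz2, le_antisymm (min_le_min le_rfl (hmono (hz.2.trans ht1))) ?_⟩
    exact le_min (min_le_left _ _) (hz2 ▸ hle z z le_rfl (hz.2.trans ht2))

lemma env_right {r : ℝ → ℝ} (hr : Continuous r) {b p : ℝ} (hpb : p < b) (h0 : ∀ x, b ≤ x → r x = 0) (hv : 0 < r p) :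
    ∃ A : ℝ → ℝ, Continuous A ∧ Antitone A ∧ (∀ x, b ≤ x → A x = 0) ∧ (∀ x, x ≤ p → A x = r p) ∧
      (∀ x y, x ≤ y → p ≤ x → A y < A x → ∃ z, x ≤ z ∧ z ≤ y ∧ r z = A x ∧ A z = A x) := by
  obtain ⟨A, h1, h2, h3, h4, h5⟩ := env_left (r := fun x => r (-x)) (hr.comp continuous_neg) (a := -b) (p := -p)
    (neg_lt_neg hpb) (fun x hx => h0 _ (by linarith)) (by simpa using hv)
  refine ⟨fun x => A (-x), h1.comp continuous_neg, fun x y h => h2 (neg_le_neg h), fun x hx => h3 _ (by linarith),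
    fun x hx => by simpa using h4 (-x) (by linarith), ?_⟩
  intro x y hxy hpx hlt
  obtain ⟨z, z1, z2, z3, z4⟩ := h5 (-y) (-x) (by linarith) (by linarith) hlt
  exact ⟨-z, by linarith, by linarith, z3, by simpa using z4⟩

lemma mkIso {m : ℝ → ℝ} (hm : Monotone m) (hc : Continuous m) {C : ℝ} (hC : ∀ x, |m x| ≤ C) {η : ℝ} (hη : 0 < η) :
    ∃ e : ℝ ≃o ℝ, ∀ x, e x = m x + η * x := by
  have hs : StrictMono (fun x => m x + η * x) := fun x y h =>
    add_lt_add_of_le_of_lt (hm h.le) (mul_lt_mul_of_pos_left h hη)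
  have hsur : Function.Surjective (fun x => m x + η * x) := by
    have hcc : Continuous (fun x => m x + η * x) := by fun_prop
    apply Continuous.surjective hcc
    · apply Filter.tendsto_atTop_mono (f := fun x => -C + η * x)
      · intro x; have := (abs_le.1 (hC x)).1; linarith
      · exact Filter.tendsto_atTop_add_const_left _ _ (Filter.tendsto_id.const_mul_atTop hη)
    · apply Filter.tendsto_atBot_mono (f := fun x => C + η * x)
      · intro x; have := (abs_le.1 (hC x)).2; linarith
      · exact Filter.tendsto_atBot_add_const_left _ _ (Filter.tendsto_id.const_mul_atBot hη)
  exact ⟨hs.orderIsoOfSurjective _ hsur, fun x => rfl⟩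

lemma core [Fact ((0:ℝ) < 2 * π)] {r : ℝ → ℝ} (hr : Continuous r) {a p b : ℝ} (ha : 0 ≤ a) (hap : a < p) (hpb : p < b)
    (hb : b ≤ 2 * π) (hra : r a = 0) (hrb : r b = 0) (hv : 0 < r p) {ε : ℝ} (hε : 0 < ε) :
    ∃ (k : ℝ ≃o ℝ) (F : ℝ → ℝ), (∀ x, x ≤ a → k x = x) ∧ (∀ x, b ≤ x → k x = x) ∧ k p = p ∧ Continuous F ∧
      (∀ x, x ≤ a → F x = 0) ∧ (∀ x, b ≤ x → F x = 0) ∧ F p = r p ∧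
      (∀ x y, x ≤ y → F x ≠ F y → ∃ z, x ≤ z ∧ z ≤ y ∧ r z = F z) ∧
      En (fun x => F (k x)) ≤ ENNReal.ofReal ε := by
  obtain ⟨v, hvd⟩ : ∃ v, v = r p := ⟨_, rfl⟩
  let r0 : ℝ → ℝ := fun x => r (max a (min x b))
  have hr0c : Continuous r0 := hr.comp (continuous_const.max (continuous_id.min continuous_const))
  have hab : a < b := hap.trans hpb
  have hr0 : ∀ x, a ≤ x → x ≤ b → r0 x = r x := by
    intro x h1 h2; simp only [r0]; rw [min_eq_left h2, max_eq_right h1]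
  have hr0a : ∀ x, x ≤ a → r0 x = 0 := by
    intro x h1; simp only [r0]; rw [min_eq_left (h1.trans hab.le), max_eq_left h1, hra]
  have hr0b : ∀ x, b ≤ x → r0 x = 0 := by
    intro x h1; simp only [r0]; rw [min_eq_right h1, max_eq_right hab.le, hrb]
  have hr0p : r0 p = v := by rw [hr0 p hap.le hpb.le, hvd]
  have hv' : 0 < v := hvd ▸ hv
  obtain ⟨A, A1, A2, A3, A4, A5⟩ := env_left hr0c hap hr0a (hr0p ▸ hv')
  obtain ⟨B, B1, B2, B3, B4, B5⟩ := env_right hr0c hpb hr0b (hr0p ▸ hv')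
  rw [hr0p] at A4 B4
  have A0 : ∀ x, 0 ≤ A x := fun x => by
    rw [← A3 (min a x) (min_le_left _ _)]; exact A2 (min_le_right _ _)
  have B0 : ∀ x, 0 ≤ B x := fun x => by
    rw [← B3 (max b x) (le_max_left _ _)]; exact B2 (le_max_right _ _)
  have Av : ∀ x, A x ≤ v := fun x => by
    rw [← A4 (max p x) (le_max_left _ _)]; exact A2 (le_max_right _ _)
  have Bv : ∀ x, B x ≤ v := fun x => by
    rw [← B4 (min p x) (min_le_left _ _)]; exact B2 (min_le_right _ _)
  -- spike
  obtain ⟨ρ, hρd⟩ : ∃ ρ, ρ = min (p - a) (b - p) / 2 := ⟨_, rfl⟩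
  have hm1 := min_le_left (p - a) (b - p)
  have hm2 := min_le_right (p - a) (b - p)
  have hm3 : 0 < min (p - a) (b - p) := lt_min (by linarith) (by linarith)
  have hρ : 0 < ρ := by linarith
  have hπ := Real.pi_pos
  obtain ⟨ψ, L, hL, ψL, ψp, ψ0, ψ1, ψs, ψm, ψa, ψE⟩ := spike (p := p) (ρ := ρ) hρ (by linarith) (by linarith)
    (ε / (4 * v ^ 2)) (by positivity) (by linarith)
  have ψc : Continuous ψ := by
    have : LipschitzWith L.toNNReal ψ := LipschitzWith.of_dist_le_mul fun x y => by
      rw [Real.dist_eq, Real.dist_eq, Real.coe_toNNReal _ hL]; exact ψL x y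
    exact this.continuous
  obtain ⟨η0, hη0, hsm⟩ := lip_small (4 * v * L + 4) (ε / 4) (by positivity) (by positivity)
  obtain ⟨η, hηd⟩ : ∃ η, η = min 1 (η0 / (4 * π)) := ⟨_, rfl⟩
  have hη : 0 < η := hηd ▸ lt_min one_pos (by positivity)
  have hη1 : η ≤ 1 := hηd ▸ min_le_left _ _
  have hη2 : 4 * π * η ≤ η0 := by
    have : η ≤ η0 / (4 * π) := hηd ▸ min_le_right _ _
    rw [le_div_iff₀ (by positivity)] at this
    linarith
  let m2 : ℝ → ℝ := fun x => v * (ψ (min x p) - ψ (max x p))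
  have m2m : Monotone m2 := by
    intro x y h
    have e1 := ψm (min x p) (min y p) (min_le_min h le_rfl) (min_le_right _ _)
    have e2 := ψa (max x p) (max y p) (le_max_right _ _) (max_le_max h le_rfl)
    exact mul_le_mul_of_nonneg_left (by linarith) hv'.le
  have m2c : Continuous m2 := continuous_const.mul ((ψc.comp (continuous_id.min continuous_const)).sub
    (ψc.comp (continuous_id.max continuous_const)))
  have m2C : ∀ x, |m2 x| ≤ v := by
    intro x
    simp only [m2]
    rw [abs_mul, abs_of_pos hv']
    apply mul_le_of_le_one_right hv'.le
    rw [abs_le]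
    constructor <;> linarith [ψ0 (min x p), ψ1 (min x p), ψ0 (max x p), ψ1 (max x p)]
  obtain ⟨e1, he1⟩ := mkIso (m := fun x => A x - B x) (fun x y h => sub_le_sub (A2 h) (B2 h)) (A1.sub B1) (C := v)
    (fun x => by rw [abs_le]; constructor <;> linarith [A0 x, B0 x, Av x, Bv x]) hη
  obtain ⟨e2, he2⟩ := mkIso m2m m2c m2C hη
  let k : ℝ ≃o ℝ := e2.trans e1.symm
  have hk : ∀ y, A (k y) - B (k y) + η * k y = m2 y + η * y := by
    intro y
    rw [← he1, ← he2]; simp [k]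
  have hfix : ∀ x, A x - B x = m2 x → k x = x := by
    intro x hx
    apply e1.injective
    rw [he1, he1]
    have := hk x
    linarith
  have hka : ∀ x, x ≤ a → k x = x := by
    intro x hx
    apply hfix
    simp only [m2]
    rw [A3 x hx, B4 x (hx.trans hap.le), min_eq_left (hx.trans hap.le), max_eq_right (hx.trans hap.le), ψp, ψs x]
    · ring
    · rw [abs_sub_comm, abs_of_nonneg (by linarith)]; linarith
  have hkb : ∀ x, b ≤ x → k x = x := by
    intro x hx
    apply hfix
    simp only [m2]
    rw [B3 x hx, A4 x (hpb.le.trans hx), min_eq_right (hpb.le.trans hx), max_eq_left (hpb.le.trans hx), ψp, ψs x]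
    · ring
    · rw [abs_of_nonneg (by linarith)]; linarith
  have hkp : k p = p := by
    apply hfix
    simp only [m2]
    rw [A4 p le_rfl, B4 p le_rfl, min_self, max_self]; ring
  have Fl : ∀ x, x ≤ p → A x + B x - v = A x := fun x hx => by rw [B4 x hx]; ring
  have Fr : ∀ x, p ≤ x → A x + B x - v = B x := fun x hx => by rw [A4 x hx]; ring
  refine ⟨k, fun x => A x + B x - v, hka, hkb, hkp, (A1.add B1).sub continuous_const, ?_, ?_, ?_, ?_, ?_⟩
  · intro x hx
    simp only; rw [Fl x (hx.trans hap.le), A3 x hx]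
  · intro x hx
    simp only; rw [Fr x (hpb.le.trans hx), B3 x hx]
  · simp only; rw [Fl p le_rfl, A4 p le_rfl, hvd]
  · intro x y hxy hne
    simp only at hne ⊢
    rcases le_total y p with hyp | hyp
    · rw [Fl x (hxy.trans hyp), Fl y hyp] at hne
      obtain ⟨z, z1, z2, z3, z4⟩ := A5 x y hxy hyp (lt_of_le_of_ne (A2 hxy) hne)
      refine ⟨z, z1, z2, ?_⟩
      rw [Fl z (z2.trans hyp), z4, ← z3, hr0 z _ ((z2.trans hyp).trans hpb.le)]
      by_contra! hc
      have h1 := hr0a z hc.le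
      have h2 := lt_of_le_of_ne (A2 hxy) hne
      linarith [A0 x]
    · rcases le_total x p with hxp | hxp
      · exact ⟨p, hxp, hyp, by rw [Fl p le_rfl, A4 p le_rfl, hvd]⟩
      · rw [Fr x hxp, Fr y hyp] at hne
        obtain ⟨z, z1, z2, z3, z4⟩ := B5 x y hxy hxp (lt_of_le_of_ne (B2 hxy) hne.symm)
        refine ⟨z, z1, z2, ?_⟩
        rw [Fr z (hxp.trans z1), z4, ← z3, hr0 z (hap.le.trans (hxp.trans z1))]
        by_contra! hc
        have h1 := hr0b z hc.le
        have h2 := lt_of_le_of_ne (B2 hxy) hne.symm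
        linarith [B0 y]
  · let g : ℝ → ℝ := fun y => η * (y - k y)
    let w : ℝ → ℝ := fun y => g (min y p) - g (max y p)
    have gp : g p = 0 := by simp [g, hkp]
    have hFk : (fun x => A (k x) + B (k x) - v) = fun x => v * ψ x + w x := by
      funext y
      have h := hk y
      simp only [m2] at h
      simp only [w]
      rcases le_total y p with hy | hy
      · have : k y ≤ p := by rw [← hkp]; exact k.monotone hy
        rw [min_eq_left hy, max_eq_right hy, ψp, B4 _ this] at h
        rw [min_eq_left hy, max_eq_right hy, gp, B4 _ this]
        simp only [g]; linarith
      · have : p ≤ k y := by rw [← hkp]; exact k.monotone hy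
        rw [min_eq_right hy, max_eq_left hy, ψp, A4 _ this] at h
        rw [min_eq_right hy, max_eq_left hy, gp, A4 _ this]
        simp only [g]; linarith
    have hmin : ∀ x y : ℝ, |min x p - min y p| ≤ |x - y| := fun x y => by
      have := abs_min_sub_min_le_max x p y p; simpa using this
    have hmax : ∀ x y : ℝ, |max x p - max y p| ≤ |x - y| := fun x y => by
      have := abs_max_sub_max_le_max x p y p; simpa using this
    have m2L : ∀ x y, |m2 x - m2 y| ≤ 2 * v * L * |x - y| := by
      intro x y
      have h1 := ψL (min x p) (min y p)
      have h2 := ψL (max x p) (max y p)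
      have h3 := mul_le_mul_of_nonneg_left (hmin x y) hL
      have h4 := mul_le_mul_of_nonneg_left (hmax x y) hL
      have h5 : |(ψ (min x p) - ψ (max x p)) - (ψ (min y p) - ψ (max y p))| ≤ 2 * (L * |x - y|) := by
        rw [abs_le] at *
        constructor <;> linarith
      simp only [m2]
      rw [← mul_sub, abs_mul, abs_of_pos hv']
      have := mul_le_mul_of_nonneg_left h5 hv'.le
      linarith
    have gL0 : ∀ x y, x ≤ y → |g x - g y| ≤ (2 * v * L + 2) * |x - y| := by
      intro x y hxy
      have h1 := k.monotone hxy
      have h2 := A2 h1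
      have h3 := B2 h1
      have h4 := hk x
      have h5 := hk y
      have h6 := m2L x y
      rw [abs_sub_comm x y, abs_of_nonneg (sub_nonneg.2 hxy)] at *
      have h7 := (abs_le.1 h6).1
      have h8 : η * (y - x) ≤ y - x := mul_le_of_le_one_left (by linarith) hη1
      have h9 : 0 ≤ η * (y - x) := mul_nonneg hη.le (by linarith)
      have h10 : 0 ≤ η * (k y - k x) := mul_nonneg hη.le (by linarith)
      have h11 : 0 ≤ 2 * v * L * (y - x) := mul_nonneg (by positivity) (by linarith)
      simp only [g]
      rw [abs_le]
      constructor <;> linarith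
    have gL : ∀ x y, |g x - g y| ≤ (2 * v * L + 2) * |x - y| := by
      intro x y
      rcases le_total x y with h | h
      · exact gL0 x y h
      · rw [abs_sub_comm, abs_sub_comm x y]; exact gL0 y x h
    have gB : ∀ x, |g x| ≤ 2 * π * η := by
      intro x
      simp only [g]
      rw [abs_mul, abs_of_pos hη, mul_comm]
      apply mul_le_mul_of_nonneg_right _ hη.le
      rcases le_total x a with h | h
      · rw [hka x h]; simp; positivity
      · rcases le_total b x with h' | h'
        · rw [hkb x h']; simp; positivity
        · have h1 := k.monotone h
          have h2 := k.monotone h'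
          rw [hka a le_rfl] at h1
          rw [hkb b le_rfl] at h2
          rw [abs_le]; constructor <;> linarith
    have hw := hsm w ?_ ?_ ?_ ?_
    · rw [hFk]
      refine (En_add (f := fun x => v * ψ x) (continuous_const.mul ψc) 1 one_pos).trans ?_
      rw [En_smul]
      calc _ ≤ ENNReal.ofReal (1 + 1) * (ENNReal.ofReal (v ^ 2) * ENNReal.ofReal (ε / (4 * v ^ 2))) +
            ENNReal.ofReal (1 + 1 / 1) * ENNReal.ofReal (ε / 4) := by gcongr
        _ = ENNReal.ofReal ε := by
          rw [← ENNReal.ofReal_mul (by positivity), ← ENNReal.ofReal_mul (by positivity),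
            ← ENNReal.ofReal_mul (by positivity), ← ENNReal.ofReal_add (by positivity) (by positivity)]
          congr 1
          field_simp
          norm_num
    · intro x y
      have h1 := gL (min x p) (min y p)
      have h2 := gL (max x p) (max y p)
      have hLL : 0 ≤ 2 * v * L + 2 := by positivity
      have h3 := mul_le_mul_of_nonneg_left (hmin x y) hLL
      have h4 := mul_le_mul_of_nonneg_left (hmax x y) hLL
      simp only [w]
      rw [abs_le] at *
      constructor <;> linarith
    · simp only [w]
      rw [min_eq_left (by linarith), max_eq_right (by linarith), gp]
      simp [g, hka 0 ha]
    · simp only [w]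
      rw [min_eq_right (by linarith), max_eq_left (by linarith), gp]
      simp [g, hkb _ hb]
    · intro x
      have h1 := gB (min x p)
      have h2 := gB (max x p)
      simp only [w]
      rw [abs_le] at *
      constructor <;> linarith

end SH


namespace SH

lemma core2 [Fact ((0:ℝ) < 2 * π)] {r : ℝ → ℝ} (hr : Continuous r) {a p b : ℝ} (ha : 0 ≤ a) (hap : a < p) (hpb : p < b)
    (hb : b ≤ 2 * π) (hra : r a = 0) (hrb : r b = 0) (hv : r p ≠ 0) {ε : ℝ} (hε : 0 < ε) :
    ∃ (k : ℝ ≃o ℝ) (F : ℝ → ℝ), (∀ x, x ≤ a → k x = x) ∧ (∀ x, b ≤ x → k x = x) ∧ k p = p ∧ Continuous F ∧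
      (∀ x, x ≤ a → F x = 0) ∧ (∀ x, b ≤ x → F x = 0) ∧ F p = r p ∧
      (∀ x y, x ≤ y → F x ≠ F y → ∃ z, x ≤ z ∧ z ≤ y ∧ r z = F z) ∧
      En (fun x => F (k x)) ≤ ENNReal.ofReal ε := by
  rcases lt_or_gt_of_ne hv with h | h
  · obtain ⟨k, F, h1, h2, h3, h4, h5, h6, h7, h8, h9⟩ := core (r := fun x => - r x) hr.neg ha hap hpb hb
      (by simp [hra]) (by simp [hrb]) (by linarith) hε
    refine ⟨k, fun x => - F x, h1, h2, h3, h4.neg, fun x hx => by simp [h5 x hx], fun x hx => by simp [h6 x hx],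
      by simp [h7], ?_, by rw [En_neg (fun x => F (k x))]; exact h9⟩
    intro x y hxy hne
    obtain ⟨z, z1, z2, z3⟩ := h8 x y hxy (fun h => hne (by simp [h]))
    exact ⟨z, z1, z2, by linarith⟩
  · exact core hr ha hap hpb hb hra hrb h hε

structure St (f : ℝ → ℝ) (H : ℝ ≃o ℝ) (S r : ℝ → ℝ) : Prop where
  hS : Continuous S
  hr : Continuous r
  dec : ∀ x, f (H x) = S x + r x
  out : ∀ x, x ≤ 0 ∨ 2 * π ≤ x → r x = 0 ∧ H x = x
  con : ∀ x y, x ≤ y → (∀ z, x ≤ z → z ≤ y → r z ≠ 0) → S x = S y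
  en : ∃ m : ℕ, En S ≤ ENNReal.ofReal (2 - (1/2) ^ m)

lemma step1 [Fact ((0:ℝ) < 2 * π)] {f : ℝ → ℝ} {H : ℝ ≃o ℝ} {S r : ℝ → ℝ} (h : St f H S r) (p : ℝ) :
    ∃ (H' : ℝ ≃o ℝ) (S' r' : ℝ → ℝ), St f H' S' r' ∧ (∀ x, r x = 0 → H' x = H x ∧ r' x = 0) ∧ H' p = H p ∧ r' p = 0 := by
  by_cases hp : r p = 0
  · exact ⟨H, S, r, h, fun x hx => ⟨rfl, hx⟩, rfl, hp⟩
  have hp0 : 0 < p := by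
    by_contra! hc
    exact hp (h.out p (Or.inl hc)).1
  have hp1 : p < 2 * π := by
    by_contra! hc
    exact hp (h.out p (Or.inr hc)).1
  have hcl : IsClosed {z | r z = 0} := isClosed_eq h.hr continuous_const
  obtain ⟨a, ⟨⟨ha0, hap⟩, hra⟩, hau⟩ := ((isCompact_Icc (a := 0) (b := p)).inter_right hcl).exists_isGreatest
    ⟨0, ⟨le_rfl, hp0.le⟩, (h.out 0 (Or.inl le_rfl)).1⟩
  obtain ⟨b, ⟨⟨hpb, hb0⟩, hrb⟩, hbu⟩ := ((isCompact_Icc (a := p) (b := 2 * π)).inter_right hcl).exists_isLeast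
    ⟨2 * π, ⟨hp1.le, le_rfl⟩, (h.out _ (Or.inr le_rfl)).1⟩
  simp only [Set.mem_ofPred_eq] at hra hrb
  have hap' : a < p := lt_of_le_of_ne hap (fun e => hp (e ▸ hra))
  have hpb' : p < b := lt_of_le_of_ne hpb (fun e => hp (e ▸ hrb))
  have hnz : ∀ z, a < z → z < b → r z ≠ 0 := by
    intro z h1 h2 h3
    rcases le_total z p with hz | hz
    · exact absurd (hau ⟨⟨ha0.trans h1.le, hz⟩, h3⟩) (not_le.2 h1)
    · exact absurd (hbu ⟨⟨hz, h2.le.trans hb0⟩, h3⟩) (not_le.2 h2)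
  obtain ⟨m, hm⟩ := h.en
  obtain ⟨ε, hε, hstep⟩ := En_step m
  obtain ⟨k, F, k1, k2, k3, F1, F2, F3, F4, F5, F6⟩ := core2 h.hr ha0 hap' hpb' hb0 hra hrb hp hε
  have hSk : ∀ x, S (k x) = S x := by
    intro x
    rcases le_or_gt x a with hx | hx
    · rw [k1 x hx]
    rcases le_or_gt b x with hx' | hx'
    · rw [k2 x hx']
    have e1 : a < k x := by
      have := k.strictMono hx; rwa [k1 a le_rfl] at this
    have e2 : k x < b := by
      have := k.strictMono hx'; rwa [k2 b le_rfl] at this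
    rcases le_total x (k x) with hh | hh
    · exact (h.con _ _ hh fun z z1 z2 => hnz z (hx.trans_le z1) (z2.trans_lt e2)).symm
    · exact h.con _ _ hh fun z z1 z2 => hnz z (e1.trans_le z1) (z2.trans_lt hx')
  have hz : ∀ x, r x = 0 → k x = x ∧ r (k x) - F (k x) = 0 := by
    intro x hx
    have : x ≤ a ∨ b ≤ x := by
      by_contra! hc
      exact hnz x hc.1 hc.2 hx
    rcases this with h' | h'
    · rw [k1 x h', F2 x h', hx]; simp
    · rw [k2 x h', F3 x h', hx]; simp
  refine ⟨k.trans H, fun x => S x + F (k x), fun x => r (k x) - F (k x), ⟨h.hS.add (F1.comp k.continuous),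
    (h.hr.comp k.continuous).sub (F1.comp k.continuous), ?_, ?_, ?_, m + 1, hstep _ _ h.hS hm F6⟩, ?_, ?_, ?_⟩
  · intro x
    simp only [OrderIso.trans_apply]
    rw [h.dec, hSk]; ring
  · intro x hx
    obtain ⟨h1, h2⟩ := h.out x hx
    refine ⟨(hz x h1).2, ?_⟩
    rw [OrderIso.trans_apply, (hz x h1).1, h2]
  · intro x y hxy hn
    have e1 := h.con x y hxy fun z z1 z2 z3 => hn z z1 z2 (hz z z3).2
    have e2 : F (k x) = F (k y) := by
      by_contra hne
      obtain ⟨z, z1, z2, z3⟩ := F5 _ _ (k.monotone hxy) hne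
      refine hn (k.symm z) ?_ ?_ ?_
      · rwa [OrderIso.le_symm_apply]
      · rwa [OrderIso.symm_apply_le]
      · rw [OrderIso.apply_symm_apply, z3, sub_self]
    rw [e1, e2]
  · intro x hx
    refine ⟨?_, (hz x hx).2⟩
    rw [OrderIso.trans_apply, (hz x hx).1]
  · rw [OrderIso.trans_apply, k3]
  · simp only
    rw [k3, F4, sub_self]

lemma step2 [Fact ((0:ℝ) < 2 * π)] {f : ℝ → ℝ} {H : ℝ ≃o ℝ} {S r : ℝ → ℝ} (h : St f H S r) (q : ℝ) :
    ∃ (H' : ℝ ≃o ℝ) (S' r' : ℝ → ℝ), St f H' S' r' ∧ (∀ x, r x = 0 → H' x = H x ∧ r' x = 0) ∧ r' q = 0 ∧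
      ∃ p, r' p = 0 ∧ H' p = q := by
  obtain ⟨H1, S1, r1, h1, a1, b1, c1⟩ := step1 h q
  obtain ⟨H2, S2, r2, h2, a2, b2, c2⟩ := step1 h1 (H1.symm q)
  refine ⟨H2, S2, r2, h2, fun x hx => ?_, (a2 q c1).2, H1.symm q, c2, by rw [b2]; simp⟩
  obtain ⟨e1, e2⟩ := a1 x hx
  obtain ⟨e3, e4⟩ := a2 x e2
  exact ⟨e3.trans e1, e4⟩

lemma seq [Fact ((0:ℝ) < 2 * π)] {f : ℝ → ℝ} (hf : Continuous f) (hout : ∀ x, x ≤ 0 ∨ 2 * π ≤ x → f x = 0) (q : ℕ → ℝ) :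
    ∃ (H : ℕ → ℝ ≃o ℝ) (S r : ℕ → ℝ → ℝ), (∀ n, St f (H n) (S n) (r n)) ∧
      (∀ n x, r n x = 0 → H (n+1) x = H n x ∧ r (n+1) x = 0) ∧ (∀ n, r (n+1) (q n) = 0) ∧
      ∀ n, ∃ p, r (n+1) p = 0 ∧ H (n+1) p = q n := by
  let T := {s : (ℝ ≃o ℝ) × (ℝ → ℝ) × (ℝ → ℝ) // St f s.1 s.2.1 s.2.2}
  have h0 : St f (OrderIso.refl ℝ) (fun _ => 0) f := by
    refine ⟨continuous_const, hf, fun x => by simp, fun x hx => ⟨hout x hx, rfl⟩, fun _ _ _ _ => rfl, 0, ?_⟩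
    simp [En]
  have hs : ∀ (s : T) (y : ℝ), ∃ s' : T, (∀ x, s.1.2.2 x = 0 → s'.1.1 x = s.1.1 x ∧ s'.1.2.2 x = 0) ∧ s'.1.2.2 y = 0 ∧
      ∃ p, s'.1.2.2 p = 0 ∧ s'.1.1 p = y := by
    intro s y
    obtain ⟨H', S', r', h, h'⟩ := step2 s.2 y
    exact ⟨⟨(H', S', r'), h⟩, h'⟩
  choose nx hnx using hs
  let sq : ℕ → T := fun n => Nat.rec ⟨(OrderIso.refl ℝ, fun _ => 0, f), h0⟩ (fun n s => nx s (q n)) n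
  exact ⟨fun n => (sq n).1.1, fun n => (sq n).1.2.1, fun n => (sq n).1.2.2, fun n => (sq n).2,
    fun n => (hnx (sq n) (q n)).1, fun n => (hnx (sq n) (q n)).2.1, fun n => (hnx (sq n) (q n)).2.2⟩

lemma main_real [Fact ((0:ℝ) < 2 * π)] {f : ℝ → ℝ} (hf : Continuous f) (hout : ∀ x, x ≤ 0 ∨ 2 * π ≤ x → f x = 0) :
    ∃ H : ℝ ≃o ℝ, (∀ x, x ≤ 0 ∨ 2 * π ≤ x → H x = x) ∧ En (fun x => f (H x)) ≤ ENNReal.ofReal 2 := by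
  have hq := TopologicalSpace.denseRange_denseSeq ℝ
  generalize TopologicalSpace.denseSeq ℝ = q at hq
  obtain ⟨H, S, r, hSt, hst, hq1, hq2⟩ := seq hf hout q
  have hmn : ∀ n m, n ≤ m → ∀ x, r n x = 0 → r m x = 0 ∧ H m x = H n x := by
    intro n m hnm
    induction m, hnm using Nat.le_induction with
    | base => exact fun x hx => ⟨hx, rfl⟩
    | succ m _ ih =>
      intro x hx
      obtain ⟨h1, h2⟩ := ih x hx
      obtain ⟨h3, h4⟩ := hst m x h1
      exact ⟨h4, h3.trans h2⟩
  have hlt : ∀ n m z w, r n z = 0 → r m w = 0 → z < w → H n z < H m w := by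
    intro n m z w hz hw h
    rw [← (hmn n (max n m) (le_max_left _ _) z hz).2, ← (hmn m (max n m) (le_max_right _ _) w hw).2]
    exact (H _).strictMono h
  have hle : ∀ n m z w, r n z = 0 → r m w = 0 → z ≤ w → H n z ≤ H m w := by
    intro n m z w hz hw h
    rw [← (hmn n (max n m) (le_max_left _ _) z hz).2, ← (hmn m (max n m) (le_max_right _ _) w hw).2]
    exact (H _).monotone h
  let A : ℝ → Set ℝ := fun x => {y | ∃ n z, z ≤ x ∧ r n z = 0 ∧ y = H n z}
  let K : ℝ → ℝ := fun x => sSup (A x)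
  have Ane : ∀ x, (A x).Nonempty := fun x =>
    ⟨_, 0, min x 0, min_le_left _ _, ((hSt 0).out _ (Or.inl (min_le_right _ _))).1, rfl⟩
  have Abd : ∀ x, BddAbove (A x) := by
    intro x
    refine ⟨H 0 (max x (2 * π)), ?_⟩
    rintro y ⟨n, z, h1, h2, rfl⟩
    exact hle _ _ _ _ h2 ((hSt 0).out _ (Or.inr (le_max_right _ _))).1 (h1.trans (le_max_left _ _))
  have hK : ∀ n z, r n z = 0 → K z = H n z := by
    intro n z hz
    apply IsGreatest.csSup_eq
    refine ⟨⟨n, z, le_rfl, hz, rfl⟩, ?_⟩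
    rintro y ⟨m, w, h1, h2, rfl⟩
    exact hle _ _ _ _ h2 hz h1
  have Kmono : Monotone K := fun x y hxy =>
    csSup_le_csSup (Abd y) (Ane x) (fun t ⟨n, z, h1, h2⟩ => ⟨n, z, h1.trans hxy, h2⟩)
  have hdense : ∀ x y : ℝ, x < y → ∃ n, x < q n ∧ q n < y := by
    intro x y hxy
    obtain ⟨n, hn⟩ := hq.exists_mem_open isOpen_Ioo (Set.nonempty_Ioo.2 hxy)
    exact ⟨n, hn⟩
  have Ks : StrictMono K := by
    intro x y hxy
    obtain ⟨n, n1, n2⟩ := hdense x y hxy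
    obtain ⟨m, m1, m2⟩ := hdense (q n) y n2
    calc K x ≤ K (q n) := Kmono n1.le
      _ = H (n+1) (q n) := hK _ _ (hq1 n)
      _ < H (m+1) (q m) := hlt _ _ _ _ (hq1 n) (hq1 m) m1
      _ = K (q m) := (hK _ _ (hq1 m)).symm
      _ ≤ K y := Kmono m2.le
  have Kc : Continuous K := by
    apply Kmono.continuous_of_denseRange
    apply Dense.mono _ hq
    rintro _ ⟨n, rfl⟩
    obtain ⟨p, p1, p2⟩ := hq2 n
    exact ⟨p, by rw [hK _ _ p1, p2]⟩
  have Kout : ∀ x, x ≤ 0 ∨ 2 * π ≤ x → K x = x := by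
    intro x hx
    obtain ⟨h1, h2⟩ := (hSt 0).out x hx
    rw [hK 0 x h1, h2]
  have Ksur : Function.Surjective K := by
    apply Kc.surjective
    · apply Filter.tendsto_id.congr'
      filter_upwards [Filter.eventually_ge_atTop (2 * π)] with x hx
      exact (Kout x (Or.inr hx)).symm
    · apply Filter.tendsto_id.congr'
      filter_upwards [Filter.eventually_le_atBot 0] with x hx
      exact (Kout x (Or.inl hx)).symm
  refine ⟨Ks.orderIsoOfSurjective K Ksur, Kout, ?_⟩
  change En (fun x => f (K x)) ≤ _
  refine En_fatou (S := S) (fun n => (hSt n).hS) ?_ _ ?_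
  · intro x
    rw [Metric.tendsto_atTop]
    intro ε hε
    obtain ⟨δ, hδ, hd⟩ := Metric.continuous_iff.1 (hf.comp Kc) x ε hε
    obtain ⟨j, j1, j2⟩ := hdense x (x + δ) (by linarith)
    refine ⟨j + 1, fun n hn => ?_⟩
    have hrn := (hmn _ _ hn _ (hq1 j)).1
    have hcl : IsClosed {z | r n z = 0} := isClosed_eq (hSt n).hr continuous_const
    obtain ⟨z, ⟨⟨hz1, hz2⟩, hz3⟩, hzl⟩ := ((isCompact_Icc (a := x) (b := q j)).inter_right hcl).exists_isLeast
      ⟨q j, ⟨j1.le, le_rfl⟩, hrn⟩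
    simp only [Set.mem_ofPred_eq] at hz3
    have hSz : S n x = S n z := by
      rcases hz1.eq_or_lt with h | h
      · rw [h]
      have he : Set.EqOn (S n) (fun _ => S n x) (Set.Ico x z) := by
        intro y hy
        refine ((hSt n).con x y hy.1 ?_).symm
        intro t t1 t2 t3
        exact absurd (hzl ⟨⟨t1, t2.trans (hy.2.le.trans hz2)⟩, t3⟩) (not_le.2 (t2.trans_lt hy.2))
      have := he.closure (hSt n).hS continuous_const
      rw [closure_Ico h.ne] at this
      exact (this ⟨h.le, le_rfl⟩).symm
    have hfz : S n z = f (K z) := by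
      rw [hK n z hz3, (hSt n).dec, hz3, add_zero]
    rw [hSz, hfz]
    apply hd z
    rw [Real.dist_eq, abs_of_nonneg (by linarith)]
    linarith
  · intro n
    obtain ⟨m, hm⟩ := (hSt n).en
    refine hm.trans (ENNReal.ofReal_le_ofReal ?_)
    have : (0:ℝ) < (1/2)^m := by positivity
    linarith

end SH


namespace SH

noncomputable def cm [Fact ((0:ℝ) < 2 * π)] (H : ℝ ≃o ℝ) : AddCircle (2 * π) → AddCircle (2 * π) :=
  AddCircle.liftIco (2 * π) 0 (fun x => (H x : AddCircle (2 * π)))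

lemma cm_apply [Fact ((0:ℝ) < 2 * π)] {H : ℝ ≃o ℝ} (hH : ∀ x, x ≤ 0 ∨ 2 * π ≤ x → H x = x) {x : ℝ} (h0 : 0 ≤ x)
    (h1 : x ≤ 2 * π) : cm H (x : AddCircle (2 * π)) = (H x : AddCircle (2 * π)) := by
  rcases h1.lt_or_eq with h | h
  · exact liftIco_zero_coe_apply ⟨h0, h⟩
  · rw [h, AddCircle.coe_period, hH _ (Or.inr le_rfl), AddCircle.coe_period]
    have := liftIco_zero_coe_apply (p := 2 * π) (f := fun x => (H x : AddCircle (2 * π))) (x := 0) ⟨le_rfl, Fact.out⟩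
    rw [hH 0 (Or.inl le_rfl)] at this
    simpa [cm] using this

lemma cm_cont [Fact ((0:ℝ) < 2 * π)] {H : ℝ ≃o ℝ} (hH : ∀ x, x ≤ 0 ∨ 2 * π ≤ x → H x = x) : Continuous (cm H) := by
  apply liftIco_zero_continuous
  · rw [hH 0 (Or.inl le_rfl), hH _ (Or.inr le_rfl), AddCircle.coe_period]; rfl
  · exact ((AddCircle.continuous_mk' _).comp H.continuous).continuousOn

lemma cm_inv [Fact ((0:ℝ) < 2 * π)] {H : ℝ ≃o ℝ} (hH : ∀ x, x ≤ 0 ∨ 2 * π ≤ x → H x = x)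
    (hH' : ∀ x, x ≤ 0 ∨ 2 * π ≤ x → H.symm x = x) (t : AddCircle (2 * π)) : cm H.symm (cm H t) = t := by
  obtain ⟨x, hx, rfl⟩ := AddCircle.coe_image_Ico_eq (2 * π) 0 ▸ Set.mem_univ t
  rw [zero_add] at hx
  rw [cm_apply hH hx.1 hx.2.le, cm_apply hH', OrderIso.symm_apply_apply]
  · have := H.monotone hx.1
    rwa [hH 0 (Or.inl le_rfl)] at this
  · have := H.monotone hx.2.le
    rwa [hH _ (Or.inr le_rfl)] at this

lemma main [Fact ((0 : ℝ) < 2 * π)]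
    (f : AddCircle (2 * π) → ℝ) (hf : Continuous f) :
    ∃ h : AddCircle (2 * π) ≃ₜ AddCircle (2 * π),
      Summable (fun k : ℤ =>
        ‖fourierCoeff (fun t => ((f (h t) : ℝ) : ℂ)) k‖ ^ 2 * |(k : ℝ)|) := by
  have hπ := Real.pi_pos
  let g : ℝ → ℝ := fun x => f ((max 0 (min x (2 * π)) : ℝ) : AddCircle (2 * π)) - f 0
  have hg : Continuous g := (hf.comp ((AddCircle.continuous_mk' _).comp
    (continuous_const.max (continuous_id.min continuous_const)))).sub continuous_const
  have hgo : ∀ x, x ≤ 0 ∨ 2 * π ≤ x → g x = 0 := by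
    rintro x (hx | hx)
    · simp only [g]
      rw [min_eq_left (by linarith), max_eq_left hx]; simp
    · simp only [g]
      rw [min_eq_right hx, max_eq_right (by linarith), AddCircle.coe_period]; simp
  obtain ⟨H, hH, hE⟩ := main_real hg hgo
  have hH' : ∀ x, x ≤ 0 ∨ 2 * π ≤ x → H.symm x = x := by
    intro x hx
    rw [OrderIso.symm_apply_eq, hH x hx]
  let h : AddCircle (2 * π) ≃ₜ AddCircle (2 * π) :=
    { toFun := cm H
      invFun := cm H.symm
      left_inv := cm_inv hH hH'
      right_inv := cm_inv (H := H.symm) hH' hH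
      continuous_toFun := cm_cont hH
      continuous_invFun := cm_cont hH' }
  refine ⟨h, ?_⟩
  let G : C(AddCircle (2 * π), ℂ) := ⟨fun t => ((f (h t) : ℝ) : ℂ), Complex.continuous_ofReal.comp (hf.comp h.continuous)⟩
  have hD := douglas G
  have hle : En (fun x : ℝ => G (x : AddCircle (2 * π))) ≤ En (fun x => g (H x)) := by
    apply En_mono
    have key : ∀ x ∈ Set.Ioc 0 (2 * π), G (x : AddCircle (2 * π)) = ((g (H x) + f 0 : ℝ) : ℂ) := by
      intro x hx
      have h1 := H.monotone hx.1.le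
      have h2 := H.monotone hx.2
      rw [hH 0 (Or.inl le_rfl)] at h1
      rw [hH _ (Or.inr le_rfl)] at h2
      change ((f (cm H x) : ℝ) : ℂ) = _
      rw [cm_apply hH hx.1.le hx.2]
      simp only [g]
      rw [min_eq_left h2, max_eq_right h1, sub_add_cancel]
    intro x hx y hy
    rw [key x hx, key y hy, ← Complex.ofReal_sub, Complex.norm_real]
    simp
  have hfin : ∑' k : ℤ, ‖fourierCoeff G k‖ₑ ^ 2 * ‖(k:ℝ)‖ₑ ≠ ⊤ := by
    intro hc
    rw [hc, ENNReal.mul_top] at hD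
    · have := (hD ▸ hle).trans hE
      simp at this
    · have : ENNReal.ofReal (2 * π) ≠ 0 := by
        rw [Ne, ENNReal.ofReal_eq_zero]; linarith
      exact pow_ne_zero _ this
  have hs := ENNReal.summable_toReal hfin
  refine hs.congr fun k => ?_
  rw [ENNReal.toReal_mul, ENNReal.toReal_pow, toReal_enorm, toReal_enorm, Real.norm_eq_abs]
  rfl

end SH

end Helpers

/-- For every continuous real-valued `f` on the circle there is a homeomorphism `h` such that
`f ∘ h` belongs to the Sobolev space `W₂^{1/2}(𝕋)`, i.e. `∑ₖ |(f∘h)^(k)|²·|k| < ∞`. -/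
theorem superposition_in_sobolev_half
    [inst : Fact ((0 : ℝ) < 2 * π)]
    (f : AddCircle (2 * π) → ℝ) (hf : Continuous f) :
    ∃ h : AddCircle (2 * π) ≃ₜ AddCircle (2 * π),
      Summable (fun k : ℤ =>
        ‖fourierCoeff (fun t => ((f (h t) : ℝ) : ℂ)) k‖ ^ 2 * |(k : ℝ)|) := by
  exact SH.main f hf
end

section
/- Let g : 𝕋 → ℝ be a continuous real-valued function on the circle 𝕋 = ℝ/2πℤ, and suppose there exists a continuous function v : 𝕋 → ℝ of bounded variation on 𝕋 with v̂(k) = -i·sgn(k)·ĝ(k) for every k ∈ ℤ (i.e., the conjugate function g̃ is continuous and of bounded variation). Then g belongs to the Sobolev space W₂^{1/2}(𝕋), i.e., Σ_{k∈ℤ} |ĝ(k)|²·|k| < ∞. -/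
open scoped Real
open MeasureTheory AddCircle ComplexConjugate

theorem aux_parseval {T : ℝ} [hT : Fact (0 < T)] (f g : C(AddCircle T, ℂ)) :
    HasSum (fun k : ℤ => conj (fourierCoeff f k) * fourierCoeff g k)
      (∫ t, g t * conj (f t) ∂haarAddCircle) := by
  have h := (fourierBasis (T := T)).hasSum_inner_mul_inner
    (ContinuousMap.toLp (E := ℂ) 2 haarAddCircle ℂ f) (ContinuousMap.toLp (E := ℂ) 2 haarAddCircle ℂ g)
  rw [ContinuousMap.inner_toLp] at h
  refine h.congr_fun (fun k => ?_)
  rw [← inner_conj_symm, ← HilbertBasis.repr_apply_apply, ← HilbertBasis.repr_apply_apply,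
    fourierBasis_repr, fourierBasis_repr, fourierCoeff_toLp, fourierCoeff_toLp]

theorem aux_shift {T : ℝ} [hT : Fact (0 < T)] (f : AddCircle T → ℂ) (a : AddCircle T) (k : ℤ) :
    fourierCoeff (fun t => f (t + a)) k = fourier k a * fourierCoeff f k := by
  unfold fourierCoeff
  rw [← integral_add_right_eq_self (fun t => fourier (-k) t • f t) a, ← integral_const_mul]
  congr 1
  ext t
  have : fourier (-k) (t + a) * fourier k a = (fourier (-k) t : ℂ) := by
    simp only [fourier_apply, ← Circle.coe_mul, ← AddCircle.toCircle_add]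
    congr 2
    simp
  simp only [smul_eq_mul]
  rw [← this]; ring

theorem aux_bv (f : ℝ → ℝ) (hf : Continuous f) (hp : Function.Periodic f (2 * π))
    (hb : BoundedVariationOn f (Set.Icc 0 (2 * π))) :
    ∃ C : ℝ, 0 ≤ C ∧ ∀ h : ℝ, 0 ≤ h → h ≤ 1 →
      ∫ t in (0:ℝ)..(2 * π), |f (t + h) - f (t - h)| ≤ C * h := by
  have hpi := Real.pi_gt_three
  have hS : BoundedVariationOn f (Set.Icc (-(2 * π)) (4 * π)) := by
    have h1 : eVariationOn f (Set.Icc (-(2 * π)) 0) ≤ eVariationOn f (Set.Icc 0 (2 * π)) := by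
      have := eVariationOn.comp_le_of_monotoneOn f (s := Set.Icc 0 (2 * π))
        (t := Set.Icc (-(2 * π)) 0) (fun x => x + 2 * π)
        (fun x _ y _ hxy => by simpa using hxy)
        (fun x hx => ⟨by linarith [hx.1], by linarith [hx.2]⟩)
      rwa [show f ∘ (fun x => x + 2 * π) = f from funext hp] at this
    have h2 : eVariationOn f (Set.Icc (2 * π) (4 * π)) ≤ eVariationOn f (Set.Icc 0 (2 * π)) := by
      have := eVariationOn.comp_le_of_monotoneOn f (s := Set.Icc 0 (2 * π))
        (t := Set.Icc (2 * π) (4 * π)) (fun x => x - 2 * π)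
        (fun x _ y _ hxy => by simpa using hxy)
        (fun x hx => ⟨by linarith [hx.1], by linarith [hx.2]⟩)
      rwa [show f ∘ (fun x => x - 2 * π) = f from funext hp.sub_eq] at this
    have e1 := eVariationOn.Icc_add_Icc f (s := Set.univ) (a := -(2 * π)) (b := 0) (c := 2 * π)
      (by linarith) (by linarith) trivial
    have e2 := eVariationOn.Icc_add_Icc f (s := Set.univ) (a := -(2 * π)) (b := 2 * π) (c := 4 * π)
      (by linarith) (by linarith) trivial
    simp only [Set.univ_inter] at e1 e2
    unfold BoundedVariationOn at *
    rw [← e2, ← e1]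
    exact ENNReal.add_ne_top.2 ⟨ENNReal.add_ne_top.2 ⟨ne_top_of_le_ne_top hb h1, hb⟩,
      ne_top_of_le_ne_top hb h2⟩
  obtain ⟨p, q, hpm, hqm, hpq⟩ := hS.locallyBoundedVariationOn.exists_monotoneOn_sub_monotoneOn
  set S := Set.Icc (-(2 * π)) (4 * π) with hSdef
  set W : ℝ → ℝ := fun x => p x + q x with hW
  have hWm : MonotoneOn W S := hpm.add hqm
  have hint : ∀ a b, a ∈ S → b ∈ S → IntervalIntegrable W volume a b := fun a b ha hb' =>
    (hWm.mono (Set.OrdConnected.uIcc_subset Set.ordConnected_Icc ha hb')).intervalIntegrable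
  have hlo : -(2 * π) ∈ S := ⟨le_rfl, by linarith⟩
  have hhi : 4 * π ∈ S := ⟨by linarith, le_rfl⟩
  refine ⟨2 * (W (4 * π) - W (-(2 * π))), ?_, fun h h0 h1 => ?_⟩
  · have := hWm hlo hhi (by linarith)
    linarith
  have m1 : -h ∈ S := ⟨by linarith, by linarith⟩
  have m2 : h ∈ S := ⟨by linarith, by linarith⟩
  have m3 : 2 * π - h ∈ S := ⟨by linarith, by linarith⟩
  have m4 : 2 * π + h ∈ S := ⟨by linarith, by linarith⟩
  have i1 : IntervalIntegrable (fun t => W (t + h)) volume 0 (2 * π) := by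
    have := (hint _ _ m2 m4).comp_add_right h
    simpa using this
  have i2 : IntervalIntegrable (fun t => W (t - h)) volume 0 (2 * π) := by
    have := (hint _ _ m1 m3).comp_sub_right h
    simpa using this
  have step1 : ∫ t in (0:ℝ)..(2 * π), |f (t + h) - f (t - h)| ≤
      ∫ t in (0:ℝ)..(2 * π), (W (t + h) - W (t - h)) := by
    apply intervalIntegral.integral_mono_on (by linarith) _ (i1.sub i2)
    · intro t ht
      have a1 : t + h ∈ S := ⟨by linarith [ht.1], by linarith [ht.2]⟩
      have a2 : t - h ∈ S := ⟨by linarith [ht.1], by linarith [ht.2]⟩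
      have b1 := hpm a2 a1 (by linarith)
      have b2 := hqm a2 a1 (by linarith)
      simp only [hpq, hW, Pi.sub_apply]
      rw [abs_le]
      constructor <;> linarith
    · apply Continuous.intervalIntegrable
      fun_prop
  refine step1.trans ?_
  rw [intervalIntegral.integral_sub i1 i2, intervalIntegral.integral_comp_add_right,
    intervalIntegral.integral_comp_sub_right, zero_add, zero_sub]
  have s1 := intervalIntegral.integral_add_adjacent_intervals (hint _ _ m2 m3) (hint _ _ m3 m4)
  have s2 := intervalIntegral.integral_add_adjacent_intervals (hint _ _ m1 m2) (hint _ _ m2 m3)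
  have u1 : ∫ t in (2 * π - h)..(2 * π + h), W t ≤ ∫ t in (2 * π - h)..(2 * π + h), W (4 * π) := by
    apply intervalIntegral.integral_mono_on (by linarith) (hint _ _ m3 m4) (by simp)
    intro t ht
    exact hWm ⟨by linarith [ht.1], by linarith [ht.2]⟩ hhi (by linarith [ht.2])
  have u2 : ∫ t in (-h)..h, W (-(2 * π)) ≤ ∫ t in (-h)..h, W t := by
    apply intervalIntegral.integral_mono_on (by linarith) (by simp) (hint _ _ m1 m2)
    intro t ht
    exact hWm hlo ⟨by linarith [ht.1], by linarith [ht.2]⟩ (by linarith [ht.1])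
  simp only [intervalIntegral.integral_const, smul_eq_mul] at u1 u2
  nlinarith

theorem aux_main [Fact ((0 : ℝ) < 2 * π)]
    (g : AddCircle (2 * π) → ℝ) (hg : Continuous g)
    (v : AddCircle (2 * π) → ℝ) (hv : Continuous v)
    (hconj : ∀ k : ℤ,
      fourierCoeff (fun t => (v t : ℂ)) k =
        -Complex.I * (k.sign : ℂ) * fourierCoeff (fun t => (g t : ℂ)) k) (h : ℝ) :
    HasSum (fun k : ℤ => ‖fourierCoeff (fun t => (g t : ℂ)) k‖ ^ 2 * (2 * Real.sin (|(k : ℝ)| * h)))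
      (∫ t, (v (t + (h : AddCircle (2 * π))) - v (t - (h : AddCircle (2 * π)))) * g t
        ∂haarAddCircle) := by
  have hc1 : Continuous fun t => (g t : ℂ) := by fun_prop
  have hcv : Continuous fun t => (v t : ℂ) := by fun_prop
  have hcp : Continuous fun t => (v (t + (h : AddCircle (2 * π))) : ℂ) := by fun_prop
  have hcm : Continuous fun t => (v (t + (-h : AddCircle (2 * π))) : ℂ) := by fun_prop
  have P1 := aux_parseval ⟨_, hc1⟩ ⟨_, hcp⟩
  have P2 := aux_parseval ⟨_, hc1⟩ ⟨_, hcm⟩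
  have P := P1.sub P2
  rw [← Complex.hasSum_ofReal]
  have i1 : Integrable (fun t => (v (t + (h : AddCircle (2 * π))) : ℂ) * conj (g t : ℂ))
      haarAddCircle :=
    (by fun_prop : Continuous _).integrable_of_hasCompactSupport (HasCompactSupport.of_compactSpace _)
  have i2 : Integrable (fun t => (v (t + (-h : AddCircle (2 * π))) : ℂ) * conj (g t : ℂ))
      haarAddCircle :=
    (by fun_prop : Continuous _).integrable_of_hasCompactSupport (HasCompactSupport.of_compactSpace _)
  have e : (∫ t, (v (t + (h : AddCircle (2 * π))) : ℂ) * conj (g t : ℂ) ∂haarAddCircle) -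
      (∫ t, (v (t + (-h : AddCircle (2 * π))) : ℂ) * conj (g t : ℂ) ∂haarAddCircle) =
      ((∫ t, (v (t + (h : AddCircle (2 * π))) - v (t - (h : AddCircle (2 * π)))) * g t
        ∂haarAddCircle : ℝ) : ℂ) := by
    rw [← integral_sub i1 i2, ← integral_complex_ofReal]
    congr 1
    ext t
    simp [sub_eq_add_neg, add_mul]
  simp only [ContinuousMap.coe_mk] at P
  rw [e] at P
  refine P.congr_fun (fun k => ?_)
  rw [aux_shift (fun t => (v t : ℂ)), aux_shift (fun t => (v t : ℂ)), hconj k, ← mul_sub, ← sub_mul]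
  have hs : (fourier k (h : AddCircle (2 * π)) : ℂ) - fourier k (-(h : AddCircle (2 * π))) =
      2 * Complex.I * (Real.sin (k * h) : ℂ) := by
    rw [← AddCircle.coe_neg, fourier_coe_apply, fourier_coe_apply]
    have hpi : (π : ℂ) ≠ 0 := by exact_mod_cast Real.pi_ne_zero
    have a1 : 2 * (π : ℂ) * Complex.I * k * (h : ℝ) / ((2 * π : ℝ) : ℂ) = (k * h : ℂ) * Complex.I := by
      push_cast; field_simp
    have a2 : 2 * (π : ℂ) * Complex.I * k * ((-h : ℝ) : ℂ) / ((2 * π : ℝ) : ℂ) =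
        -(k * h : ℂ) * Complex.I := by
      push_cast; field_simp
    rw [a1, a2, Complex.ofReal_sin, Complex.sin]
    push_cast
    linear_combination (-(Complex.exp (-(k * h : ℂ) * Complex.I)) +
      Complex.exp ((k * h : ℂ) * Complex.I)) * Complex.I_sq
  rw [hs]
  have hsg : Real.sin (|(k : ℝ)| * h) = k.sign * Real.sin (k * h) := by
    rcases lt_trichotomy k 0 with hk | hk | hk
    · have : (k : ℝ) < 0 := by exact_mod_cast hk
      rw [abs_of_neg this, Int.sign_eq_neg_one_of_neg hk, neg_mul, Real.sin_neg]
      simp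
    · simp [hk]
    · have : (0 : ℝ) < k := by exact_mod_cast hk
      rw [abs_of_pos this, Int.sign_eq_one_of_pos hk]
      simp
  rw [hsg]
  have hn := Complex.conj_mul' (fourierCoeff (fun t => (g t : ℂ)) k)
  push_cast
  rw [← hn]
  linear_combination (2 * Complex.sin (k * h) * (k.sign : ℂ) *
    conj (fourierCoeff (fun t => (g t : ℂ)) k) * fourierCoeff (fun t => (g t : ℂ)) k) * Complex.I_sq

/-- If `g` is continuous on the circle and its conjugate function is continuous and of bounded
variation, then `g` belongs to the Sobolev space `W₂^{1/2}(𝕋)`. -/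
theorem sobolev_half_of_conjugate_bounded_variation
    [inst : Fact ((0 : ℝ) < 2 * π)]
    (g : AddCircle (2 * π) → ℝ) (hg : Continuous g)
    (v : AddCircle (2 * π) → ℝ) (hv : Continuous v)
    (hvBV : BoundedVariationOn (fun t : ℝ => v (t : AddCircle (2 * π))) (Set.Icc 0 (2 * π)))
    (hconj : ∀ k : ℤ,
      fourierCoeff (fun t => (v t : ℂ)) k =
        -Complex.I * (k.sign : ℂ) * fourierCoeff (fun t => (g t : ℂ)) k) :
    Summable (fun k : ℤ => ‖fourierCoeff (fun t => (g t : ℂ)) k‖ ^ 2 * |(k : ℝ)|) := by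
  have hpi := Real.pi_gt_three
  have main := aux_main g hg v hv hconj
  have hc1 : Continuous fun t => (g t : ℂ) := by fun_prop
  have hasum : Summable fun k : ℤ => ‖fourierCoeff (fun t => (g t : ℂ)) k‖ ^ 2 := by
    have := (aux_parseval ⟨_, hc1⟩ ⟨_, hc1⟩).summable.norm
    refine this.congr (fun k => ?_)
    simp [sq]
  set a : ℤ → ℝ := fun k => ‖fourierCoeff (fun t => (g t : ℂ)) k‖ ^ 2 with ha
  have ha0 : ∀ k, 0 ≤ a k := fun k => by positivity
  obtain ⟨C, hC0, hC⟩ := aux_bv (fun t : ℝ => v (t : AddCircle (2 * π)))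
    (hv.comp (AddCircle.continuous_mk' _)) (fun t => by simp) hvBV
  obtain ⟨M, hM⟩ : ∃ M, ∀ t, |g t| ≤ M := by
    obtain ⟨M, hM⟩ := (isCompact_range hg.norm).bddAbove
    exact ⟨M, fun t => hM ⟨t, rfl⟩⟩
  have hM0 : 0 ≤ M := (abs_nonneg _).trans (hM 0)
  set K := (2 * π)⁻¹ * (M * C) with hK
  have hK0 : 0 ≤ K := by positivity
  have bd : ∀ h : ℝ, 0 ≤ h → h ≤ 1 →
      ‖∫ t, (v (t + (h : AddCircle (2 * π))) - v (t - (h : AddCircle (2 * π)))) * g t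
        ∂haarAddCircle‖ ≤ K * h := by
    intro h h0 h1
    have r1 : ‖∫ t, (v (t + (h : AddCircle (2 * π))) - v (t - (h : AddCircle (2 * π)))) * g t
        ∂haarAddCircle‖ ≤ ∫ t, |v (t + (h : AddCircle (2 * π))) - v (t - (h : AddCircle (2 * π)))| * M
        ∂haarAddCircle := by
      apply norm_integral_le_of_norm_le
      · exact (by fun_prop : Continuous _).integrable_of_hasCompactSupport (HasCompactSupport.of_compactSpace _)
      · refine Filter.Eventually.of_forall (fun t => ?_)
        rw [norm_mul]
        exact mul_le_mul_of_nonneg_left (hM t) (abs_nonneg _)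
    refine r1.trans ?_
    rw [integral_mul_const, integral_haarAddCircle, ← AddCircle.intervalIntegral_preimage (2 * π) 0]
    have := hC h h0 h1
    simp only [zero_add, smul_eq_mul]
    simp only [AddCircle.coe_add, AddCircle.coe_sub] at this
    calc _ ≤ (2 * π)⁻¹ * (C * h) * M := by gcongr
      _ = K * h := by rw [hK]; ring
  have bd2 : ∀ H : ℝ, 0 ≤ H → H ≤ 1 → ∀ F : Finset ℤ,
      ∑ k ∈ F, a k * (2 * ((1 - Real.cos (|(k : ℝ)| * H)) / |(k : ℝ)|)) ≤ K * H * H := by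
    intro H H0 H1 F
    have hs := intervalIntegral.hasSum_integral_of_dominated_convergence (μ := volume)
      (a := 0) (b := H) (fun k _ => a k * 2)
      (F := fun (k : ℤ) h => a k * (2 * Real.sin (|(k : ℝ)| * h)))
      (f := fun h : ℝ => ∫ t, (v (t + (h : AddCircle (2 * π))) - v (t - (h : AddCircle (2 * π)))) * g t
        ∂haarAddCircle)
      (fun k => (by fun_prop : Continuous _).aestronglyMeasurable)
      (fun k => Filter.Eventually.of_forall fun t _ => by
        rw [norm_mul, norm_mul, Real.norm_of_nonneg (ha0 k)]
        refine mul_le_mul_of_nonneg_left ?_ (ha0 k)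
        have := Real.abs_sin_le_one (|(k : ℝ)| * t)
        simp only [Real.norm_eq_abs, Nat.abs_ofNat]
        linarith)
      (Filter.Eventually.of_forall fun t _ => hasum.mul_right 2)
      (by simp)
      (Filter.Eventually.of_forall fun t _ => main t)
    have hI : ∀ k : ℤ, ∫ h in (0:ℝ)..H, a k * (2 * Real.sin (|(k : ℝ)| * h)) =
        a k * (2 * ((1 - Real.cos (|(k : ℝ)| * H)) / |(k : ℝ)|)) := by
      intro k
      rcases eq_or_ne k 0 with rfl | hk
      · simp
      · have : |(k : ℝ)| ≠ 0 := by simpa using hk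
        rw [intervalIntegral.integral_const_mul, intervalIntegral.integral_const_mul,
          intervalIntegral.integral_comp_mul_left _ this, integral_sin]
        simp only [mul_zero, Real.cos_zero, smul_eq_mul]
        field_simp
    simp only [hI] at hs
    refine (sum_le_hasSum F (fun k _ => ?_) hs).trans ?_
    · have := Real.cos_le_one (|(k : ℝ)| * H)
      have h2 : 0 ≤ 1 - Real.cos (|(k : ℝ)| * H) := by linarith
      have := ha0 k
      positivity
    · refine (le_abs_self _).trans ?_
      have := intervalIntegral.norm_integral_le_of_norm_le_const (a := 0) (b := H) (C := K * H)
        (f := fun h : ℝ => ∫ t, (v (t + (h : AddCircle (2 * π))) - v (t - (h : AddCircle (2 * π)))) * g t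
        ∂haarAddCircle) (fun h hh => by
          rw [Set.uIoc_of_le H0] at hh
          refine (bd h hh.1.le (hh.2.trans H1)).trans ?_
          exact mul_le_mul_of_nonneg_left hh.2 hK0)
      rwa [sub_zero, abs_of_nonneg H0] at this
  refine summable_of_sum_le (c := K * π ^ 2 / 4)
    (fun k => mul_nonneg (ha0 k) (abs_nonneg _)) (fun F => ?_)
  set N : ℝ := 1 + ∑ k ∈ F, |(k : ℝ)| with hN
  have hN1 : 1 ≤ N := by
    have : 0 ≤ ∑ k ∈ F, |(k : ℝ)| := Finset.sum_nonneg fun _ _ => abs_nonneg _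
    linarith
  have hNp : 0 < N := by linarith
  have hb := bd2 N⁻¹ (by positivity) (inv_le_one_of_one_le₀ hN1) F
  have hterm : ∀ k ∈ F, a k * |(k : ℝ)| * (4 / π ^ 2 * (N⁻¹ * N⁻¹)) ≤
      a k * (2 * ((1 - Real.cos (|(k : ℝ)| * N⁻¹)) / |(k : ℝ)|)) := by
    intro k hk
    rw [mul_assoc]
    refine mul_le_mul_of_nonneg_left ?_ (ha0 k)
    rcases eq_or_ne k 0 with rfl | hk0
    · simp
    have hkp : 0 < |(k : ℝ)| := by simpa using hk0
    have hkN : |(k : ℝ)| ≤ N := by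
      have := Finset.single_le_sum (f := fun k : ℤ => |(k : ℝ)|) (fun i _ => abs_nonneg _) hk
      linarith
    have hx : |(|(k : ℝ)| * N⁻¹)| ≤ π := by
      rw [abs_of_nonneg (by positivity), ← div_eq_mul_inv, div_le_iff₀ hNp]
      nlinarith
    have hcos := Real.cos_le_one_sub_mul_cos_sq hx
    have : 2 / π ^ 2 * (|(k : ℝ)| * N⁻¹) ^ 2 ≤ 1 - Real.cos (|(k : ℝ)| * N⁻¹) := by linarith
    calc |(k : ℝ)| * (4 / π ^ 2 * (N⁻¹ * N⁻¹))
        = 2 * ((2 / π ^ 2 * (|(k : ℝ)| * N⁻¹) ^ 2) / |(k : ℝ)|) := by field_simp; ring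
      _ ≤ _ := by gcongr
  have hb' := (Finset.sum_le_sum hterm).trans hb
  rw [← Finset.sum_mul] at hb'
  have hN2 : 0 < N⁻¹ * N⁻¹ := by positivity
  have hb3 : (∑ k ∈ F, a k * |(k : ℝ)|) * (4 / π ^ 2) ≤ K := by
    refine le_of_mul_le_mul_right ?_ hN2
    linarith
  rw [← mul_div_assoc, div_le_iff₀ (by positivity)] at hb3
  linarith
end

section
/- Let f : 𝕋 → ℝ be a continuous real-valued function on the circle 𝕋 = ℝ/2πℤ. Then there exists a homeomorphism h of 𝕋 onto itself such that the Fourier series of g = f∘h converges uniformly to g: for every ε > 0 there is N such that for all n ≥ N and all t ∈ 𝕋, |Σ_{|k|≤n} ĝ(k) e^{ikt} − g(t)| < ε (the Bohr–Pál theorem, as deduced from the Jurkat–Waterman theorem). -/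
open scoped Real

namespace BP

noncomputable def Phi (n : ℕ) (v : ℝ) : ℝ := ∑ k ∈ Finset.range n, Real.sin ((k + 1 : ℝ) * v) / (k + 1 : ℝ)

noncomputable def Dk (n : ℕ) (v : ℝ) : ℝ := 1 + 2 * ∑ k ∈ Finset.range n, Real.cos ((k + 1 : ℝ) * v)

lemma Phi_hasDeriv (n : ℕ) (v : ℝ) :
    HasDerivAt (Phi n) (∑ k ∈ Finset.range n, Real.cos ((k + 1 : ℝ) * v)) v := by
  unfold Phi
  apply HasDerivAt.fun_sum
  intro k _
  have h1 : HasDerivAt (fun v : ℝ => (k + 1 : ℝ) * v) (k + 1 : ℝ) v := by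
    simpa using (hasDerivAt_id v).const_mul (k + 1 : ℝ)
  have h2 := h1.sin.div_const (k + 1 : ℝ)
  refine h2.congr_deriv ?_
  field_simp

lemma Phi_neg (n : ℕ) (v : ℝ) : Phi n (-v) = - Phi n v := by
  unfold Phi
  rw [← Finset.sum_neg_distrib]
  refine Finset.sum_congr rfl fun k _ => ?_
  rw [mul_neg, Real.sin_neg, neg_div]

lemma Phi_periodic (n : ℕ) : Function.Periodic (Phi n) (2 * π) := by
  intro v
  unfold Phi
  refine Finset.sum_congr rfl fun k _ => ?_
  congr 1
  have := Real.sin_add_nat_mul_two_pi ((k + 1 : ℝ) * v) (k + 1)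
  rw [← this]
  congr 1
  push_cast
  ring

lemma Phi_pi (n : ℕ) : Phi n π = 0 := by
  unfold Phi
  refine Finset.sum_eq_zero fun k _ => ?_
  have := Real.sin_nat_mul_pi (k + 1)
  push_cast at this
  rw [this, zero_div]

lemma Phi_lip (n : ℕ) (u v : ℝ) : |Phi n u - Phi n v| ≤ n * |u - v| := by
  unfold Phi
  rw [← Finset.sum_sub_distrib]
  refine (Finset.abs_sum_le_sum_abs _ _).trans ?_
  have : ∀ k ∈ Finset.range n, |Real.sin ((k + 1 : ℝ) * u) / (k + 1 : ℝ) - Real.sin ((k + 1 : ℝ) * v) / (k + 1 : ℝ)| ≤ |u - v| := by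
    intro k _
    have hk : (0 : ℝ) < k + 1 := by positivity
    rw [← sub_div, abs_div, abs_of_pos hk, div_le_iff₀ hk]
    have h := Real.abs_sin_sub_sin_le ((k + 1 : ℝ) * u) ((k + 1 : ℝ) * v)
    rw [← mul_sub, abs_mul, abs_of_pos hk] at h
    linarith
  refine (Finset.sum_le_sum this).trans ?_
  simp

lemma cos_sum (n : ℕ) (v : ℝ) :
    (2 * Real.sin (v / 2)) * (∑ k ∈ Finset.range n, Real.cos ((k + 1 : ℝ) * v) + 1 / 2) =
      Real.sin ((n + 1 / 2 : ℝ) * v) := by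
  induction n with
  | zero => simp; ring_nf
  | succ n ih =>
    rw [Finset.sum_range_succ]
    have e1 : ((n + 1 : ℕ) + 1 / 2 : ℝ) * v = (n + 1 : ℝ) * v + v / 2 := by push_cast; ring
    have e2 : (n + 1 / 2 : ℝ) * v = (n + 1 : ℝ) * v - v / 2 := by ring
    rw [e1, Real.sin_add]
    rw [e2, Real.sin_sub] at ih
    linear_combination ih

lemma G_half (n : ℕ) (v : ℝ) (hv0 : 0 < v) (hv1 : v ≤ π) :
    |Phi n v - (π - v) / 2| ≤ 2 / ((2 * n + 1) * Real.sin (v / 2)) := by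
  set m : ℝ := 2 * n + 1 with hm
  have hm0 : 0 < m := by positivity
  have hs : ∀ x ∈ Set.Ioc 0 π, 0 < Real.sin (x / 2) := fun x hx =>
    Real.sin_pos_of_pos_of_lt_pi (by linarith [hx.1]) (by linarith [hx.1, hx.2])
  have hc : ∀ x ∈ Set.Ioc 0 π, 0 ≤ Real.cos (x / 2) := fun x hx =>
    Real.cos_nonneg_of_mem_Icc ⟨by linarith [hx.1, Real.pi_pos], by linarith [hx.2]⟩
  let Q : ℝ → ℝ := fun v => Phi n v - (π - v) / 2 + Real.cos ((n + 1 / 2 : ℝ) * v) / (m * Real.sin (v / 2))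
  let R : ℝ → ℝ := fun v => 1 / (m * Real.sin (v / 2))
  have hden : ∀ x : ℝ, HasDerivAt (fun x : ℝ => m * Real.sin (x / 2)) (m * (Real.cos (x / 2) * (1 / 2))) x := by
    intro x
    have h1 : HasDerivAt (fun v : ℝ => v / 2) (1 / 2) x := by
      simpa using (hasDerivAt_id x).div_const 2
    exact h1.sin.const_mul m
  have hR : ∀ x ∈ Set.Ioc 0 π, HasDerivAt R (-(Real.cos (x / 2)) / (2 * m * Real.sin (x / 2) ^ 2)) x := by
    intro x hx
    have hne := (hs x hx).ne'
    have := (hasDerivAt_const x (1 : ℝ)).fun_div (hden x) (by positivity)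
    refine this.congr_deriv ?_
    field_simp
    ring
  have hQ : ∀ x ∈ Set.Ioc 0 π, HasDerivAt Q (-(Real.cos ((n + 1 / 2 : ℝ) * x) * Real.cos (x / 2)) / (2 * m * Real.sin (x / 2) ^ 2)) x := by
    intro x hx
    have hne := (hs x hx).ne'
    have h1 : HasDerivAt (fun v : ℝ => (n + 1 / 2 : ℝ) * v) (n + 1 / 2 : ℝ) x := by
      simpa using (hasDerivAt_id x).const_mul (n + 1 / 2 : ℝ)
    have h2 := h1.cos.fun_div (hden x) (by positivity)
    have h3 : HasDerivAt (fun v : ℝ => (π - v) / 2) (-1 / 2) x := by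
      simpa using ((hasDerivAt_id x).const_sub π).div_const 2
    have h4 := ((Phi_hasDeriv n x).fun_sub h3).fun_add h2
    refine h4.congr_deriv ?_
    have h5 := cos_sum n x
    have h6 : ∑ k ∈ Finset.range n, Real.cos ((k + 1 : ℝ) * x) = Real.sin ((n + 1 / 2 : ℝ) * x) / (2 * Real.sin (x / 2)) - 1 / 2 := by
      rw [← h5, mul_div_cancel_left₀ _ (by positivity)]; ring
    rw [h6]
    have : (n : ℝ) + 1 / 2 = m / 2 := by rw [hm]; ring
    rw [this]
    field_simp
    ring
  have hint : interior (Set.Icc v π) ⊆ Set.Ioc 0 π := by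
    rw [interior_Icc]; intro x hx; exact ⟨hv0.trans hx.1, hx.2.le⟩
  have hsub : Set.Icc v π ⊆ Set.Ioc 0 π := fun x hx => ⟨hv0.trans_le hx.1, hx.2⟩
  have key : ∀ s : ℝ, |s| = 1 → AntitoneOn (fun x => R x + s * Q x) (Set.Icc v π) := by
    intro s hs1
    apply antitoneOn_of_deriv_nonpos (convex_Icc _ _)
    · intro x hx
      exact ((hR x (hsub hx)).fun_add ((hQ x (hsub hx)).const_mul s)).continuousAt.continuousWithinAt
    · intro x hx
      exact ((hR x (hint hx)).fun_add ((hQ x (hint hx)).const_mul s)).differentiableAt.differentiableWithinAt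
    · intro x hx
      rw [((hR x (hint hx)).fun_add ((hQ x (hint hx)).const_mul s)).deriv]
      have hp := hs x (hint hx)
      have hcc := hc x (hint hx)
      have : -Real.cos (x / 2) / (2 * m * Real.sin (x / 2) ^ 2) + s * (-(Real.cos ((n + 1 / 2 : ℝ) * x) * Real.cos (x / 2)) / (2 * m * Real.sin (x / 2) ^ 2)) = -((1 + s * Real.cos ((n + 1 / 2 : ℝ) * x)) * Real.cos (x / 2) / (2 * m * Real.sin (x / 2) ^ 2)) := by
        ring
      rw [this, neg_nonpos]
      have h7 : |s * Real.cos ((n + 1 / 2 : ℝ) * x)| ≤ 1 := by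
        rw [abs_mul, hs1, one_mul]; exact Real.abs_cos_le_one _
      have h8 : 0 ≤ 1 + s * Real.cos ((n + 1 / 2 : ℝ) * x) := by linarith [(abs_le.1 h7).1]
      positivity
  have hQpi : Q π = 0 := by
    have : Real.cos ((n + 1 / 2 : ℝ) * π) = 0 := by
      rw [show ((n + 1 / 2 : ℝ) * π) = n * π + π / 2 by ring, Real.cos_add_pi_div_two, Real.sin_nat_mul_pi, neg_zero]
    simp only [Q, Phi_pi, this]
    simp
  have hRpi : 0 ≤ R π := by
    have := hs π ⟨Real.pi_pos, le_rfl⟩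
    positivity
  have a1 := key 1 (by simp) (Set.left_mem_Icc.2 hv1) (Set.right_mem_Icc.2 hv1) hv1
  have a2 := key (-1) (by simp) (Set.left_mem_Icc.2 hv1) (Set.right_mem_Icc.2 hv1) hv1
  simp only [hQpi] at a1 a2
  have hsv := hs v ⟨hv0, hv1⟩
  have hb : |Real.cos ((n + 1 / 2 : ℝ) * v) / (m * Real.sin (v / 2))| ≤ R v := by
    rw [abs_div, abs_of_pos (by positivity : 0 < m * Real.sin (v / 2))]
    simp only [R]
    gcongr
    exact Real.abs_cos_le_one _
  have e : 2 / (m * Real.sin (v / 2)) = R v + R v := by simp only [R]; ring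
  rw [e]
  have hQv : Phi n v - (π - v) / 2 = Q v - Real.cos ((n + 1 / 2 : ℝ) * v) / (m * Real.sin (v / 2)) := by
    simp only [Q]; ring
  rw [hQv]
  have hb' := abs_le.1 hb
  rw [abs_le]
  constructor <;> linarith [hb'.1, hb'.2]

lemma G_full (n : ℕ) (v : ℝ) (hv0 : 0 < v) (hv1 : v < 2 * π) :
    |Phi n v - (π - v) / 2| ≤ 2 / ((2 * n + 1) * Real.sin (v / 2)) := by
  rcases le_total v π with h | h
  · exact G_half n v hv0 h
  · have := G_half n (2 * π - v) (by linarith) (by linarith)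
    have e1 : Phi n (2 * π - v) = - Phi n v := by
      rw [← Phi_neg, ← Phi_periodic n (-v)]; congr 1; ring
    have e2 : Real.sin ((2 * π - v) / 2) = Real.sin (v / 2) := by
      rw [← Real.sin_pi_sub]; congr 1; ring
    rw [e1, e2] at this
    rw [← abs_neg]
    convert this using 2
    ring

lemma Phi_bound (n : ℕ) (v : ℝ) : |Phi n v| ≤ 4 := by
  have h1 : ∀ v, 0 ≤ v → v ≤ π → |Phi n v| ≤ 4 := by
    intro v hv0 hv1
    by_cases h : n * v ≤ 4
    · have := Phi_lip n v 0
      have h0 : Phi n 0 = 0 := by simp [Phi]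
      rw [h0, sub_zero, sub_zero, abs_of_nonneg hv0] at this
      linarith
    · push Not at h
      have hv : 0 < v := by
        rcases hv0.eq_or_lt with h' | h'
        · rw [← h'] at h; simp at h; linarith
        · exact h'
      have h2 := G_half n v hv hv1
      have h3 : v / π ≤ Real.sin (v / 2) := by
        have := Real.mul_le_sin (x := v / 2) (by linarith) (by linarith)
        convert this using 1
        field_simp
      have h4 : 2 / ((2 * n + 1) * Real.sin (v / 2)) ≤ 1 := by
        have hvp : 0 < v / π := by positivity
        rw [div_le_one (by have := hvp.trans_le h3; positivity)]
        have : 2 ≤ (2 * n + 1) * (v / π) := by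
          rw [← mul_div_assoc, le_div_iff₀ Real.pi_pos]
          nlinarith [Real.pi_lt_d2]
        refine this.trans ?_
        gcongr
      have h5 := abs_le.1 (h2.trans h4)
      have := Real.pi_lt_d2
      rw [abs_le]
      constructor <;> linarith [h5.1, h5.2]
  obtain ⟨y, hy, hyv⟩ := (Phi_periodic n).exists_mem_Ico Real.two_pi_pos v (-π)
  rw [hyv]
  rcases le_total 0 y with h | h
  · exact h1 y h (by linarith [hy.2])
  · rw [← abs_neg, ← Phi_neg]
    exact h1 (-y) (by linarith) (by linarith [hy.1])

noncomputable def En (n : ℕ) (v : ℝ) : ℝ := Phi n v - ((if 0 ≤ v then π / 2 else - (π / 2)) - v / 2)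

lemma En_bound (n : ℕ) (v : ℝ) (h1 : -(2 * π) ≤ v) (h2 : v ≤ 2 * π) : |En n v| ≤ 6 := by
  have h3 := abs_le.1 (Phi_bound n v)
  have := Real.pi_lt_d2
  unfold En
  rw [abs_le]
  split_ifs <;> constructor <;> linarith [h3.1, h3.2]

lemma En_small (n : ℕ) (v : ℝ) (h1 : -(2 * π) ≤ v) (h2 : v ≤ 2 * π) (hs : Real.sin (v / 2) ≠ 0) :
    |En n v| ≤ 2 / ((2 * n + 1) * |Real.sin (v / 2)|) := by
  have hA : v ≠ 2 * π := by rintro rfl; simp at hs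
  have hB : v ≠ -(2 * π) := by rintro rfl; simp [neg_div] at hs
  have hC : v ≠ 0 := by rintro rfl; simp at hs
  rcases lt_or_gt_of_ne hC with h | h
  · have := G_full n (-v) (by linarith) (by have := lt_of_le_of_ne h1 hB.symm; linarith)
    have hp : 0 < Real.sin (-v / 2) := Real.sin_pos_of_pos_of_lt_pi (by linarith) (by have := lt_of_le_of_ne h1 hB.symm; linarith)
    rw [Phi_neg] at this
    have e : |Real.sin (v / 2)| = Real.sin (-v / 2) := by
      rw [← abs_neg, ← Real.sin_neg, ← neg_div, abs_of_pos hp]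
    rw [e]
    unfold En
    rw [if_neg (by linarith), ← abs_neg]
    convert this using 2
    ring
  · have := G_full n v h (lt_of_le_of_ne h2 hA)
    have hp : 0 < Real.sin (v / 2) := Real.sin_pos_of_pos_of_lt_pi (by linarith) (by have := lt_of_le_of_ne h2 hA; linarith)
    rw [abs_of_pos hp]
    unfold En
    rw [if_pos h.le]
    convert this using 2
    ring

noncomputable def S (n : ℕ) (u : ℝ → ℝ) (t : ℝ) : ℝ :=
  (1 / (2 * π)) * ∫ x in (0 : ℝ)..(2 * π), u x * Dk n (t - x)

lemma Dk_continuous (n : ℕ) : Continuous (Dk n) := by unfold Dk; fun_prop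

lemma Dk_bound (n : ℕ) (v : ℝ) : |Dk n v| ≤ 2 * n + 1 := by
  unfold Dk
  have : |∑ k ∈ Finset.range n, Real.cos ((k + 1 : ℝ) * v)| ≤ n := by
    refine (Finset.abs_sum_le_sum_abs _ _).trans ?_
    refine (Finset.sum_le_sum fun k _ => Real.abs_cos_le_one _).trans ?_
    simp
  have := abs_le.1 this
  rw [abs_le]
  constructor <;> linarith [this.1, this.2]

lemma S_congr (n : ℕ) {u v : ℝ → ℝ} (h : ∀ x ∈ Set.Icc 0 (2 * π), u x = v x) (t : ℝ) :
    S n u t = S n v t := by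
  unfold S
  congr 1
  apply intervalIntegral.integral_congr
  intro x hx
  rw [Set.uIcc_of_le Real.two_pi_pos.le] at hx
  simp only [h x hx]

lemma S_close (n : ℕ) {u v : ℝ → ℝ} (hu : IntervalIntegrable u MeasureTheory.volume 0 (2 * π))
    (hv : IntervalIntegrable v MeasureTheory.volume 0 (2 * π)) {ε : ℝ}
    (h : ∀ x ∈ Set.Icc 0 (2 * π), |u x - v x| ≤ ε) (t : ℝ) :
    |S n u t - S n v t| ≤ (2 * n + 1) * ε := by
  have hc : Continuous fun x => Dk n (t - x) := (Dk_continuous n).comp (by fun_prop)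
  unfold S
  rw [← mul_sub, ← intervalIntegral.integral_sub (hu.mul_continuousOn hc.continuousOn)
    (hv.mul_continuousOn hc.continuousOn)]
  have h1 := intervalIntegral.norm_integral_le_of_norm_le_const (a := 0) (b := 2 * π)
    (f := fun x => u x * Dk n (t - x) - v x * Dk n (t - x)) (C := (2 * n + 1) * ε) (by
      intro x hx
      rw [Set.uIoc_of_le Real.two_pi_pos.le] at hx
      rw [← sub_mul, Real.norm_eq_abs, abs_mul, mul_comm]
      have := h x ⟨hx.1.le, hx.2⟩
      have := Dk_bound n (t - x)
      gcongr)
  rw [Real.norm_eq_abs, sub_zero, abs_of_pos Real.two_pi_pos] at h1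
  rw [abs_mul, abs_of_pos (by positivity : 0 < 1 / (2 * π))]
  rw [one_div, inv_mul_le_iff₀ Real.two_pi_pos]
  linarith

noncomputable def ind (a x : ℝ) : ℝ := if a ≤ x then 1 else 0

lemma ind_mono (a : ℝ) : Monotone (ind a) := by
  intro x y h
  unfold ind
  split_ifs <;> linarith

lemma ind_int (a : ℝ) : IntervalIntegrable (ind a) MeasureTheory.volume 0 (2 * π) :=
  (ind_mono a).intervalIntegrable

lemma S_ind (n : ℕ) {a : ℝ} (h0 : 0 ≤ a) (h1 : a ≤ 2 * π) (t : ℝ) :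
    S n (ind a) t = (2 * π - a + 2 * Phi n (t - a) - 2 * Phi n t) / (2 * π) := by
  have hc : Continuous fun x => Dk n (t - x) := (Dk_continuous n).comp (by fun_prop)
  have hI : IntervalIntegrable (fun x => ind a x * Dk n (t - x)) MeasureTheory.volume 0 (2 * π) :=
    (ind_int a).mul_continuousOn hc.continuousOn
  have hder : ∀ x : ℝ, HasDerivAt (fun x => -((t - x) + 2 * Phi n (t - x))) (Dk n (t - x)) x := by
    intro x
    have h1 : HasDerivAt (fun x : ℝ => t - x) (-1) x := by
      simpa using (hasDerivAt_id x).const_sub t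
    have h2 := (Phi_hasDeriv n (t - x)).comp x h1
    refine (h1.fun_add (h2.const_mul 2)).fun_neg.congr_deriv ?_
    unfold Dk
    ring
  have e1 : ∫ x in (0 : ℝ)..a, ind a x * Dk n (t - x) = 0 := by
    rw [intervalIntegral.integral_congr_ae (g := fun _ => 0)]
    · simp
    · have : ∀ᵐ x : ℝ, x ≠ a := by simp [MeasureTheory.ae_iff]
      filter_upwards [this] with x hx hxm
      rw [Set.uIoc_of_le h0] at hxm
      have : ¬ a ≤ x := by
        intro h; exact hx (le_antisymm hxm.2 h)
      simp [ind, this]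
  have e2 : ∫ x in a..(2 * π), ind a x * Dk n (t - x) = ∫ x in a..(2 * π), Dk n (t - x) := by
    apply intervalIntegral.integral_congr
    intro x hx
    rw [Set.uIcc_of_le h1] at hx
    simp [ind, hx.1]
  have e3 := intervalIntegral.integral_eq_sub_of_hasDerivAt (a := a) (b := 2 * π)
    (fun x _ => hder x) (hc.intervalIntegrable _ _)
  have e4 : Phi n (t - 2 * π) = Phi n t := (Phi_periodic n).sub_eq t
  unfold S
  rw [← intervalIntegral.integral_add_adjacent_intervals (b := a), e1, e2, e3, e4]
  · ring
  · exact hI.mono_set (by rw [Set.uIcc_of_le h0, Set.uIcc_of_le Real.two_pi_pos.le]; exact Set.Icc_subset_Icc_right h1)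
  · exact hI.mono_set (by rw [Set.uIcc_of_le h1, Set.uIcc_of_le Real.two_pi_pos.le]; exact Set.Icc_subset_Icc_left h0)

noncomputable def step (T : Finset ℝ) (d : ℝ → ℝ) (x : ℝ) : ℝ := ∑ a ∈ T, d a * ind a x

lemma step_int (T : Finset ℝ) (d : ℝ → ℝ) :
    IntervalIntegrable (step T d) MeasureTheory.volume 0 (2 * π) := by
  have := IntervalIntegrable.sum T (fun a (_ : a ∈ T) => (ind_int a).const_mul (d a))
  have e : step T d = ∑ a ∈ T, fun x => d a * ind a x := by
    ext x
    simp [step]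
  rw [e]
  exact this

lemma S_add (n : ℕ) {u v : ℝ → ℝ} (hu : IntervalIntegrable u MeasureTheory.volume 0 (2 * π))
    (hv : IntervalIntegrable v MeasureTheory.volume 0 (2 * π)) (c e : ℝ) (t : ℝ) :
    S n (fun x => c * u x + e * v x) t = c * S n u t + e * S n v t := by
  have hc : Continuous fun x => Dk n (t - x) := (Dk_continuous n).comp (by fun_prop)
  unfold S
  have : (fun x => (c * u x + e * v x) * Dk n (t - x)) =
      fun x => c * (u x * Dk n (t - x)) + e * (v x * Dk n (t - x)) := by ext; ring
  rw [this, intervalIntegral.integral_add ((hu.mul_continuousOn hc.continuousOn).const_mul c)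
    ((hv.mul_continuousOn hc.continuousOn).const_mul e), intervalIntegral.integral_const_mul,
    intervalIntegral.integral_const_mul]
  ring

lemma S_step (n : ℕ) (T : Finset ℝ) (d : ℝ → ℝ) (t : ℝ) :
    S n (step T d) t = ∑ a ∈ T, d a * S n (ind a) t := by
  induction T using Finset.induction_on with
  | empty => simp [S, step]
  | insert a T ha ih =>
    rw [Finset.sum_insert ha, ← ih]
    have := S_add n (ind_int a) (step_int T d) (d a) 1 t
    rw [one_mul] at this
    rw [← this]
    congr 1
    ext x
    simp [step, Finset.sum_insert ha]

lemma step_err (T : Finset ℝ) (d : ℝ → ℝ) (hT : ∀ a ∈ T, 0 ≤ a ∧ a ≤ 2 * π)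
    (hd : ∑ a ∈ T.filter (fun a => a ≠ 0), d a = 0) (n : ℕ) (t : ℝ) (ht : 0 ≤ t) :
    S n (step T d) t - step T d t =
      ∑ a ∈ T.filter (fun a => a ≠ 0), d a * ((1 / π) * En n (t - a)) := by
  have e0 : ∀ c : ℝ, ∑ a ∈ T.filter (fun a => a ≠ 0), d a * c = 0 := by
    intro c; rw [← Finset.sum_mul, hd, zero_mul]
  rw [S_step, step, ← Finset.sum_sub_distrib]
  have e1 : ∑ a ∈ T, (d a * S n (ind a) t - d a * ind a t) =
      ∑ a ∈ T.filter (fun a => a ≠ 0), (d a * S n (ind a) t - d a * ind a t) := by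
    rw [Finset.sum_filter]
    refine Finset.sum_congr rfl fun a ha => ?_
    split_ifs with h
    · rfl
    · have h' : a = 0 := by tauto
      subst h'
      rw [S_ind n le_rfl Real.two_pi_pos.le]
      simp [ind, ht]
  rw [e1, ← sub_eq_zero, ← Finset.sum_sub_distrib]
  refine Eq.trans ?_ (e0 (1 / 2 - (1 / π) * Phi n t - t / (2 * π)))
  refine Finset.sum_congr rfl fun a ha => ?_
  rw [Finset.mem_filter] at ha
  rw [S_ind n (hT a ha.1).1 (hT a ha.1).2]
  unfold En ind
  have := Real.pi_pos
  by_cases h : a ≤ t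
  · rw [if_pos h, if_pos (by linarith)]; field_simp; ring
  · rw [if_neg h, if_neg (by linarith)]; field_simp; ring

lemma sin_tri (t a b : ℝ) : |Real.sin ((a - b) / 2)| ≤ |Real.sin ((t - a) / 2)| + |Real.sin ((t - b) / 2)| := by
  have e : (a - b) / 2 = (t - b) / 2 - (t - a) / 2 := by ring
  rw [e, Real.sin_sub]
  refine (abs_sub _ _).trans ?_
  rw [abs_mul, abs_mul]
  have h1 := Real.abs_cos_le_one ((t - a) / 2)
  have h2 := Real.abs_cos_le_one ((t - b) / 2)
  have h3 := abs_nonneg (Real.sin ((t - a) / 2))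
  have h4 := abs_nonneg (Real.sin ((t - b) / 2))
  nlinarith

lemma step_conv (T : Finset ℝ) (d : ℝ → ℝ) (hT : ∀ a ∈ T, 0 ≤ a ∧ a ≤ 2 * π)
    (hd : ∑ a ∈ T.filter (fun a => a ≠ 0), d a = 0) (ε : ℝ) (hε : 0 < ε) :
    ∃ N : ℕ, ∀ n, N ≤ n → ∀ J, 0 ≤ J → (∀ a ∈ T, a ≠ 0 → |d a| ≤ J) →
      ∀ t, 0 ≤ t → t ≤ 2 * π → |S n (step T d) t - step T d t| ≤ 6 * J + ε := by
  set U := T.filter (fun a => a ≠ 0) with hU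
  obtain ⟨κ, hκ0, hκ⟩ : ∃ κ : ℝ, 0 < κ ∧ ∀ a ∈ U, ∀ b ∈ U, a ≠ b → 2 * κ ≤ |Real.sin ((a - b) / 2)| := by
    have : ∀ᶠ κ : ℝ in nhdsWithin 0 (Set.Ioi 0), ∀ a ∈ U, ∀ b ∈ U, a ≠ b → 2 * κ ≤ |Real.sin ((a - b) / 2)| := by
      rw [Filter.eventually_all_finset]
      intro a ha
      rw [Filter.eventually_all_finset]
      intro b hb
      by_cases hab : a = b
      · simp [hab]
      · have hpos : 0 < |Real.sin ((a - b) / 2)| := by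
          rw [abs_pos]
          simp only [hU, Finset.mem_filter] at ha hb
          have h1 := hT a ha.1
          have h2 := hT b hb.1
          have h3 : 0 < a := lt_of_le_of_ne h1.1 (Ne.symm ha.2)
          have h4 : 0 < b := lt_of_le_of_ne h2.1 (Ne.symm hb.2)
          intro h0
          rw [Real.sin_eq_zero_iff_of_lt_of_lt (by linarith) (by linarith)] at h0
          exact hab (by linarith)
        have ht : Filter.Tendsto (fun κ : ℝ => 2 * κ) (nhdsWithin 0 (Set.Ioi 0)) (nhds (2 * 0)) :=
          ((continuous_const.mul continuous_id).tendsto 0).mono_left nhdsWithin_le_nhds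
        rw [mul_zero] at ht
        filter_upwards [ht.eventually_lt_const hpos] with κ hk _
        exact hk.le
    obtain ⟨κ, h1, h2⟩ := (this.and self_mem_nhdsWithin).exists
    exact ⟨κ, h2, h1⟩
  obtain ⟨N, hN⟩ := exists_nat_gt ((∑ a ∈ U, |d a|) * (2 / κ) / ε)
  refine ⟨N, fun n hn J hJ hdJ t ht0 ht1 => ?_⟩
  rw [step_err T d hT hd n t ht0]
  refine (Finset.abs_sum_le_sum_abs _ _).trans ?_
  have hpi : 1 / π ≤ 1 := by
    rw [div_le_one Real.pi_pos]; linarith [Real.pi_gt_three]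
  have hpi0 : 0 < 1 / π := by have := Real.pi_pos; positivity
  have hb : ∀ a ∈ U, |d a * ((1 / π) * En n (t - a))| ≤ |d a| * |En n (t - a)| := by
    intro a _
    rw [abs_mul, abs_mul, abs_of_pos hpi0]
    have := abs_nonneg (En n (t - a))
    gcongr
    nlinarith
  refine (Finset.sum_le_sum hb).trans ?_
  have hfar : ∀ a ∈ U, κ ≤ |Real.sin ((t - a) / 2)| → |d a| * |En n (t - a)| ≤ |d a| * (2 / κ / (2 * n + 1)) := by
    intro a ha hk
    have ha' := hT a (Finset.mem_filter.1 ha).1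
    have hp := hκ0.trans_le hk
    have h2 := En_small n (t - a) (by linarith) (by linarith) (abs_pos.1 hp)
    gcongr
    refine h2.trans ?_
    rw [div_div, mul_comm κ]
    gcongr
  have hsum : ∑ a ∈ U, |d a| * (2 / κ / (2 * n + 1)) ≤ ε := by
    rw [← Finset.sum_mul]
    have h3 : (N : ℝ) ≤ n := by exact_mod_cast hn
    rw [div_lt_iff₀ hε] at hN
    rw [← mul_div_assoc, div_le_iff₀ (by positivity)]
    nlinarith
  by_cases hex : ∃ a0 ∈ U, |Real.sin ((t - a0) / 2)| < κ
  · obtain ⟨a0, ha0, hlt⟩ := hex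
    have hle : ∀ a ∈ U, |d a| * |En n (t - a)| ≤ |d a| * (2 / κ / (2 * n + 1)) + if a = a0 then 6 * J else 0 := by
      intro a ha
      split_ifs with h
      · have ha' := Finset.mem_filter.1 ha
        have h1 := hdJ a ha'.1 ha'.2
        have h2 := En_bound n (t - a) (by linarith [hT a ha'.1]) (by linarith [hT a ha'.1])
        have h3 : |d a| * |En n (t - a)| ≤ J * 6 := by gcongr
        have h4 : 0 ≤ |d a| * (2 / κ / (2 * n + 1)) := by positivity
        linarith
      · rw [add_zero]
        apply hfar a ha
        have h1 := hκ a ha a0 ha0 h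
        have h2 := sin_tri t a a0
        linarith
    refine (Finset.sum_le_sum hle).trans ?_
    rw [Finset.sum_add_distrib, Finset.sum_ite_eq' U a0, if_pos ha0]
    linarith
  · push Not at hex
    refine (Finset.sum_le_sum fun a ha => hfar a ha (hex a ha)).trans ?_
    linarith

lemma step_rep (T : Finset ℝ) (v : ℝ → ℝ) :
    ∃ d : ℝ → ℝ, ∀ t, ∀ a ∈ T, a ≤ t → (∀ b ∈ T, b ≤ t → b ≤ a) → step T d t = v a := by
  induction T using Finset.induction_on_max with
  | empty => exact ⟨0, by simp⟩
  | insert M T hM ih =>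
    obtain ⟨d, hd⟩ := ih
    have hMT : M ∉ T := fun h => lt_irrefl _ (hM M h)
    refine ⟨Function.update d M (v M - ∑ b ∈ T, d b), fun t a ha hat hmax => ?_⟩
    have e : step (insert M T) (Function.update d M (v M - ∑ b ∈ T, d b)) t =
        (v M - ∑ b ∈ T, d b) * ind M t + step T d t := by
      unfold step
      rw [Finset.sum_insert hMT, Function.update_self]
      congr 1
      refine Finset.sum_congr rfl fun b hb => ?_
      rw [Function.update_of_ne]
      rintro rfl; exact hMT hb
    rw [e]
    by_cases h : M ≤ t
    · have h1 : a = M := by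
        apply le_antisymm
        · rcases Finset.mem_insert.1 ha with h' | h'
          · exact h'.le
          · exact (hM a h').le
        · exact hmax M (Finset.mem_insert_self _ _) h
      subst h1
      have : step T d t = ∑ b ∈ T, d b := by
        unfold step
        refine Finset.sum_congr rfl fun b hb => ?_
        simp [ind, ((hM b hb).le.trans h)]
      rw [this]
      simp [ind, h]
    · have h1 : a ∈ T := by
        rcases Finset.mem_insert.1 ha with h' | h'
        · subst h'; exact absurd hat h
        · exact h'
      rw [hd t a h1 hat fun b hb => hmax b (Finset.mem_insert_of_mem hb)]
      simp [ind, h]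

structure Valid (P : Set (ℝ × ℝ)) : Prop where
  zero : ((0 : ℝ), (0 : ℝ)) ∈ P
  top : (2 * π, 2 * π) ∈ P
  mem : ∀ p ∈ P, 0 ≤ p.1 ∧ p.1 ≤ 2 * π
  mono : ∀ p ∈ P, ∀ q ∈ P, p.1 < q.1 ↔ p.2 < q.2

lemma Valid.mono_le {P : Set (ℝ × ℝ)} (h : Valid P) {p q : ℝ × ℝ} (hp : p ∈ P) (hq : q ∈ P) :
    p.1 ≤ q.1 ↔ p.2 ≤ q.2 := by
  rw [← not_lt, ← not_lt, h.mono q hq p hp]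

lemma Valid.mem2 {P : Set (ℝ × ℝ)} (h : Valid P) {p : ℝ × ℝ} (hp : p ∈ P) :
    0 ≤ p.2 ∧ p.2 ≤ 2 * π :=
  ⟨(h.mono_le h.zero hp).1 (h.mem p hp).1, (h.mono_le hp h.top).1 (h.mem p hp).2⟩

noncomputable def hP (P : Set (ℝ × ℝ)) (t : ℝ) : ℝ := sSup {x | ∃ a, a ≤ t ∧ (a, x) ∈ P}

lemma hP_ge {P : Set (ℝ × ℝ)} (h : Valid P) {p : ℝ × ℝ} (hp : p ∈ P) {t : ℝ} (ht : p.1 ≤ t) :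
    p.2 ≤ hP P t := by
  apply le_csSup
  · exact ⟨2 * π, by rintro x ⟨a, _, hx⟩; exact (h.mem2 hx).2⟩
  · exact ⟨p.1, ht, hp⟩

lemma hP_le' {P : Set (ℝ × ℝ)} (h : Valid P) {t y : ℝ} (h0 : 0 ≤ t)
    (hy : ∀ p ∈ P, p.1 ≤ t → p.2 ≤ y) : hP P t ≤ y := by
  apply csSup_le
  · exact ⟨0, 0, h0, h.zero⟩
  · rintro x ⟨a, ha, hx⟩
    exact hy _ hx ha

lemma hP_le {P : Set (ℝ × ℝ)} (h : Valid P) {p : ℝ × ℝ} (hp : p ∈ P) {t : ℝ} (h0 : 0 ≤ t)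
    (ht : t ≤ p.1) : hP P t ≤ p.2 :=
  hP_le' h h0 fun _ hq hqt => (h.mono_le hq hp).1 (hqt.trans ht)

lemma hP_eq {P : Set (ℝ × ℝ)} (h : Valid P) {p : ℝ × ℝ} (hp : p ∈ P) {t : ℝ} (ht : p.1 ≤ t)
    (hm : ∀ q ∈ P, q.1 ≤ t → q.1 ≤ p.1) : hP P t = p.2 :=
  le_antisymm (hP_le' h ((h.mem p hp).1.trans ht) fun _ hq hqt => (h.mono_le hq hp).1 (hm _ hq hqt))
    (hP_ge h hp ht)

lemma hP_node {P : Set (ℝ × ℝ)} (h : Valid P) {p : ℝ × ℝ} (hp : p ∈ P) : hP P p.1 = p.2 :=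
  hP_eq h hp le_rfl fun _ _ h => h

def Adj (P : Finset (ℝ × ℝ)) (p q : ℝ × ℝ) : Prop :=
  p ∈ P ∧ q ∈ P ∧ p.1 < q.1 ∧ ∀ r ∈ P, r.1 ≤ p.1 ∨ q.1 ≤ r.1

def Osc (F : ℝ → ℝ) (P : Finset (ℝ × ℝ)) (J : ℝ) : Prop :=
  ∀ p q, Adj P p q → ∀ x ∈ Set.Icc p.2 q.2, |F x - F p.2| ≤ J

lemma exists_pred {P : Finset (ℝ × ℝ)} (h : Valid (P : Set (ℝ × ℝ))) {t : ℝ} (ht : 0 ≤ t) :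
    ∃ p ∈ P, p.1 ≤ t ∧ ∀ q ∈ P, q.1 ≤ t → q.1 ≤ p.1 := by
  obtain ⟨p, hp, hm⟩ := Finset.exists_max_image (P.filter fun r => r.1 ≤ t) (fun r => r.1)
    ⟨(0, 0), Finset.mem_filter.2 ⟨h.zero, ht⟩⟩
  rw [Finset.mem_filter] at hp
  exact ⟨p, hp.1, hp.2, fun q hq hqt => hm q (Finset.mem_filter.2 ⟨hq, hqt⟩)⟩

lemma exists_succ {P : Finset (ℝ × ℝ)} (h : Valid (P : Set (ℝ × ℝ))) {t : ℝ} (ht : t < 2 * π) :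
    ∃ p ∈ P, t < p.1 ∧ ∀ q ∈ P, t < q.1 → p.1 ≤ q.1 := by
  obtain ⟨p, hp, hm⟩ := Finset.exists_min_image (P.filter fun r => t < r.1) (fun r => r.1)
    ⟨(2 * π, 2 * π), Finset.mem_filter.2 ⟨h.top, ht⟩⟩
  rw [Finset.mem_filter] at hp
  exact ⟨p, hp.1, hp.2, fun q hq hqt => hm q (Finset.mem_filter.2 ⟨hq, hqt⟩)⟩

lemma exists_adj {P : Finset (ℝ × ℝ)} (h : Valid (P : Set (ℝ × ℝ))) {t : ℝ} (h0 : 0 ≤ t)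
    (ht : t < 2 * π) : ∃ p q, Adj P p q ∧ p.1 ≤ t ∧ t < q.1 := by
  obtain ⟨p, hp, hpt, hpm⟩ := exists_pred h h0
  obtain ⟨q, hq, hqt, hqm⟩ := exists_succ h ht
  refine ⟨p, q, ⟨hp, hq, hpt.trans_lt hqt, fun r hr => ?_⟩, hpt, hqt⟩
  rcases le_or_gt r.1 t with h' | h'
  · exact Or.inl (hpm r hr h')
  · exact Or.inr (hqm r hr h')

lemma Valid.swap {P : Finset (ℝ × ℝ)} (h : Valid (P : Set (ℝ × ℝ))) :
    Valid ((P.image Prod.swap : Finset (ℝ × ℝ)) : Set (ℝ × ℝ)) where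
  zero := by
    rw [Finset.mem_coe, Finset.mem_image]; exact ⟨_, h.zero, rfl⟩
  top := by
    rw [Finset.mem_coe, Finset.mem_image]; exact ⟨_, h.top, rfl⟩
  mem := by
    intro p hp
    rw [Finset.mem_coe, Finset.mem_image] at hp
    obtain ⟨q, hq, rfl⟩ := hp
    exact h.mem2 hq
  mono := by
    intro p hp q hq
    rw [Finset.mem_coe, Finset.mem_image] at hp hq
    obtain ⟨p, hp, rfl⟩ := hp
    obtain ⟨q, hq, rfl⟩ := hq
    exact (h.mono p hp q hq).symm

lemma exists_adj2 {P : Finset (ℝ × ℝ)} (h : Valid (P : Set (ℝ × ℝ))) {x : ℝ} (h0 : 0 ≤ x)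
    (hx : x < 2 * π) : ∃ p q, Adj P p q ∧ p.2 ≤ x ∧ x < q.2 := by
  obtain ⟨p, q, ⟨hp, hq, hpq, hr⟩, h1, h2⟩ := exists_adj h.swap h0 hx
  rw [Finset.mem_image] at hp hq
  obtain ⟨p, hp, rfl⟩ := hp
  obtain ⟨q, hq, rfl⟩ := hq
  refine ⟨p, q, ⟨hp, hq, (h.mono p hp q hq).2 hpq, fun r hrP => ?_⟩, h1, h2⟩
  rcases hr r.swap (Finset.mem_image_of_mem _ hrP) with h' | h'
  · exact Or.inl ((h.mono_le hrP hp).2 h')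
  · exact Or.inr ((h.mono_le hq hrP).2 h')

lemma u_step (F : ℝ → ℝ) (hF : F 0 = F (2 * π)) {P : Finset (ℝ × ℝ)}
    (h : Valid (P : Set (ℝ × ℝ))) :
    ∃ (T : Finset ℝ) (d : ℝ → ℝ), (∀ a ∈ T, 0 ≤ a ∧ a ≤ 2 * π) ∧
      (∑ a ∈ T.filter (fun a => a ≠ 0), d a = 0) ∧
      (∀ t ∈ Set.Icc 0 (2 * π), F (hP P t) = step T d t) ∧
      ∀ J, Osc F P J → ∀ a ∈ T, a ≠ 0 → |d a| ≤ J := by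
  obtain ⟨d, hd⟩ := step_rep (P.image Prod.fst) (fun a => F (hP P a))
  set T := P.image Prod.fst with hTdef
  have hT : ∀ a ∈ T, 0 ≤ a ∧ a ≤ 2 * π := by
    intro a ha
    obtain ⟨p, hp, rfl⟩ := Finset.mem_image.1 ha
    exact h.mem p hp
  have hval : ∀ t ∈ Set.Icc 0 (2 * π), F (hP P t) = step T d t := by
    intro t ht
    obtain ⟨p, hp, hpt, hpm⟩ := exists_pred h ht.1
    rw [hd t p.1 (Finset.mem_image_of_mem _ hp) hpt, hP_node h hp, hP_eq h hp hpt hpm]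
    intro b hb hbt
    obtain ⟨q, hq, rfl⟩ := Finset.mem_image.1 hb
    exact hpm q hq hbt
  have h0T : (0 : ℝ) ∈ T := Finset.mem_image.2 ⟨_, h.zero, rfl⟩
  refine ⟨T, d, hT, ?_, hval, ?_⟩
  · have e1 := hval 0 ⟨le_rfl, Real.two_pi_pos.le⟩
    have e2 := hval (2 * π) ⟨Real.two_pi_pos.le, le_rfl⟩
    have n1 : hP P 0 = 0 := hP_node h h.zero
    have n2 : hP P (2 * π) = 2 * π := hP_node h h.top
    rw [n1] at e1
    rw [n2] at e2
    have s1 : step T d 0 = d 0 := by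
      unfold step
      rw [Finset.sum_eq_single_of_mem 0 h0T]
      · simp [ind]
      · intro b hb hb0
        have : ¬ b ≤ 0 := fun h => hb0 (le_antisymm h (hT b hb).1)
        simp [ind, this]
    have s2 : step T d (2 * π) = ∑ a ∈ T, d a := by
      unfold step
      refine Finset.sum_congr rfl fun a ha => ?_
      simp [ind, (hT a ha).2]
    have s3 : ∑ a ∈ T, d a = ∑ a ∈ T.filter (fun a => a ≠ 0), d a + d 0 := by
      rw [← Finset.sum_erase_add _ _ h0T]
      congr 1
      refine Finset.sum_congr ?_ fun _ _ => rfl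
      ext a
      simp [and_comm]
    linarith
  · intro J hJ a ha ha0
    obtain ⟨q, hq, rfl⟩ := Finset.mem_image.1 ha
    have hq0 : 0 < q.1 := lt_of_le_of_ne (h.mem q hq).1 (Ne.symm ha0)
    obtain ⟨p, hp, hpm⟩ := Finset.exists_max_image (P.filter fun r => r.1 < q.1) (fun r => r.1)
      ⟨(0, 0), Finset.mem_filter.2 ⟨h.zero, hq0⟩⟩
    rw [Finset.mem_filter] at hp
    have hadj : Adj P p q := by
      refine ⟨hp.1, hq, hp.2, fun r hr => ?_⟩
      rcases lt_or_ge r.1 q.1 with h' | h'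
      · exact Or.inl (hpm r (Finset.mem_filter.2 ⟨hr, h'⟩))
      · exact Or.inr h'
    have hj := hJ p q hadj q.2 ⟨((h.mono p hp.1 q hq).1 hp.2).le, le_rfl⟩
    rw [← hP_node h hq, ← hP_node h hp.1, hval _ (h.mem q hq), hval _ (h.mem p hp.1)] at hj
    have : step T d q.1 - step T d p.1 = d q.1 := by
      unfold step
      rw [← Finset.sum_sub_distrib, Finset.sum_eq_single_of_mem q.1 ha]
      · simp [ind, hp.2]
      · intro b hb hbq
        obtain ⟨r, hr, rfl⟩ := Finset.mem_image.1 hb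
        rcases hadj.2.2.2 r hr with h' | h'
        · simp [ind, h', h'.trans hp.2.le]
        · have h1 : ¬ r.1 ≤ q.1 := fun h2 => hbq (le_antisymm h2 h')
          have h3 : ¬ r.1 ≤ p.1 := fun h2 => h1 (h2.trans hp.2.le)
          simp [ind, h1, h3]
    rwa [this] at hj

lemma u_int (F : ℝ → ℝ) (hF : F 0 = F (2 * π)) {P : Finset (ℝ × ℝ)}
    (h : Valid (P : Set (ℝ × ℝ))) :
    IntervalIntegrable (fun t => F (hP P t)) MeasureTheory.volume 0 (2 * π) := by
  obtain ⟨T, d, _, _, h3, _⟩ := u_step F hF h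
  refine (step_int T d).congr ?_
  intro x hx
  rw [Set.uIoc_of_le Real.two_pi_pos.le] at hx
  exact (h3 x ⟨hx.1.le, hx.2⟩).symm

lemma u_conv (F : ℝ → ℝ) (hF : F 0 = F (2 * π)) {P : Finset (ℝ × ℝ)}
    (h : Valid (P : Set (ℝ × ℝ))) (ε : ℝ) (hε : 0 < ε) :
    ∃ N : ℕ, ∀ n, N ≤ n → ∀ J, 0 ≤ J → Osc F P J → ∀ t ∈ Set.Icc 0 (2 * π),
      |S n (fun t => F (hP P t)) t - F (hP P t)| ≤ 6 * J + ε := by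
  obtain ⟨T, d, h1, h2, h3, h4⟩ := u_step F hF h
  obtain ⟨N, hN⟩ := step_conv T d h1 h2 ε hε
  refine ⟨N, fun n hn J hJ0 hJ t ht => ?_⟩
  rw [S_congr n h3, h3 t ht]
  exact hN n hn J hJ0 (h4 J hJ) t ht.1 ht.2

lemma insert_valid {P : Finset (ℝ × ℝ)} (h : Valid (P : Set (ℝ × ℝ))) {p q : ℝ × ℝ}
    (hA : Adj P p q) {t x : ℝ} (ht : p.1 < t ∧ t < q.1) (hx : p.2 < x ∧ x < q.2) :
    Valid ((insert (t, x) P : Finset (ℝ × ℝ)) : Set (ℝ × ℝ)) := by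
  obtain ⟨hp, hq, hpq, hr⟩ := hA
  have k1 : ∀ r ∈ P, (r.1 < t ↔ r.2 < x) ∧ (t < r.1 ↔ x < r.2) := by
    intro r hrP
    rcases hr r hrP with h' | h'
    · have h2 := (h.mono_le hrP hp).1 h'
      exact ⟨⟨fun _ => by linarith, fun _ => by linarith⟩, ⟨fun _ => by linarith, fun _ => by linarith⟩⟩
    · have h2 := (h.mono_le hq hrP).1 h'
      exact ⟨⟨fun _ => by linarith, fun _ => by linarith⟩, ⟨fun _ => by linarith, fun _ => by linarith⟩⟩
  refine ⟨?_, ?_, ?_, ?_⟩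
  · rw [Finset.mem_coe]; exact Finset.mem_insert_of_mem h.zero
  · rw [Finset.mem_coe]; exact Finset.mem_insert_of_mem h.top
  · intro r hr
    rcases Finset.mem_insert.1 (Finset.mem_coe.1 hr) with rfl | hr
    · have h1 := h.mem p hp
      have h2 := h.mem q hq
      exact ⟨by simp only; linarith, by simp only; linarith⟩
    · exact h.mem r hr
  · intro r hr s hs
    rcases Finset.mem_insert.1 (Finset.mem_coe.1 hr) with rfl | hr <;>
    rcases Finset.mem_insert.1 (Finset.mem_coe.1 hs) with rfl | hs
    · simp
    · exact (k1 s hs).2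
    · exact (k1 r hr).1
    · exact h.mono r hr s hs

lemma insert_val (F : ℝ → ℝ) {P : Finset (ℝ × ℝ)} (h : Valid (P : Set (ℝ × ℝ))) {p q : ℝ × ℝ}
    (hA : Adj P p q) {t x : ℝ} (ht : p.1 < t ∧ t < q.1) (hx : p.2 < x ∧ x < q.2)
    (y : ℝ) (hy : y ∈ Set.Icc 0 (2 * π)) :
    F (hP (insert (t, x) P : Finset (ℝ × ℝ)) y) =
      F (hP P y) + (F x - F p.2) * (ind t y - ind q.1 y) := by
  have hv := insert_valid h hA ht hx
  obtain ⟨hp, hq, hpq, hr⟩ := hA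
  by_cases h1 : t ≤ y
  · by_cases h2 : q.1 ≤ y
    · obtain ⟨r, hrP, hrt, hrm⟩ := exists_pred h hy.1
      have hqr := hrm q hq h2
      rw [hP_eq h hrP hrt hrm, hP_eq hv (p := r) (Finset.mem_coe.2 (Finset.mem_insert_of_mem hrP)) hrt]
      · simp [ind, h1, h2]
      · intro s hs hsy
        rcases Finset.mem_insert.1 (Finset.mem_coe.1 hs) with rfl | hs
        · simp only; linarith
        · exact hrm s hs hsy
    · rw [hP_eq h hp (by linarith : p.1 ≤ y), hP_eq hv (p := (t, x)) (Finset.mem_coe.2 (Finset.mem_insert_self _ _)) h1]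
      · simp [ind, h1, h2]
      · intro s hs hsy
        rcases Finset.mem_insert.1 (Finset.mem_coe.1 hs) with rfl | hs
        · exact le_rfl
        · rcases hr s hs with h' | h'
          · simp only; linarith
          · exact absurd (h'.trans hsy) h2
      · intro s hs hsy
        rcases hr s hs with h' | h'
        · exact h'
        · exact absurd (h'.trans hsy) h2
  · have h2 : ¬ q.1 ≤ y := fun h' => h1 (by linarith)
    obtain ⟨r, hrP, hrt, hrm⟩ := exists_pred h hy.1
    rw [hP_eq h hrP hrt hrm, hP_eq hv (p := r) (Finset.mem_coe.2 (Finset.mem_insert_of_mem hrP)) hrt]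
    · simp [ind, h1, h2]
    · intro s hs hsy
      rcases Finset.mem_insert.1 (Finset.mem_coe.1 hs) with rfl | hs
      · exact absurd hsy h1
      · exact hrm s hs hsy

lemma insert_S (F : ℝ → ℝ) (hF : F 0 = F (2 * π)) {P : Finset (ℝ × ℝ)}
    (h : Valid (P : Set (ℝ × ℝ))) {p q : ℝ × ℝ}
    (hA : Adj P p q) {t x : ℝ} (ht : p.1 < t ∧ t < q.1) (hx : p.2 < x ∧ x < q.2) (n : ℕ) (y : ℝ) :
    |S n (fun t' => F (hP (insert (t, x) P : Finset (ℝ × ℝ)) t')) y - S n (fun t => F (hP P t)) y|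
      ≤ 4 * |F x - F p.2| ∧
    |S n (fun t' => F (hP (insert (t, x) P : Finset (ℝ × ℝ)) t')) y - S n (fun t => F (hP P t)) y|
      ≤ |F x - F p.2| * ((2 * n + 1) * (q.1 - t)) := by
  have h1 := h.mem p hA.1
  have h2 := h.mem q hA.2.1
  have e1 := S_congr n (u := fun t' => F (hP (insert (t, x) P : Finset (ℝ × ℝ)) t'))
    (v := fun z => 1 * F (hP P z) + (F x - F p.2) * (1 * ind t z + (-1) * ind q.1 z))
    (fun z hz => by
      have := insert_val F h hA ht hx z hz
      rw [this]; ring) y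
  have i1 : IntervalIntegrable (fun z => 1 * ind t z + (-1) * ind q.1 z) MeasureTheory.volume 0 (2 * π) :=
    ((ind_int t).const_mul 1).add ((ind_int q.1).const_mul (-1))
  rw [S_add n (u_int F hF h) i1, S_add n (ind_int t) (ind_int q.1),
    S_ind n (by linarith) (by linarith), S_ind n h2.1 h2.2] at e1
  have e2 : S n (fun t' => F (hP (insert (t, x) P : Finset (ℝ × ℝ)) t')) y - S n (fun t => F (hP P t)) y
      = (F x - F p.2) * ((q.1 - t + 2 * (Phi n (y - t) - Phi n (y - q.1))) / (2 * π)) := by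
    rw [e1]; ring
  rw [e2, abs_mul]
  have hpi := Real.pi_gt_three
  constructor
  · rw [mul_comm]
    gcongr
    rw [abs_div, abs_of_pos Real.two_pi_pos, div_le_iff₀ Real.two_pi_pos]
    have b1 := abs_le.1 (Phi_bound n (y - t))
    have b2 := abs_le.1 (Phi_bound n (y - q.1))
    rw [abs_le]
    constructor <;> linarith [b1.1, b1.2, b2.1, b2.2]
  · gcongr
    rw [abs_div, abs_of_pos Real.two_pi_pos, div_le_iff₀ Real.two_pi_pos]
    have b1 := Phi_lip n (y - t) (y - q.1)
    have b2 : |y - t - (y - q.1)| = q.1 - t := by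
      rw [show y - t - (y - q.1) = q.1 - t by ring, abs_of_pos (by linarith)]
    rw [b2] at b1
    have b1 := abs_le.1 b1
    have hpos : 0 ≤ (2 * n + 1) * (q.1 - t) := by
      have : 0 ≤ q.1 - t := by linarith
      positivity
    have : (2 * n + 1) * (q.1 - t) ≤ (2 * n + 1) * (q.1 - t) * (2 * π) := by nlinarith
    rw [abs_le]
    constructor <;> nlinarith [b1.1, b1.2]

lemma next_step (F : ℝ → ℝ) (hc : Continuous F) (hF : F 0 = F (2 * π)) {P : Finset (ℝ × ℝ)}
    (h : Valid (P : Set (ℝ × ℝ))) (z : ℚ ⊕ ℚ) (N : ℕ) (ε : ℝ) (hε : 0 < ε) :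
    ∃ P' : Finset (ℝ × ℝ), P ⊆ P' ∧ Valid (P' : Set (ℝ × ℝ)) ∧
      (∀ τ : ℚ, z = Sum.inl τ → (0 : ℝ) < τ → (τ : ℝ) < 2 * π → ∃ p ∈ P', p.1 = τ) ∧
      (∀ τ : ℚ, z = Sum.inr τ → (0 : ℝ) < τ → (τ : ℝ) < 2 * π → ∃ p ∈ P', p.2 = τ) ∧
      (∀ n y J, 0 ≤ J → Osc F P J →
        |S n (fun t => F (hP P' t)) y - S n (fun t => F (hP P t)) y| ≤ 4 * J + ε) ∧
      (∀ n, n ≤ N → ∀ y,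
        |S n (fun t => F (hP P' t)) y - S n (fun t => F (hP P t)) y| ≤ ε) := by
  have triv : (∀ τ : ℚ, z = Sum.inl τ → (0 : ℝ) < τ → (τ : ℝ) < 2 * π → ∃ p ∈ P, p.1 = τ) →
      (∀ τ : ℚ, z = Sum.inr τ → (0 : ℝ) < τ → (τ : ℝ) < 2 * π → ∃ p ∈ P, p.2 = τ) → _ :=
    fun h1 h2 => (⟨P, subset_rfl, h, h1, h2, fun n y J hJ _ => by
      rw [sub_self, abs_zero]; positivity, fun n _ y => by rw [sub_self, abs_zero]; exact hε.le⟩ :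
      ∃ P' : Finset (ℝ × ℝ), P ⊆ P' ∧ Valid (P' : Set (ℝ × ℝ)) ∧
      (∀ τ : ℚ, z = Sum.inl τ → (0 : ℝ) < τ → (τ : ℝ) < 2 * π → ∃ p ∈ P', p.1 = τ) ∧
      (∀ τ : ℚ, z = Sum.inr τ → (0 : ℝ) < τ → (τ : ℝ) < 2 * π → ∃ p ∈ P', p.2 = τ) ∧
      (∀ n y J, 0 ≤ J → Osc F P J →
        |S n (fun t => F (hP P' t)) y - S n (fun t => F (hP P t)) y| ≤ 4 * J + ε) ∧
      (∀ n, n ≤ N → ∀ y,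
        |S n (fun t => F (hP P' t)) y - S n (fun t => F (hP P t)) y| ≤ ε))
  rcases z with τ | τ
  · by_cases hex : (0 : ℝ) < τ → (τ : ℝ) < 2 * π → ∃ p ∈ P, p.1 = τ
    · exact triv (fun σ hσ => by cases hσ; exact hex) (fun σ hσ => by cases hσ)
    · push Not at hex
      obtain ⟨h0, h1, hne⟩ := hex
      obtain ⟨p, q, hA, hpt, htq⟩ := exists_adj h h0.le h1
      have hpt' : p.1 < τ := lt_of_le_of_ne hpt (hne p hA.1)
      have hpq : p.2 < q.2 := (h.mono p hA.1 q hA.2.1).1 hA.2.2.1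
      obtain ⟨δ, hδ, hcl⟩ := Metric.continuousAt_iff.1 (hc.continuousAt (x := p.2)) (ε / 4) (by positivity)
      have hm : 0 < min (δ / 2) ((q.2 - p.2) / 2) := lt_min (by linarith) (by linarith)
      have hm1 := min_le_left (δ / 2) ((q.2 - p.2) / 2)
      have hm2 := min_le_right (δ / 2) ((q.2 - p.2) / 2)
      set x := p.2 + min (δ / 2) ((q.2 - p.2) / 2) with hx
      have hx1 : p.2 < x ∧ x < q.2 := ⟨by linarith, by linarith⟩
      have hFx : |F x - F p.2| ≤ ε / 4 := by
        have := hcl (x := x) (by rw [Real.dist_eq, abs_of_pos (by linarith)]; linarith)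
        rw [Real.dist_eq] at this
        exact this.le
      refine ⟨insert ((τ : ℝ), x) P, Finset.subset_insert _ _, insert_valid h hA ⟨hpt', htq⟩ hx1,
        ?_, ?_, ?_, ?_⟩
      · intro σ hσ _ _
        cases hσ
        exact ⟨_, Finset.mem_insert_self _ _, rfl⟩
      · intro σ hσ
        cases hσ
      · intro n y J hJ _
        have := (insert_S F hF h hA ⟨hpt', htq⟩ hx1 n y).1
        linarith
      · intro n _ y
        have := (insert_S F hF h hA ⟨hpt', htq⟩ hx1 n y).1
        linarith
  · by_cases hex : (0 : ℝ) < τ → (τ : ℝ) < 2 * π → ∃ p ∈ P, p.2 = τ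
    · exact triv (fun σ hσ => by cases hσ) (fun σ hσ => by cases hσ; exact hex)
    · push Not at hex
      obtain ⟨h0, h1, hne⟩ := hex
      obtain ⟨p, q, hA, hpt, htq⟩ := exists_adj2 h h0.le h1
      have hpt' : p.2 < τ := lt_of_le_of_ne hpt (hne p hA.1)
      have hpq : p.1 < q.1 := hA.2.2.1
      set K : ℝ := |F τ - F p.2| * (2 * N + 1) + 1 with hK
      have hK0 : 0 < K := by positivity
      have hm : 0 < min (ε / K) ((q.1 - p.1) / 2) := lt_min (by positivity) (by linarith)
      have hm1 := min_le_left (ε / K) ((q.1 - p.1) / 2)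
      have hm2 := min_le_right (ε / K) ((q.1 - p.1) / 2)
      set t := q.1 - min (ε / K) ((q.1 - p.1) / 2) with ht
      have ht1 : p.1 < t ∧ t < q.1 := ⟨by linarith, by linarith⟩
      refine ⟨insert (t, (τ : ℝ)) P, Finset.subset_insert _ _, insert_valid h hA ht1 ⟨hpt', htq⟩,
        ?_, ?_, ?_, ?_⟩
      · intro σ hσ
        cases hσ
      · intro σ hσ _ _
        cases hσ
        exact ⟨_, Finset.mem_insert_self _ _, rfl⟩
      · intro n y J hJ hO
        have := (insert_S F hF h hA ht1 ⟨hpt', htq⟩ n y).1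
        have := hO p q hA τ ⟨hpt'.le, htq.le⟩
        linarith
      · intro n hn y
        refine ((insert_S F hF h hA ht1 ⟨hpt', htq⟩ n y).2).trans ?_
        have h3 : (n : ℝ) ≤ N := by exact_mod_cast hn
        have h4 : q.1 - t ≤ ε / K := by linarith
        have h5 : 0 ≤ q.1 - t := by linarith
        calc |F τ - F p.2| * ((2 * n + 1) * (q.1 - t)) ≤ |F τ - F p.2| * ((2 * N + 1) * (q.1 - t)) := by gcongr
          _ ≤ K * (q.1 - t) := by rw [hK]; nlinarith
          _ ≤ K * (ε / K) := by gcongr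
          _ = ε := by field_simp

lemma exists_seq (F : ℝ → ℝ) (hc : Continuous F) (hF : F 0 = F (2 * π)) (e : ℕ → ℚ ⊕ ℚ) :
    ∃ (P : ℕ → Finset (ℝ × ℝ)) (N : ℕ → ℕ), (∀ i, Valid (P i : Set (ℝ × ℝ))) ∧
      (∀ i, P i ⊆ P (i + 1)) ∧ (∀ i, N i < N (i + 1)) ∧
      (∀ i, ∀ τ : ℚ, e i = Sum.inl τ → (0 : ℝ) < τ → (τ : ℝ) < 2 * π → ∃ p ∈ P (i + 1), p.1 = τ) ∧
      (∀ i, ∀ τ : ℚ, e i = Sum.inr τ → (0 : ℝ) < τ → (τ : ℝ) < 2 * π → ∃ p ∈ P (i + 1), p.2 = τ) ∧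
      (∀ i n y J, 0 ≤ J → Osc F (P i) J →
        |S n (fun t => F (hP (P (i + 1)) t)) y - S n (fun t => F (hP (P i) t)) y| ≤ 4 * J + (1 / 2) ^ i) ∧
      (∀ i n, n ≤ N i → ∀ y,
        |S n (fun t => F (hP (P (i + 1)) t)) y - S n (fun t => F (hP (P i) t)) y| ≤ (1 / 2) ^ i) ∧
      (∀ i n, N i ≤ n → ∀ J, 0 ≤ J → Osc F (P i) J → ∀ t ∈ Set.Icc 0 (2 * π),
        |S n (fun t => F (hP (P i) t)) t - F (hP (P i) t)| ≤ 6 * J + (1 / 2) ^ i) := by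
  have hstep : ∀ (i : ℕ) (σ : {P : Finset (ℝ × ℝ) // Valid (P : Set (ℝ × ℝ))} × ℕ),
      ∃ σ' : {P : Finset (ℝ × ℝ) // Valid (P : Set (ℝ × ℝ))} × ℕ,
      σ.1.1 ⊆ σ'.1.1 ∧ σ.2 < σ'.2 ∧
      (∀ τ : ℚ, e i = Sum.inl τ → (0 : ℝ) < τ → (τ : ℝ) < 2 * π → ∃ p ∈ σ'.1.1, p.1 = τ) ∧
      (∀ τ : ℚ, e i = Sum.inr τ → (0 : ℝ) < τ → (τ : ℝ) < 2 * π → ∃ p ∈ σ'.1.1, p.2 = τ) ∧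
      (∀ n y J, 0 ≤ J → Osc F σ.1.1 J →
        |S n (fun t => F (hP σ'.1.1 t)) y - S n (fun t => F (hP σ.1.1 t)) y| ≤ 4 * J + (1 / 2) ^ i) ∧
      (∀ n, n ≤ σ.2 → ∀ y,
        |S n (fun t => F (hP σ'.1.1 t)) y - S n (fun t => F (hP σ.1.1 t)) y| ≤ (1 / 2) ^ i) ∧
      (∀ n, σ'.2 ≤ n → ∀ J, 0 ≤ J → Osc F σ'.1.1 J → ∀ t ∈ Set.Icc 0 (2 * π),
        |S n (fun t => F (hP σ'.1.1 t)) t - F (hP σ'.1.1 t)| ≤ 6 * J + (1 / 2) ^ (i + 1)) := by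
    rintro i ⟨⟨P, hP⟩, N⟩
    obtain ⟨P', h1, h2, h3, h4, h5, h6⟩ := next_step F hc hF hP (e i) N ((1 / 2) ^ i) (by positivity)
    obtain ⟨M, hM⟩ := u_conv F hF h2 ((1 / 2) ^ (i + 1)) (by positivity)
    refine ⟨⟨⟨P', h2⟩, max (N + 1) M⟩, h1, ?_, h3, h4, h5, h6, ?_⟩
    · simp only; omega
    · intro n hn
      exact hM n (le_trans (le_max_right _ _) hn)
  have h0 : Valid ((({(0, 0), (2 * π, 2 * π)} : Finset (ℝ × ℝ))) : Set (ℝ × ℝ)) := by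
    have := Real.two_pi_pos
    refine ⟨by simp, by simp, ?_, ?_⟩
    · intro p hp
      simp only [Finset.coe_insert, Finset.coe_singleton, Set.mem_insert_iff, Set.mem_singleton_iff] at hp
      rcases hp with rfl | rfl
      · exact ⟨le_rfl, this.le⟩
      · exact ⟨this.le, le_rfl⟩
    · intro p hp q hq
      simp only [Finset.coe_insert, Finset.coe_singleton, Set.mem_insert_iff, Set.mem_singleton_iff] at hp hq
      rcases hp with rfl | rfl <;> rcases hq with rfl | rfl <;> simp
  obtain ⟨M, hM⟩ := u_conv F hF h0 ((1 / 2) ^ 0) (by positivity)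
  choose next hnext using hstep
  let σ : ℕ → {P : Finset (ℝ × ℝ) // Valid (P : Set (ℝ × ℝ))} × ℕ := fun i =>
    Nat.rec ⟨⟨_, h0⟩, M⟩ (fun i s => next i s) i
  refine ⟨fun i => (σ i).1.1, fun i => (σ i).2, fun i => (σ i).1.2, fun i => (hnext i (σ i)).1,
    fun i => (hnext i (σ i)).2.1, fun i => (hnext i (σ i)).2.2.1, fun i => (hnext i (σ i)).2.2.2.1,
    fun i => (hnext i (σ i)).2.2.2.2.1, fun i => (hnext i (σ i)).2.2.2.2.2.1, ?_⟩
  intro i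
  cases i with
  | zero => exact hM
  | succ i => exact (hnext i (σ i)).2.2.2.2.2.2

lemma main_real (F : ℝ → ℝ) (hc : Continuous F) (hF : F 0 = F (2 * π)) :
    ∃ h : ℝ → ℝ, StrictMonoOn h (Set.Icc 0 (2 * π)) ∧ ContinuousOn h (Set.Icc 0 (2 * π)) ∧
      h 0 = 0 ∧ h (2 * π) = 2 * π ∧
      ∀ ε, 0 < ε → ∃ N : ℕ, ∀ n, N ≤ n → ∀ t ∈ Set.Icc 0 (2 * π),
        |S n (fun t => F (h t)) t - F (h t)| < ε := by
  obtain ⟨e, he⟩ := exists_surjective_nat (ℚ ⊕ ℚ)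
  obtain ⟨P, N, hV, hsub, hN, hit1, hit2, hS1, hS2, hS3⟩ := exists_seq F hc hF e
  have hmono : Monotone P := monotone_nat_of_le_succ hsub
  have hNm : StrictMono N := strictMono_nat_of_lt_succ hN
  set Q : Set (ℝ × ℝ) := ⋃ i, (P i : Set (ℝ × ℝ)) with hQ
  have hsubQ : ∀ i, ∀ p ∈ P i, p ∈ Q := fun i p hp => Set.mem_iUnion.2 ⟨i, hp⟩
  have hVQ : Valid Q := by
    refine ⟨hsubQ 0 _ (hV 0).zero, hsubQ 0 _ (hV 0).top, ?_, ?_⟩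
    · intro p hp
      obtain ⟨i, hi⟩ := Set.mem_iUnion.1 hp
      exact (hV i).mem p hi
    · intro p hp q hq
      obtain ⟨i, hi⟩ := Set.mem_iUnion.1 hp
      obtain ⟨j, hj⟩ := Set.mem_iUnion.1 hq
      exact (hV (max i j)).mono p (hmono (le_max_left i j) hi) q (hmono (le_max_right i j) hj)
  have hT : ∀ τ : ℚ, (0 : ℝ) < τ → (τ : ℝ) < 2 * π → ∃ p ∈ Q, p.1 = τ := by
    intro τ h0 h1
    obtain ⟨i, hi⟩ := he (Sum.inl τ)
    obtain ⟨p, hp, h⟩ := hit1 i τ hi h0 h1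
    exact ⟨p, hsubQ _ p hp, h⟩
  have hX : ∀ τ : ℚ, (0 : ℝ) < τ → (τ : ℝ) < 2 * π → ∃ i, ∃ p ∈ P i, p.2 = τ := by
    intro τ h0 h1
    obtain ⟨i, hi⟩ := he (Sum.inr τ)
    obtain ⟨p, hp, h⟩ := hit2 i τ hi h0 h1
    exact ⟨i + 1, p, hp, h⟩
  have hpi := Real.two_pi_pos
  have h00 : hP Q 0 = 0 := hP_node hVQ hVQ.zero
  have h11 : hP Q (2 * π) = 2 * π := hP_node hVQ hVQ.top
  have hmaps : ∀ t ∈ Set.Icc 0 (2 * π), hP Q t ∈ Set.Icc 0 (2 * π) := fun t ht =>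
    ⟨hP_ge hVQ hVQ.zero ht.1, hP_le hVQ hVQ.top ht.1 ht.2⟩
  have hstrict : StrictMonoOn (hP Q) (Set.Icc 0 (2 * π)) := by
    intro s hs t ht hst
    obtain ⟨a, ha1, ha2⟩ := exists_rat_btwn hst
    obtain ⟨b, hb1, hb2⟩ := exists_rat_btwn ha2
    obtain ⟨p, hp, hpa⟩ := hT a (by linarith [hs.1]) (by linarith [ht.2])
    obtain ⟨q, hq, hqb⟩ := hT b (by linarith [hs.1]) (by linarith [ht.2])
    have h1 := hP_le hVQ hp hs.1 (by rw [hpa]; exact ha1.le)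
    have h2 := hP_ge hVQ hq (t := t) (by rw [hqb]; exact hb2.le)
    have h3 : p.2 < q.2 := (hVQ.mono p hp q hq).1 (by rw [hpa, hqb]; exact hb1)
    linarith
  have hcont : ContinuousOn (hP Q) (Set.Icc 0 (2 * π)) := by
    rw [continuousOn_iff_continuous_domRestrict]
    let k : Set.Icc 0 (2 * π) → Set.Icc 0 (2 * π) := fun t => ⟨hP Q t, hmaps t t.2⟩
    have hk : Monotone k := fun s t hst => hstrict.monotoneOn s.2 t.2 hst
    haveI : Nontrivial (Set.Icc (0:ℝ) (2 * π)) :=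
      ⟨⟨⟨0, le_rfl, hpi.le⟩, ⟨2 * π, hpi.le, le_rfl⟩, fun h => hpi.ne (congrArg Subtype.val h)⟩⟩
    have hd : DenseRange k := by
      rw [DenseRange, dense_iff_exists_between]
      intro x y hxy
      obtain ⟨a, ha1, ha2⟩ := exists_rat_btwn (show (x : ℝ) < y from hxy)
      have ha0 : (0 : ℝ) < a := by linarith [x.2.1]
      have ha3 : (a : ℝ) < 2 * π := by linarith [y.2.2]
      obtain ⟨i, p, hp, hpa⟩ := hX a ha0 ha3
      refine ⟨⟨a, ha0.le, ha3.le⟩, ⟨⟨p.1, (hV i).mem p hp⟩, ?_⟩, ha1, ha2⟩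
      apply Subtype.ext
      simp only [k]
      rw [hP_node hVQ (hsubQ i p hp), hpa]
    exact continuous_subtype_val.comp (hk.continuous_of_denseRange hd)
  have hOsc : ∀ ε, 0 < ε → ∃ i0, ∀ i, i0 ≤ i → Osc F (P i) ε := by
    intro ε hε
    have huc := (isCompact_Icc (a := (0 : ℝ)) (b := 2 * π)).uniformContinuousOn_of_continuous hc.continuousOn
    obtain ⟨δ, hδ, hδε⟩ := Metric.uniformContinuousOn_iff.1 huc ε hε
    obtain ⟨r, hr0, hr1⟩ := exists_rat_btwn hδ
    have hr0' : (0 : ℚ) < r := by exact_mod_cast hr0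
    obtain ⟨M, hM⟩ := exists_nat_gt (2 * π / r)
    have hfin : ∀ᶠ i in Filter.atTop, ∀ k ∈ Finset.range M, (0 : ℝ) < k * r → (k * r : ℝ) < 2 * π → ∃ p ∈ P i, p.2 = k * r := by
      rw [Filter.eventually_all_finset]
      intro k _
      by_cases hk : (0 : ℝ) < k * r ∧ (k * r : ℝ) < 2 * π
      · obtain ⟨i, p, hp, hpk⟩ := hX (k * r) (by push_cast; exact hk.1) (by push_cast; exact hk.2)
        filter_upwards [Filter.eventually_ge_atTop i] with j hj _ _
        exact ⟨p, hmono hj hp, by rw [hpk]; push_cast; rfl⟩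
      · filter_upwards with j h1 h2
        exact absurd ⟨h1, h2⟩ hk
    obtain ⟨i0, hi0⟩ := Filter.eventually_atTop.1 hfin
    refine ⟨i0, fun i hi p q hA x hx => ?_⟩
    have hp2 := (hV i).mem2 hA.1
    have hq2 := (hV i).mem2 hA.2.1
    have hgap : q.2 - p.2 < δ := by
      by_contra hcon
      push Not at hcon
      set k := ⌊p.2 / r⌋₊ + 1 with hk
      have k1 : p.2 < k * r := by
        rw [← div_lt_iff₀ hr0, hk]
        push_cast
        exact Nat.lt_floor_add_one _
      have k2 : k * r ≤ p.2 + r := by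
        have := Nat.floor_le (div_nonneg hp2.1 hr0.le)
        rw [le_div_iff₀ hr0] at this
        rw [hk]; push_cast; linarith
      have k3 : (k * r : ℝ) < q.2 := by linarith
      have kM : k < M := by
        have : (k : ℝ) < M := by
          refine lt_trans ?_ hM
          rw [lt_div_iff₀ hr0]
          linarith
        exact_mod_cast this
      obtain ⟨s, hs, hsk⟩ := hi0 i hi k (Finset.mem_range.2 kM) (by linarith) (by linarith)
      rcases hA.2.2.2 s hs with h' | h'
      · have := ((hV i).mono_le hs hA.1).1 h'
        linarith
      · have := ((hV i).mono_le hA.2.1 hs).1 h'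
        linarith
    have := hδε x ⟨by linarith [hx.1], by linarith [hx.2]⟩ p.2 hp2 (by
      rw [Real.dist_eq, abs_of_nonneg (by linarith [hx.1])]; linarith [hx.2])
    rw [Real.dist_eq] at this
    exact this.le
  have hunif : ∀ i J, 0 ≤ J → Osc F (P i) J → ∀ t ∈ Set.Icc 0 (2 * π),
      |F (hP Q t) - F (hP (P i) t)| ≤ J := by
    intro i J hJ0 hJ t ht
    rcases ht.2.eq_or_lt with h' | h'
    · have : hP (P i) (2 * π) = 2 * π := hP_node (hV i) (hV i).top
      rw [h', h11, this, sub_self, abs_zero]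
      exact hJ0
    · obtain ⟨p, q, hA, h1, h2⟩ := exists_adj (hV i) ht.1 h'
      have : hP (P i) t = p.2 := by
        apply hP_eq (hV i) hA.1 h1
        intro s hs hst
        rcases hA.2.2.2 s hs with h3 | h3
        · exact h3
        · linarith
      rw [this]
      exact hJ p q hA _ ⟨hP_ge hVQ (hsubQ i p hA.1) h1, hP_le hVQ (hsubQ i q hA.2.1) ht.1 h2.le⟩
  have hgint : IntervalIntegrable (fun t => F (hP Q t)) MeasureTheory.volume 0 (2 * π) := by
    apply ContinuousOn.intervalIntegrable
    rw [Set.uIcc_of_le hpi.le]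
    exact hc.comp_continuousOn hcont
  have hlim : ∀ n t, Filter.Tendsto (fun i => S n (fun t => F (hP (P i) t)) t) Filter.atTop
      (nhds (S n (fun t => F (hP Q t)) t)) := by
    intro n t
    rw [Metric.tendsto_atTop]
    intro ε hε
    obtain ⟨i0, hi0⟩ := hOsc (ε / (2 * (2 * n + 1))) (by positivity)
    refine ⟨i0, fun i hi => ?_⟩
    have := S_close n hgint (u_int F hF (hV i)) (hunif i _ (by positivity) (hi0 i hi)) t
    rw [dist_comm, Real.dist_eq]
    refine this.trans_lt ?_
    have : (2 * n + 1 : ℝ) * (ε / (2 * (2 * n + 1))) = ε / 2 := by field_simp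
    rw [this]
    linarith
  have htail : ∀ j n, n ≤ N j → ∀ t, |S n (fun t => F (hP Q t)) t - S n (fun t => F (hP (P j) t)) t| ≤ 2 * (1 / 2) ^ j := by
    intro j n hn t
    have hpart : ∀ m, |S n (fun t => F (hP (P (j + m)) t)) t - S n (fun t => F (hP (P j) t)) t| ≤ 2 * (1 / 2) ^ j - 2 * (1 / 2) ^ (j + m) := by
      intro m
      induction m with
      | zero => simp
      | succ m ih =>
        have h1 := hS2 (j + m) n (hn.trans (hNm.monotone (Nat.le_add_right _ _))) t
        have h2 := abs_sub_le (S n (fun t => F (hP (P (j + m + 1)) t)) t) (S n (fun t => F (hP (P (j + m)) t)) t) (S n (fun t => F (hP (P j) t)) t)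
        rw [← add_assoc, pow_succ]
        linarith
    have h1 : Filter.Tendsto (fun m => |S n (fun t => F (hP (P (j + m)) t)) t - S n (fun t => F (hP (P j) t)) t|) Filter.atTop
        (nhds |S n (fun t => F (hP Q t)) t - S n (fun t => F (hP (P j) t)) t|) := by
      have := (hlim n t).comp (Filter.tendsto_add_atTop_nat j)
      have := (this.sub_const (S n (fun t => F (hP (P j) t)) t)).abs
      refine this.congr fun m => ?_
      simp only [Function.comp, add_comm m j]
    refine le_of_tendsto' h1 fun m => (hpart m).trans ?_
    have : (0 : ℝ) ≤ (1 / 2) ^ (j + m) := by positivity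
    linarith
  refine ⟨hP Q, hstrict, hcont, h00, h11, fun ε hε => ?_⟩
  obtain ⟨i0, hi0⟩ := hOsc (ε / 30) (by positivity)
  obtain ⟨i1, hi1⟩ := exists_pow_lt_of_lt_one (show 0 < ε / 30 by positivity) (show (1 / 2 : ℝ) < 1 by norm_num)
  set j0 := max i0 i1 with hj0
  refine ⟨N j0, fun n hn t ht => ?_⟩
  obtain ⟨j, hj, hjn, hnj⟩ : ∃ j, j0 ≤ j ∧ N j ≤ n ∧ n ≤ N (j + 1) := by
    have hex : ∃ m, n < N m := ⟨n + 1, lt_of_lt_of_le (Nat.lt_succ_self n) (hNm.id_le _)⟩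
    have hf := Nat.find_spec hex
    have hmin : ∀ m, m < Nat.find hex → N m ≤ n := fun m hm => not_lt.1 (Nat.find_min hex hm)
    have hgt : j0 < Nat.find hex := by
      by_contra hcon
      push Not at hcon
      have := hNm.monotone hcon
      omega
    refine ⟨Nat.find hex - 1, by omega, hmin _ (by omega), ?_⟩
    rw [Nat.sub_add_cancel (by omega)]
    exact hf.le
  have hO := hi0 j ((le_max_left _ _).trans hj)
  have hpw : (1 / 2 : ℝ) ^ j < ε / 30 :=
    (pow_le_pow_of_le_one (by norm_num) (by norm_num) ((le_max_right _ _).trans hj)).trans_lt hi1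
  have hε30 : 0 ≤ ε / 30 := by positivity
  have a1 := htail (j + 1) n hnj t
  rw [pow_succ] at a1
  have a2 := hS1 j n t _ hε30 hO
  have a3 := hS3 j n hjn _ hε30 hO t ht
  have a4 := hunif j _ hε30 hO t ht
  rw [abs_le] at a1 a2 a3 a4
  rw [abs_lt]
  constructor <;> linarith [a1.1, a1.2, a2.1, a2.2, a3.1, a3.2, a4.1, a4.2]

lemma exp_sum (n : ℕ) (v : ℝ) :
    ∑ k ∈ Finset.Icc (-(n : ℤ)) (n : ℤ), Complex.exp (k * v * Complex.I) = ((Dk n v : ℝ) : ℂ) := by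
  induction n with
  | zero => simp [Dk]
  | succ n ih =>
    have e : Finset.Icc (-((n + 1 : ℕ) : ℤ)) ((n + 1 : ℕ) : ℤ) =
        insert (-((n + 1 : ℕ) : ℤ)) (insert ((n + 1 : ℕ) : ℤ) (Finset.Icc (-(n : ℤ)) (n : ℤ))) := by
      ext k
      simp only [Finset.mem_Icc, Finset.mem_insert]
      omega
    rw [e, Finset.sum_insert, Finset.sum_insert, ih]
    · unfold Dk
      rw [Finset.sum_range_succ]
      have : (2 : ℂ) * Complex.cos (((n : ℂ) + 1) * v) = Complex.exp (((n : ℂ) + 1) * v * Complex.I) + Complex.exp (-(((n : ℂ) + 1) * v) * Complex.I) :=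
        Complex.two_cos _
      have a1 : Complex.exp (((-((n + 1 : ℕ) : ℤ) : ℤ) : ℂ) * v * Complex.I) =
          Complex.exp (-(((n : ℂ) + 1) * v) * Complex.I) := by
        congr 1; push_cast; ring
      have a2 : Complex.exp ((((n + 1 : ℕ) : ℤ) : ℂ) * v * Complex.I) =
          Complex.exp (((n : ℂ) + 1) * v * Complex.I) := by
        congr 1; push_cast; ring
      rw [a1, a2]
      push_cast
      rw [mul_add, this]
      ring
    · simp
    · simp only [Finset.mem_Icc, Finset.mem_insert]
      omega

lemma S_fourier [inst : Fact ((0 : ℝ) < 2 * π)] (g : AddCircle (2 * π) → ℝ) (u : ℝ → ℝ)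
    (hu : ContinuousOn u (Set.Icc 0 (2 * π)))
    (hg : ∀ x ∈ Set.Ico 0 (2 * π), g (x : AddCircle (2 * π)) = u x) (n : ℕ) (t : ℝ) :
    ∑ k ∈ Finset.Icc (-(n : ℤ)) (n : ℤ),
      fourierCoeff (fun s => ((g s : ℝ) : ℂ)) k * fourier k (t : AddCircle (2 * π)) =
      ((S n u t : ℝ) : ℂ) := by
  have hpi := Real.two_pi_pos
  have hcoef : ∀ k : ℤ, fourierCoeff (fun s => ((g s : ℝ) : ℂ)) k * fourier k (t : AddCircle (2 * π)) =
      (1 / (2 * π) : ℂ) * ∫ x in (0 : ℝ)..(2 * π), (u x : ℂ) * Complex.exp (k * ((t - x : ℝ) : ℂ) * Complex.I) := by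
    intro k
    rw [fourierCoeff_eq_intervalIntegral _ k 0, zero_add, Complex.real_smul, mul_assoc,
      ← intervalIntegral.integral_mul_const]
    congr 1
    · push_cast; rfl
    apply intervalIntegral.integral_congr_ae
    have : ∀ᵐ x : ℝ, x ≠ 2 * π := by simp [MeasureTheory.ae_iff]
    filter_upwards [this] with x hx hxm
    rw [Set.uIoc_of_le hpi.le] at hxm
    rw [hg x ⟨hxm.1.le, lt_of_le_of_ne hxm.2 hx⟩, fourier_coe_apply, fourier_coe_apply, smul_eq_mul,
      mul_comm _ (u x : ℂ), mul_assoc, ← Complex.exp_add]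
    congr 2
    have : (π : ℂ) ≠ 0 := by exact_mod_cast Real.pi_ne_zero
    push_cast
    field_simp
    ring
  have huC : ContinuousOn (fun x => (u x : ℂ)) (Set.uIcc 0 (2 * π)) := by
    rw [Set.uIcc_of_le hpi.le]
    exact Complex.continuous_ofReal.comp_continuousOn hu
  rw [Finset.sum_congr rfl fun k _ => hcoef k, ← Finset.mul_sum, ← intervalIntegral.integral_finsetSum]
  · unfold S
    push_cast
    congr 1
    rw [← intervalIntegral.integral_ofReal]
    apply intervalIntegral.integral_congr
    intro x _
    simp only
    have h3 := exp_sum n (t - x)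
    push_cast at h3 ⊢
    rw [← Finset.mul_sum, h3]
  · intro k _
    apply ContinuousOn.intervalIntegrable
    apply huC.mul
    fun_prop

lemma circle_homeo [inst : Fact ((0 : ℝ) < 2 * π)] (h : ℝ → ℝ)
    (hs : StrictMonoOn h (Set.Icc 0 (2 * π))) (hc : ContinuousOn h (Set.Icc 0 (2 * π)))
    (h0 : h 0 = 0) (h1 : h (2 * π) = 2 * π) :
    ∃ k : AddCircle (2 * π) ≃ₜ AddCircle (2 * π),
      ∀ x ∈ Set.Ico 0 (2 * π), k (x : AddCircle (2 * π)) = (h x : AddCircle (2 * π)) := by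
  have hpi := Real.two_pi_pos
  let w : ℝ → AddCircle (2 * π) := fun x => (h x : AddCircle (2 * π))
  have hw : ContinuousOn w (Set.Icc 0 (2 * π)) :=
    (AddCircle.continuous_mk' (2 * π)).comp_continuousOn hc
  have hend : w 0 = w (2 * π) := by
    show ((h 0 : ℝ) : AddCircle (2 * π)) = ((h (2 * π) : ℝ) : AddCircle (2 * π))
    rw [h0, h1, AddCircle.coe_period]; rfl
  have hcont : Continuous (AddCircle.liftIco (2 * π) 0 w) :=
    AddCircle.liftIco_zero_continuous hend hw
  have hval : ∀ x ∈ Set.Ico 0 (2 * π), AddCircle.liftIco (2 * π) 0 w (x : AddCircle (2 * π)) = w x :=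
    fun x hx => AddCircle.liftIco_zero_coe_apply hx
  have hrep : ∀ y : AddCircle (2 * π), ∃ x ∈ Set.Ico 0 (2 * π), (x : AddCircle (2 * π)) = y := by
    intro y
    obtain ⟨ha, hb⟩ := (AddCircle.equivIco (2 * π) 0 y).2
    exact ⟨_, ⟨ha, by linarith⟩, (AddCircle.equivIco (2 * π) 0).symm_apply_apply y⟩
  have hmaps : ∀ x ∈ Set.Ico 0 (2 * π), h x ∈ Set.Ico 0 (2 * π) := by
    intro x hx
    constructor
    · rw [← h0]; exact hs.monotoneOn ⟨le_rfl, hpi.le⟩ ⟨hx.1, hx.2.le⟩ hx.1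
    · rw [← h1]
      conv_rhs => rw [h1]
      rw [← h1]
      exact hs ⟨hx.1, hx.2.le⟩ ⟨hpi.le, le_rfl⟩ hx.2
  have hbij : Function.Bijective (AddCircle.liftIco (2 * π) 0 w) := by
    constructor
    · intro y z hyz
      obtain ⟨a, ha, rfl⟩ := hrep y
      obtain ⟨b, hb, rfl⟩ := hrep z
      rw [hval a ha, hval b hb] at hyz
      have := (AddCircle.coe_eq_coe_iff_of_mem_Ico (p := 2 * π) (a := 0) (by rw [zero_add]; exact hmaps a ha)
        (by rw [zero_add]; exact hmaps b hb)).1 hyz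
      rw [hs.injOn ⟨ha.1, ha.2.le⟩ ⟨hb.1, hb.2.le⟩ this]
    · intro y
      obtain ⟨b, hb, rfl⟩ := hrep y
      have := intermediate_value_Ico hpi.le hc
      rw [h0, h1] at this
      obtain ⟨a, ha, hab⟩ := this hb
      exact ⟨(a : AddCircle (2 * π)), by rw [hval a ha]; simp [w, hab]⟩
  have hH : IsHomeomorph (AddCircle.liftIco (2 * π) 0 w) :=
    isHomeomorph_iff_continuous_bijective.2 ⟨hcont, hbij⟩
  exact ⟨hH.homeomorph _, fun x hx => hval x hx⟩

end BP

/-- **The Bohr–Pál theorem.** For every continuous real-valued `f` on the circle there is a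
homeomorphism `h` of the circle such that the Fourier series of `g = f ∘ h` converges
uniformly to `g`. -/
theorem bohr_pal
    [inst : Fact ((0 : ℝ) < 2 * π)]
    (f : AddCircle (2 * π) → ℝ) (hf : Continuous f) :
    ∃ h : AddCircle (2 * π) ≃ₜ AddCircle (2 * π),
      ∀ ε : ℝ, 0 < ε → ∃ N : ℕ, ∀ n : ℕ, N ≤ n → ∀ t : AddCircle (2 * π),
        ‖(∑ k ∈ Finset.Icc (-(n : ℤ)) (n : ℤ),
            fourierCoeff (fun s => ((f (h s) : ℝ) : ℂ)) k * fourier k t) -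
          ((f (h t) : ℝ) : ℂ)‖ < ε := by
  have hFc : Continuous fun x : ℝ => f (x : AddCircle (2 * π)) :=
    hf.comp (AddCircle.continuous_mk' (2 * π))
  obtain ⟨h, hs, hc, h0, h1, hconv⟩ := BP.main_real (fun x : ℝ => f (x : AddCircle (2 * π))) hFc
    (by rw [AddCircle.coe_period]; rfl)
  obtain ⟨k, hk⟩ := BP.circle_homeo h hs hc h0 h1
  refine ⟨k, fun ε hε => ?_⟩
  obtain ⟨N, hN⟩ := hconv ε hε
  refine ⟨N, fun n hn t => ?_⟩
  have hrep : ∃ x ∈ Set.Ico 0 (2 * π), (x : AddCircle (2 * π)) = t := by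
    obtain ⟨ha, hb⟩ := (AddCircle.equivIco (2 * π) 0 t).2
    exact ⟨_, ⟨ha, by linarith⟩, (AddCircle.equivIco (2 * π) 0).symm_apply_apply t⟩
  obtain ⟨x, hx, rfl⟩ := hrep
  have e := BP.S_fourier (fun s => f (k s)) (fun x => f (h x : AddCircle (2 * π)))
    (hFc.comp_continuousOn hc) (fun x hx => by rw [hk x hx]) n x
  rw [e, hk x hx, ← Complex.ofReal_sub, Complex.norm_real, Real.norm_eq_abs]
  exact hN n hn x ⟨hx.1, hx.2.le⟩
end
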